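/- For any fixed real A > 0 and any fixed integer k ≥ 0 there exists a constant C_{A,k}, depending only on A and k, such that for all T ≥ 3: (1/T) · ∫_T^{2T} (N(t + A/log T) − N(t))^k dt ≤ C_{A,k}, where the integral is over t ∈ [T, 2T]. -/

import Mathlib

open MeasureTheory Filter Topology

/-- The order of vanishing of the Riemann zeta function at `ρ`: the least `m` such that the
`m`-th derivative of `ζ` does not vanish at `ρ` (so a zero counts with its multiplicity). -/
noncomputable def zetaZeroOrder (ρ : ℂ) : ℕ :=
  sInf {m : ℕ | iteratedDeriv m riemannZeta ρ ≠ 0}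

/-- `N(t)`: the number of nontrivial zeros `ρ` of `ζ` (i.e. `0 < Re ρ < 1`) with
`0 < Im ρ ≤ t`, counted with multiplicity. -/
noncomputable def zetaN (t : ℝ) : ℝ :=
  ∑' ρ : {z : ℂ // riemannZeta z = 0 ∧ 0 < z.re ∧ z.re < 1 ∧ 0 < z.im ∧ z.im ≤ t},
    (zetaZeroOrder ρ : ℝ)

open ArithmeticFunction in
/-- The Möbius function restricted to integers coprime to `q`. -/
noncomputable def coprimeMoebius (q : ℕ) : ArithmeticFunction ℝ :=
  ⟨fun m => if m.Coprime q then ((moebius m : ℤ) : ℝ) else 0, by simp⟩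

/-- The indicator function of the integers all of whose prime factors divide `q`. -/
noncomputable def factoredIndicator (q : ℕ) : ArithmeticFunction ℝ :=
  ⟨fun n => if n ≠ 0 ∧ n.primeFactors ⊆ q.primeFactors then 1 else 0, by simp⟩

/-- The Euler factor `∏ (1 - 1/p)⁻¹` over the primes dividing `q`, i.e. `q / φ(q)`. -/
noncomputable def eulerFactor (q : ℕ) : ℝ := ∏ p ∈ q.primeFactors, (1 - (p : ℝ)⁻¹)⁻¹

theorem coprimeMoebius_isMultiplicative (q : ℕ) : (coprimeMoebius q).IsMultiplicative := by
  constructor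
  · simp [coprimeMoebius]
  · intro m n hmn
    simp only [coprimeMoebius, ArithmeticFunction.coe_mk, Nat.coprime_mul_iff_left,
      ArithmeticFunction.isMultiplicative_moebius.map_mul_of_coprime hmn]
    split_ifs <;> simp_all

theorem factoredIndicator_isMultiplicative (q : ℕ) :
    (factoredIndicator q).IsMultiplicative := by
  rw [ArithmeticFunction.IsMultiplicative.iff_ne_zero]
  constructor
  · simp [factoredIndicator]
  · intro m n hm hn hmn
    simp only [factoredIndicator, ArithmeticFunction.coe_mk, Nat.primeFactors_mul hm hn,
      Finset.union_subset_iff]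
    split_ifs <;> simp_all

theorem coprimeMoebius_mul_zeta (q : ℕ) (hq : q ≠ 0) :
    coprimeMoebius q * (ArithmeticFunction.zeta : ArithmeticFunction ℝ) = factoredIndicator q := by
  rw [ArithmeticFunction.IsMultiplicative.eq_iff_eq_on_prime_powers _
    ((coprimeMoebius_isMultiplicative q).mul
      ArithmeticFunction.isMultiplicative_zeta.natCast) _
    (factoredIndicator_isMultiplicative q)]
  intro p i hp
  rw [ArithmeticFunction.coe_mul_zeta_apply, Nat.sum_divisors_prime_pow hp]
  rcases i with _ | i
  · simp [factoredIndicator, coprimeMoebius]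
  · rw [Finset.sum_range_succ', Finset.sum_range_succ']
    have h0 : ∀ k ∈ Finset.range i, coprimeMoebius q (p ^ (k + 1 + 1)) = 0 := by
      intro k _
      simp [coprimeMoebius, ArithmeticFunction.moebius_apply_prime_pow hp]
    rw [Finset.sum_eq_zero h0]
    have := hp.ne_zero
    by_cases hpq : p ∣ q
    · have : ¬ p.Coprime q := by rwa [hp.coprime_iff_not_dvd, not_not]
      simp [factoredIndicator, coprimeMoebius, Nat.primeFactors_prime_pow (Nat.succ_ne_zero i) hp,
        hp, hpq, hq, this, hp.ne_zero]
    · have : p.Coprime q := by rwa [hp.coprime_iff_not_dvd]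
      simp [factoredIndicator, coprimeMoebius, Nat.primeFactors_prime_pow (Nat.succ_ne_zero i) hp,
        hp, hpq, hq, ArithmeticFunction.moebius_apply_prime hp]
      rw [if_pos this]
      norm_num

theorem abs_coprimeMoebius_le_one (q m : ℕ) : |coprimeMoebius q m| ≤ 1 := by
  simp only [coprimeMoebius, ArithmeticFunction.coe_mk]
  split_ifs
  · exact_mod_cast ArithmeticFunction.abs_moebius_le_one
  · simp

theorem factoredIndicator_nonneg (q n : ℕ) : 0 ≤ factoredIndicator q n := by
  simp only [factoredIndicator, ArithmeticFunction.coe_mk]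
  split_ifs <;> simp

theorem factoredIndicator_le_one (q n : ℕ) : factoredIndicator q n ≤ 1 := by
  simp only [factoredIndicator, ArithmeticFunction.coe_mk]
  split_ifs <;> simp

theorem sum_factoredIndicator_div_le (q N : ℕ) :
    ∑ n ∈ Finset.Ioc 0 N, factoredIndicator q n / n ≤ eulerFactor q := by
  let f : ℕ →* ℝ :=
    { toFun := fun n => (n : ℝ)⁻¹, map_one' := by simp, map_mul' := by intros; simp [mul_comm] }
  have hf : ∀ {p : ℕ}, p.Prime → ‖f p‖ < 1 := by
    intro p hp
    have : (1 : ℝ) < p := by exact_mod_cast hp.one_lt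
    simp only [f, MonoidHom.coe_mk, OneHom.coe_mk, norm_inv, RCLike.norm_natCast]
    exact inv_lt_one_of_one_lt₀ this
  have h := (EulerProduct.summable_and_hasSum_factoredNumbers_prod_filter_prime_geometric hf
    q.primeFactors).2
  have hP : (∏ p ∈ q.primeFactors with Nat.Prime p, (1 - f p)⁻¹) = eulerFactor q := by
    rw [Finset.filter_true_of_mem (fun p hp => Nat.prime_of_mem_primeFactors hp)]
    rfl
  rw [hP] at h
  have h1 : HasSum (fun n : ℕ => (Nat.factoredNumbers q.primeFactors).indicator
      (fun n : ℕ => (n : ℝ)⁻¹) n) (eulerFactor q) := by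
    rw [← hasSum_subtype_iff_indicator]
    exact h
  refine le_trans (Finset.sum_le_sum ?_) (sum_le_hasSum (Finset.Ioc 0 N) ?_ h1)
  · intro n hn
    simp only [factoredIndicator, ArithmeticFunction.coe_mk]
    split_ifs with hc
    · rw [Set.indicator_of_mem]
      · simp
      · rw [Nat.mem_factoredNumbers]
        exact ⟨hc.1, fun p hp => hc.2 (by simpa [Nat.mem_primeFactors, hc.1] using hp)⟩
    · simp only [zero_div]
      exact Set.indicator_nonneg (fun _ _ => by positivity) _
  · intro n _
    exact Set.indicator_nonneg (fun _ _ => by positivity) _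

theorem one_le_eulerFactor (q : ℕ) : 1 ≤ eulerFactor q := by
  calc (1 : ℝ) = ∏ _p ∈ q.primeFactors, (1 : ℝ) := by simp
    _ ≤ _ := Finset.prod_le_prod (fun _ _ => zero_le_one) (fun p hp => ?_)
  have h1 : (1 : ℝ) < p := by exact_mod_cast (Nat.prime_of_mem_primeFactors hp).one_lt
  have h2 := inv_lt_one_of_one_lt₀ h1
  have h3 : 0 < (p : ℝ)⁻¹ := by positivity
  exact (one_le_inv₀ (by linarith)).mpr (by linarith)

theorem abs_sum_coprimeMoebius_div_le (q N : ℕ) (hq : q ≠ 0) :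
    |∑ m ∈ Finset.Ioc 0 N, coprimeMoebius q m / m| ≤ 2 := by
  rcases Nat.eq_zero_or_pos N with rfl | hN
  · simp
  have h := ArithmeticFunction.sum_Ioc_mul_zeta_eq_sum (coprimeMoebius q) N
  rw [coprimeMoebius_mul_zeta q hq] at h
  have h1 : |∑ n ∈ Finset.Ioc 0 N, factoredIndicator q n| ≤ N := by
    rw [abs_of_nonneg (Finset.sum_nonneg fun n _ => factoredIndicator_nonneg q n)]
    refine (Finset.sum_le_card_nsmul _ _ 1 fun n _ => factoredIndicator_le_one q n).trans ?_
    simp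
  have h2 : |∑ n ∈ Finset.Ioc 0 N, coprimeMoebius q n * ((N : ℝ) / n - ((N / n : ℕ) : ℝ))|
      ≤ N := by
    refine (Finset.abs_sum_le_sum_abs _ _).trans ?_
    refine (Finset.sum_le_card_nsmul _ _ 1 fun n hn => ?_).trans (by simp)
    rw [abs_mul]
    have hn0 : 0 < n := (Finset.mem_Ioc.mp hn).1
    have ha : ((N / n : ℕ) : ℝ) ≤ (N : ℝ) / n := Nat.cast_div_le
    have hb : (N : ℝ) / n ≤ ((N / n : ℕ) : ℝ) + 1 := by
      have := Nat.lt_floor_add_one ((N : ℝ) / n)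
      rw [Nat.floor_div_eq_div] at this
      exact this.le
    refine mul_le_one₀ (abs_coprimeMoebius_le_one q n) (abs_nonneg _) ?_
    rw [abs_le]; constructor <;> linarith
  have h3 : (N : ℝ) * ∑ m ∈ Finset.Ioc 0 N, coprimeMoebius q m / m =
      ∑ n ∈ Finset.Ioc 0 N, factoredIndicator q n +
      ∑ n ∈ Finset.Ioc 0 N, coprimeMoebius q n * ((N : ℝ) / n - ((N / n : ℕ) : ℝ)) := by
    rw [h, Finset.mul_sum, ← Finset.sum_add_distrib]
    refine Finset.sum_congr rfl fun n _ => by ring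
  have hN' : (0 : ℝ) < N := by exact_mod_cast hN
  have h4 : (N : ℝ) * |∑ m ∈ Finset.Ioc 0 N, coprimeMoebius q m / m| ≤ N * 2 := by
    rw [← abs_of_pos hN', ← abs_mul, abs_of_pos hN', h3]
    exact (abs_add_le _ _).trans (by linarith)
  exact le_of_mul_le_mul_left h4 hN'

theorem abs_harmonic_floor_sub_log_le (y : ℝ) (hy : 1 ≤ y) :
    |(harmonic ⌊y⌋₊ : ℝ) - Real.log y - Real.eulerMascheroniConstant| ≤ 2 / y := by
  set n := ⌊y⌋₊ with hn
  have hn1 : 1 ≤ n := (Nat.one_le_floor_iff y).mpr hy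
  have hn0 : (0 : ℝ) < n := by exact_mod_cast hn1
  have hny : (n : ℝ) ≤ y := Nat.floor_le (by linarith)
  have hyn : y < n + 1 := Nat.lt_floor_add_one y
  have h1 := Real.eulerMascheroniSeq_lt_eulerMascheroniConstant n
  have h2 := Real.eulerMascheroniConstant_lt_eulerMascheroniSeq' n
  simp only [Real.eulerMascheroniSeq, Real.eulerMascheroniSeq', if_neg (by omega : ¬ n = 0)]
    at h1 h2
  have h3 : Real.log n ≤ Real.log y := Real.log_le_log hn0 hny
  have h4 : Real.log y ≤ Real.log (n + 1) := Real.log_le_log (by linarith) hyn.le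
  have h5 : Real.log (n + 1) - Real.log n ≤ 1 / n := by
    rw [← Real.log_div (by positivity) (by positivity)]
    refine (Real.log_le_sub_one_of_pos (by positivity)).trans ?_
    rw [add_div, div_self hn0.ne']; simp
  have h6 : 1 / (n : ℝ) ≤ 2 / y := by
    rw [div_le_div_iff₀ hn0 (by linarith)]
    have : (1 : ℝ) ≤ n := by exact_mod_cast hn1
    linarith
  rw [abs_le]; constructor <;> linarith

theorem abs_sum_coprimeMoebius_mul_log_le (q : ℕ) (hq : q ≠ 0) (x : ℝ) (hx : 1 ≤ x) :
    |∑ m ∈ Finset.Ioc 0 ⌊x⌋₊, coprimeMoebius q m / m * Real.log (x / m)| ≤ 6 * eulerFactor q := by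
  set N := ⌊x⌋₊ with hN
  let f : ArithmeticFunction ℝ := ⟨fun m => coprimeMoebius q m / m, by simp⟩
  let g : ArithmeticFunction ℝ := ⟨fun m => (m : ℝ)⁻¹, by simp⟩
  have hfg : ∀ n, (f * g) n = factoredIndicator q n / n := by
    intro n
    rw [← coprimeMoebius_mul_zeta q hq, ArithmeticFunction.mul_apply,
      ArithmeticFunction.mul_apply, Finset.sum_div]
    refine Finset.sum_congr rfl fun p hp => ?_
    obtain ⟨h1, h2⟩ := Nat.mem_divisorsAntidiagonal.mp hp
    have h3 : p.2 ≠ 0 := by rintro h; simp [h] at h1; omega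
    simp [f, g, ← h1, h3]
    field_simp
  have h := ArithmeticFunction.sum_Ioc_mul_eq_sum_sum f g N
  simp only [hfg] at h
  have hH : ∀ m ∈ Finset.Ioc 0 N, ∑ k ∈ Finset.Ioc 0 (N / m), g k =
      (harmonic ⌊x / m⌋₊ : ℝ) := by
    intro m _
    rw [Nat.floor_div_natCast, harmonic_eq_sum_Icc]
    push_cast
    rfl
  have hsum : ∑ m ∈ Finset.Ioc 0 N, coprimeMoebius q m / m * Real.log (x / m) =
      ∑ n ∈ Finset.Ioc 0 N, factoredIndicator q n / n
      - Real.eulerMascheroniConstant * ∑ m ∈ Finset.Ioc 0 N, coprimeMoebius q m / m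
      - ∑ m ∈ Finset.Ioc 0 N, coprimeMoebius q m / m * ((harmonic ⌊x / m⌋₊ : ℝ) -
        Real.log (x / m) - Real.eulerMascheroniConstant) := by
    rw [h, Finset.mul_sum, ← Finset.sum_sub_distrib, ← Finset.sum_sub_distrib]
    refine Finset.sum_congr rfl fun m hm => ?_
    rw [hH m hm]
    simp only [f, ArithmeticFunction.coe_mk]
    ring
  have hx0 : 0 < x := by linarith
  have h1 : |∑ m ∈ Finset.Ioc 0 N, coprimeMoebius q m / m * ((harmonic ⌊x / m⌋₊ : ℝ) -
        Real.log (x / m) - Real.eulerMascheroniConstant)| ≤ 2 := by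
    refine (Finset.abs_sum_le_sum_abs _ _).trans ?_
    refine (Finset.sum_le_card_nsmul _ _ (2 / x) fun m hm => ?_).trans ?_
    · obtain ⟨hm0, hmN⟩ := Finset.mem_Ioc.mp hm
      have hm0' : (0 : ℝ) < m := by exact_mod_cast hm0
      have hmx : (m : ℝ) ≤ x := (Nat.le_floor_iff hx0.le).mp hmN
      have hb := abs_harmonic_floor_sub_log_le (x / m) (by rwa [one_le_div hm0'])
      rw [abs_mul, abs_div, abs_of_pos hm0']
      calc |coprimeMoebius q m| / m * |_| ≤ 1 / m * (2 / (x / m)) := by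
            gcongr
            exact abs_coprimeMoebius_le_one q m
        _ = 2 / x := by field_simp
    · simp only [Nat.card_Ioc, tsub_zero, nsmul_eq_mul]
      have : (N : ℝ) ≤ x := Nat.floor_le hx0.le
      rw [mul_div_assoc', div_le_iff₀ hx0]
      linarith
  have h2 := sum_factoredIndicator_div_le q N
  have h2' : 0 ≤ ∑ n ∈ Finset.Ioc 0 N, factoredIndicator q n / n :=
    Finset.sum_nonneg fun n _ => div_nonneg (factoredIndicator_nonneg q n) (by positivity)
  have h3 := abs_sum_coprimeMoebius_div_le q N hq
  have h4 := Real.eulerMascheroniConstant_lt_two_thirds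
  have h4' := Real.one_half_lt_eulerMascheroniConstant
  have h5 := one_le_eulerFactor q
  have h6 : |Real.eulerMascheroniConstant * ∑ m ∈ Finset.Ioc 0 N, coprimeMoebius q m / m|
      ≤ 2 := by
    rw [abs_mul, abs_of_pos (by linarith)]
    nlinarith
  rw [hsum]
  rw [abs_le] at h1 h6 ⊢
  constructor <;> linarith [h1.1, h1.2, h6.1, h6.2]

theorem abs_sum_coprimeMoebius_mul_posLog_le (q : ℕ) (hq : q ≠ 0) (N : ℕ) (x : ℝ) (hx0 : 0 ≤ x)
    (hxN : ⌊x⌋₊ ≤ N) :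
    |∑ m ∈ Finset.Ioc 0 N, coprimeMoebius q m / m * Real.posLog (x / m)| ≤ 6 * eulerFactor q := by
  rcases lt_or_ge x 1 with hx | hx
  · rw [Finset.sum_eq_zero]
    · have := one_le_eulerFactor q
      simp only [abs_zero]
      linarith
    · intro m hm
      have hm1 : (1 : ℝ) ≤ m := by exact_mod_cast (Finset.mem_Ioc.mp hm).1
      have h0 : Real.posLog (x / m) = 0 := by
        rw [Real.posLog_eq_zero_iff, abs_of_nonneg (by positivity)]
        exact (div_le_one (by linarith)).mpr (by linarith)
      rw [h0, mul_zero]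
  · refine le_trans (le_of_eq ?_) (abs_sum_coprimeMoebius_mul_log_le q hq x hx)
    congr 1
    symm
    have hsub : Finset.Ioc 0 ⌊x⌋₊ ⊆ Finset.Ioc 0 N :=
      Finset.Ioc_subset_Ioc_right hxN
    rw [← Finset.sum_subset_zero_on_sdiff hsub]
    · intro m hm
      rw [Finset.mem_sdiff, Finset.mem_Ioc, Finset.mem_Ioc] at hm
      have hm1 : ⌊x⌋₊ < m := by omega
      have hm2 : x < m := (Nat.floor_lt hx0).mp hm1
      have h0 : Real.posLog (x / m) = 0 := by
        rw [Real.posLog_eq_zero_iff, abs_of_nonneg (by positivity)]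
        exact (div_le_one (by linarith)).mpr hm2.le
      rw [h0, mul_zero]
    · intro m hm
      obtain ⟨hm0, hm1⟩ := Finset.mem_Ioc.mp hm
      have hmpos : (0 : ℝ) < m := by exact_mod_cast hm0
      have hm2 : (m : ℝ) ≤ x := (Nat.le_floor_iff hx0).mp hm1
      rw [Real.posLog_eq_log]
      rw [abs_of_nonneg (by positivity)]
      rwa [one_le_div hmpos]

/-- Taylor's formula for `L * exp (ε * L)` with integral remainder. -/
theorem mul_exp_eq_add_integral (ε L Λ : ℝ) (hL : L ≤ Λ) (hL0 : 0 ≤ L) :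
    L * Real.exp (ε * L) =
      L + ∫ l in (0 : ℝ)..Λ, (2 * ε + ε ^ 2 * l) * Real.exp (ε * l) * max 0 (L - l) := by
  have hcont : Continuous fun l : ℝ =>
      (2 * ε + ε ^ 2 * l) * Real.exp (ε * l) * max 0 (L - l) := by fun_prop
  rw [← intervalIntegral.integral_add_adjacent_intervals
    (hcont.intervalIntegrable 0 L) (hcont.intervalIntegrable L Λ)]
  have h2 : ∫ l in L..Λ, (2 * ε + ε ^ 2 * l) * Real.exp (ε * l) * max 0 (L - l) = 0 := by
    rw [intervalIntegral.integral_congr (g := fun _ => (0 : ℝ))]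
    · simp
    · intro l hl
      rw [Set.uIcc_of_le hL] at hl
      simp [max_eq_left (by linarith [hl.1] : L - l ≤ 0)]
  have h1 : ∫ l in (0 : ℝ)..L, (2 * ε + ε ^ 2 * l) * Real.exp (ε * l) * max 0 (L - l) =
      ∫ l in (0 : ℝ)..L, (2 * ε + ε ^ 2 * l) * Real.exp (ε * l) * (L - l) := by
    refine intervalIntegral.integral_congr fun l hl => ?_
    rw [Set.uIcc_of_le hL0] at hl
    simp [max_eq_right (by linarith [hl.2] : 0 ≤ L - l)]
  have h3 : ∫ l in (0 : ℝ)..L, (2 * ε + ε ^ 2 * l) * Real.exp (ε * l) * (L - l) =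
      ((1 + ε * L) * Real.exp (ε * L) * (L - L) + L * Real.exp (ε * L)) -
      ((1 + ε * 0) * Real.exp (ε * 0) * (L - 0) + 0 * Real.exp (ε * 0)) := by
    refine intervalIntegral.integral_eq_sub_of_hasDerivAt
      (f := fun l => (1 + ε * l) * Real.exp (ε * l) * (L - l) + l * Real.exp (ε * l)) ?_ ?_
    · intro l _
      have he : HasDerivAt (fun l : ℝ => Real.exp (ε * l)) (Real.exp (ε * l) * ε) l := by
        simpa using ((hasDerivAt_id l).const_mul ε).exp
      have ha : HasDerivAt (fun l : ℝ => 1 + ε * l) ε l := by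
        simpa using ((hasDerivAt_id l).const_mul ε).const_add 1
      have hb : HasDerivAt (fun l : ℝ => L - l) (-1) l := by
        simpa using (hasDerivAt_id l).const_sub L
      have := ((ha.fun_mul he).fun_mul hb).fun_add ((hasDerivAt_id' l).fun_mul he)
      convert this using 1
      ring
    · exact Continuous.intervalIntegrable (by fun_prop) _ _
  rw [h1, h2, h3]
  simp

theorem posLog_eq_max_log {x : ℝ} : Real.posLog x = max 0 (Real.log x) := rfl

theorem abs_sum_coprimeMoebius_rpow_mul_posLog_le (q : ℕ) (hq : q ≠ 0) (N : ℕ) (x ε : ℝ)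
    (hx0 : 0 ≤ x) (hxN : ⌊x⌋₊ ≤ N) (hε : 0 ≤ ε) (hεx : ε * Real.log x ≤ 1) :
    |∑ m ∈ Finset.Ioc 0 N, coprimeMoebius q m * (m : ℝ) ^ (-(1 + ε)) * Real.posLog (x / m)| ≤
      60 * eulerFactor q := by
  have hP := one_le_eulerFactor q
  rcases lt_or_ge x 1 with hx | hx
  · rw [Finset.sum_eq_zero]
    · simp only [abs_zero]
      linarith
    · intro m hm
      have hm1 : (1 : ℝ) ≤ m := by exact_mod_cast (Finset.mem_Ioc.mp hm).1
      have h0 : Real.posLog (x / m) = 0 := by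
        rw [Real.posLog_eq_zero_iff, abs_of_nonneg (by positivity)]
        exact (div_le_one (by linarith)).mpr (by linarith)
      rw [h0, mul_zero]
  set Λ := Real.log x with hΛ
  have hΛ0 : 0 ≤ Λ := Real.log_nonneg hx
  have hxpos : 0 < x := by linarith
  have hterm : ∀ m ∈ Finset.Ioc 0 N,
      coprimeMoebius q m * (m : ℝ) ^ (-(1 + ε)) * Real.posLog (x / m) =
      x ^ (-ε) * (coprimeMoebius q m / m * Real.posLog (x / m) +
        ∫ l in (0 : ℝ)..Λ, (2 * ε + ε ^ 2 * l) * Real.exp (ε * l) *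
          (coprimeMoebius q m / m * Real.posLog (x * Real.exp (-l) / m))) := by
    intro m hm
    have hm1 : (1 : ℝ) ≤ m := by exact_mod_cast (Finset.mem_Ioc.mp hm).1
    have hm0 : (0 : ℝ) < m := by linarith
    set L := Real.log (x / m) with hL
    have hLΛ : L ≤ Λ := Real.log_le_log (by positivity) (div_le_self hx0 hm1)
    have hint : ∀ l : ℝ, Real.posLog (x * Real.exp (-l) / m) = max 0 (L - l) := by
      intro l
      rw [posLog_eq_max_log, mul_div_right_comm, Real.log_mul (by positivity) (by positivity),
        Real.log_exp, ← sub_eq_add_neg]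
    rcases le_or_gt 0 L with hL0 | hL0
    · have hkey := mul_exp_eq_add_integral ε L Λ hLΛ hL0
      have hpos : Real.posLog (x / m) = L := by rw [posLog_eq_max_log]; exact max_eq_right hL0
      rw [hpos]
      have : (m : ℝ) ^ (-(1 + ε)) = x ^ (-ε) * (Real.exp (ε * L) / m) := by
        rw [hL, neg_add, Real.rpow_add hm0, Real.rpow_neg_one, Real.rpow_def_of_pos hm0,
          Real.rpow_def_of_pos hxpos, Real.log_div hxpos.ne' hm0.ne', mul_div_assoc',
          ← Real.exp_add]
        ring_nf
      rw [this]
      simp_rw [hint]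
      have h2 : ∫ l in (0 : ℝ)..Λ, (2 * ε + ε ^ 2 * l) * Real.exp (ε * l) *
          (coprimeMoebius q m / m * max 0 (L - l)) = coprimeMoebius q m / m *
          ∫ l in (0 : ℝ)..Λ, (2 * ε + ε ^ 2 * l) * Real.exp (ε * l) * max 0 (L - l) := by
        rw [← intervalIntegral.integral_const_mul]
        congr 1
        ext l
        ring
      rw [h2]
      have h3 : ∫ l in (0 : ℝ)..Λ, (2 * ε + ε ^ 2 * l) * Real.exp (ε * l) * max 0 (L - l) =
        L * Real.exp (ε * L) - L := by linarith
      rw [h3]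
      ring
    · have hpos : Real.posLog (x / m) = 0 := by rw [posLog_eq_max_log]; exact max_eq_left hL0.le
      rw [hpos, intervalIntegral.integral_congr (g := fun _ => (0 : ℝ))]
      · simp
      · intro l hl
        rw [Set.uIcc_of_le hΛ0] at hl
        simp only [hint, max_eq_left (by linarith [hl.1] : L - l ≤ 0), mul_zero]
  rw [Finset.sum_congr rfl hterm, ← Finset.mul_sum, Finset.sum_add_distrib, abs_mul]
  have hx1 : |x ^ (-ε)| ≤ 1 := by
    rw [abs_of_nonneg (by positivity)]
    exact Real.rpow_le_one_of_one_le_of_nonpos hx (by linarith)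
  have hcont : ∀ m ∈ Finset.Ioc 0 N, Continuous fun l : ℝ =>
      (2 * ε + ε ^ 2 * l) * Real.exp (ε * l) *
          (coprimeMoebius q m / m * Real.posLog (x * Real.exp (-l) / m)) := by
    intro m _
    have := Real.continuous_posLog
    fun_prop
  rw [← intervalIntegral.integral_finsetSum fun m hm => (hcont m hm).intervalIntegrable _ _]
  have hI : |∫ l in (0 : ℝ)..Λ, ∑ m ∈ Finset.Ioc 0 N, (2 * ε + ε ^ 2 * l) * Real.exp (ε * l) *
          (coprimeMoebius q m / m * Real.posLog (x * Real.exp (-l) / m))| ≤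
      (3 * ε * Real.exp 1) * (6 * eulerFactor q) * |Λ - 0| := by
    rw [← Real.norm_eq_abs]
    refine intervalIntegral.norm_integral_le_of_norm_le_const fun l hl => ?_
    rw [Set.uIoc_of_le hΛ0] at hl
    rw [← Finset.mul_sum, norm_mul, Real.norm_eq_abs, Real.norm_eq_abs]
    have hlε : ε * l ≤ 1 := (mul_le_mul_of_nonneg_left hl.2 hε).trans hεx
    have hε2 : 0 ≤ ε ^ 2 * l := mul_nonneg (sq_nonneg _) hl.1.le
    refine mul_le_mul ?_ ?_ (abs_nonneg _) (by positivity)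
    · rw [abs_of_nonneg (by positivity)]
      refine mul_le_mul ?_ (Real.exp_le_exp.mpr hlε) (by positivity) (by positivity)
      nlinarith
    · refine abs_sum_coprimeMoebius_mul_posLog_le q hq N _ (by positivity) ?_
      refine le_trans (Nat.floor_le_floor (mul_le_of_le_one_right hx0 ?_)) hxN
      exact Real.exp_le_one_iff.mpr (by linarith [hl.1])
  have hM := abs_sum_coprimeMoebius_mul_posLog_le q hq N x hx0 hxN
  have he : Real.exp 1 ≤ 3 := by linarith [Real.exp_one_lt_d9]
  have hI2 : (3 * ε * Real.exp 1) * (6 * eulerFactor q) * |Λ - 0| ≤ 54 * eulerFactor q := by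
    rw [sub_zero, abs_of_nonneg hΛ0]
    have : (3 * ε * Real.exp 1) * (6 * eulerFactor q) * Λ =
      (ε * Λ) * Real.exp 1 * (18 * eulerFactor q) := by ring
    rw [this]
    have h1 : (ε * Λ) * Real.exp 1 ≤ 1 * 3 := by
      refine mul_le_mul hεx (by linarith) (by positivity) (by norm_num)
    nlinarith
  have hs := abs_add_le (∑ m ∈ Finset.Ioc 0 N, coprimeMoebius q m / m * Real.posLog (x / m))
    (∫ l in (0 : ℝ)..Λ, ∑ m ∈ Finset.Ioc 0 N, (2 * ε + ε ^ 2 * l) * Real.exp (ε * l) *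
          (coprimeMoebius q m / m * Real.posLog (x * Real.exp (-l) / m)))
  refine (mul_le_of_le_one_left (abs_nonneg _) hx1).trans (hs.trans ?_)
  linarith

theorem prod_Icc_one_sub_inv_sq (N : ℕ) :
    ∏ n ∈ Finset.Icc 2 (N + 1), (1 - ((n : ℝ) ^ 2)⁻¹) = (N + 2) / (2 * (N + 1)) := by
  induction N with
  | zero => simp
  | succ N ih =>
    rw [Finset.prod_Icc_succ_top (by omega), ih]
    push_cast
    field_simp
    ring

theorem half_le_prod_one_sub_inv_sq (S : Finset ℕ) (hS : ∀ p ∈ S, 2 ≤ p) :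
    (1 / 2 : ℝ) ≤ ∏ p ∈ S, (1 - ((p : ℝ) ^ 2)⁻¹) := by
  have hb : ∀ n : ℕ, 2 ≤ n → 0 ≤ (1 - ((n : ℝ) ^ 2)⁻¹) ∧ (1 - ((n : ℝ) ^ 2)⁻¹) ≤ 1 := by
    intro n hn
    have h2 : (2 : ℝ) ≤ n := by exact_mod_cast hn
    have : ((n : ℝ) ^ 2)⁻¹ ≤ 1 := inv_le_one_of_one_le₀ (by nlinarith)
    have : 0 ≤ ((n : ℝ) ^ 2)⁻¹ := by positivity
    constructor <;> linarith
  have hsub : S ⊆ Finset.Icc 2 (S.sup id + 1) := fun p hp => by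
    rw [Finset.mem_Icc]
    exact ⟨hS p hp, (Finset.le_sup (f := id) hp).trans (Nat.le_succ _)⟩
  have h1 : ∏ n ∈ Finset.Icc 2 (S.sup id + 1), (1 - ((n : ℝ) ^ 2)⁻¹) ≤
      ∏ p ∈ S, (1 - ((p : ℝ) ^ 2)⁻¹) := by
    rw [← Finset.prod_sdiff hsub]
    refine mul_le_of_le_one_left (Finset.prod_nonneg fun n hn => (hb n (hS n hn)).1) ?_
    have hmem : ∀ n ∈ Finset.Icc 2 (S.sup id + 1) \ S, 2 ≤ n := fun n hn =>
      (Finset.mem_Icc.mp (Finset.mem_sdiff.mp hn).1).1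
    exact Finset.prod_le_one (fun n hn => (hb n (hmem n hn)).1) (fun n hn => (hb n (hmem n hn)).2)
  refine le_trans ?_ h1
  rw [prod_Icc_one_sub_inv_sq, div_le_div_iff₀ (by norm_num) (by positivity)]
  linarith

theorem eulerFactor_le (q : ℕ) (hq : Squarefree q) :
    eulerFactor q ≤ 2 * ∑ b ∈ q.divisors, (b : ℝ)⁻¹ := by
  have h1 : ∑ b ∈ q.divisors, (b : ℝ)⁻¹ = ∏ p ∈ q.primeFactors, (1 + (p : ℝ)⁻¹) := by
    let g : ArithmeticFunction ℝ := ⟨fun m => (m : ℝ)⁻¹, by simp⟩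
    have hg : g.IsMultiplicative := by
      constructor
      · simp [g]
      · intro m n _
        simp [g, mul_comm]
    exact (hg.prodPrimeFactors_one_add_of_squarefree hq).symm
  have h2 : eulerFactor q * ∏ p ∈ q.primeFactors, (1 - ((p : ℝ) ^ 2)⁻¹) =
      ∏ p ∈ q.primeFactors, (1 + (p : ℝ)⁻¹) := by
    rw [eulerFactor, ← Finset.prod_mul_distrib]
    refine Finset.prod_congr rfl fun p hp => ?_
    have h1 : (1 : ℝ) < p := by exact_mod_cast (Nat.prime_of_mem_primeFactors hp).one_lt
    have h2 : (p : ℝ) - 1 ≠ 0 := by linarith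
    have h3 : (1 : ℝ) - (p : ℝ)⁻¹ ≠ 0 := by
      have := inv_lt_one_of_one_lt₀ h1
      linarith
    rw [inv_mul_eq_iff_eq_mul₀ h3]
    ring
  have h3 := half_le_prod_one_sub_inv_sq q.primeFactors
    fun p hp => (Nat.prime_of_mem_primeFactors hp).two_le
  have h4 := one_le_eulerFactor q
  rw [h1, ← h2]
  nlinarith

theorem exists_sum_eulerFactor_sq_div_le : ∃ C : ℝ, 0 < C ∧ ∀ Q : ℕ, 1 ≤ Q →
    ∑ q ∈ Finset.Ioc 0 Q with Squarefree q, eulerFactor q ^ 2 / q ≤ C * (1 + Real.log Q) := by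
  have hsummable : Summable fun n : ℕ => (n : ℝ) ^ (-(3 / 2) : ℝ) :=
    Real.summable_nat_rpow.mpr (by norm_num)
  set Z := ∑' n : ℕ, (n : ℝ) ^ (-(3 / 2) : ℝ) with hZ
  have hZs : ∀ S : Finset ℕ, ∑ n ∈ S, (n : ℝ) ^ (-(3 / 2) : ℝ) ≤ Z := fun S =>
    hsummable.sum_le_tsum S fun n _ => by positivity
  have hZ1 : 1 ≤ Z := by simpa using hZs {1}
  refine ⟨4 * Z * Z, by positivity, fun Q hQ => ?_⟩
  have hpt : ∀ q ∈ Finset.Ioc 0 Q, Squarefree q → eulerFactor q ^ 2 / q ≤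
      4 * Z * ∑ b ∈ q.divisors, (b : ℝ) ^ (-(1 / 2) : ℝ) / q := by
    intro q hq hsq
    have h0 := one_le_eulerFactor q
    have h1 := eulerFactor_le q hsq
    have h2 : (∑ b ∈ q.divisors, (b : ℝ)⁻¹) ^ 2 ≤
        (∑ b ∈ q.divisors, (b : ℝ) ^ (-(3 / 2) : ℝ)) *
          ∑ b ∈ q.divisors, (b : ℝ) ^ (-(1 / 2) : ℝ) := by
      refine Finset.sum_sq_le_sum_mul_sum_of_sq_le_mul _ (fun _ _ => by positivity)
        (fun _ _ => by positivity) fun b hb => ?_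
      have hb0 : (0 : ℝ) < b := by exact_mod_cast Nat.pos_of_mem_divisors hb
      rw [← Real.rpow_add hb0, inv_pow, ← Real.rpow_natCast, ← Real.rpow_neg hb0.le]
      norm_num
    have h3 := hZs q.divisors
    rw [← Finset.sum_div, mul_div_assoc']
    gcongr
    calc eulerFactor q ^ 2 ≤ (2 * ∑ b ∈ q.divisors, (b : ℝ)⁻¹) ^ 2 := by gcongr
      _ = 4 * (∑ b ∈ q.divisors, (b : ℝ)⁻¹) ^ 2 := by ring
      _ ≤ 4 * (Z * ∑ b ∈ q.divisors, (b : ℝ) ^ (-(1 / 2) : ℝ)) := by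
        gcongr
        refine h2.trans ?_
        gcongr
      _ = _ := by ring
  have h4 : ∑ q ∈ Finset.Ioc 0 Q with Squarefree q, eulerFactor q ^ 2 / q ≤
      ∑ q ∈ Finset.Ioc 0 Q, 4 * Z * ∑ b ∈ q.divisors, (b : ℝ) ^ (-(1 / 2) : ℝ) / q := by
    rw [Finset.sum_filter]
    refine Finset.sum_le_sum fun q hq => ?_
    split_ifs with hsq
    · exact hpt q hq hsq
    · positivity
  refine h4.trans ?_
  rw [← Finset.mul_sum]
  have hlog : 0 ≤ Real.log Q := Real.log_natCast_nonneg Q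
  have h5 : ∑ q ∈ Finset.Ioc 0 Q, ∑ b ∈ q.divisors, (b : ℝ) ^ (-(1 / 2) : ℝ) / q ≤
      ∑ b ∈ Finset.Ioc 0 Q, (b : ℝ) ^ (-(3 / 2) : ℝ) * (1 + Real.log Q) := by
    let f : ArithmeticFunction ℝ := ⟨fun b => if b = 0 then 0 else (b : ℝ) ^ (-(3 / 2) : ℝ),
      by simp⟩
    let g : ArithmeticFunction ℝ := ⟨fun m => (m : ℝ)⁻¹, by simp⟩
    have hfg : ∀ q ∈ Finset.Ioc 0 Q,
        ∑ b ∈ q.divisors, (b : ℝ) ^ (-(1 / 2) : ℝ) / q = (f * g) q := by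
      intro q hq
      rw [ArithmeticFunction.mul_apply,
        Nat.sum_divisorsAntidiagonal (f := fun a b => f a * g b)]
      refine Finset.sum_congr rfl fun b hb => ?_
      have hb0 : b ≠ 0 := (Nat.pos_of_mem_divisors hb).ne'
      have hb0' : (0 : ℝ) < b := by exact_mod_cast Nat.pos_of_mem_divisors hb
      simp only [f, g, ArithmeticFunction.coe_mk, if_neg hb0]
      rw [Nat.cast_div (Nat.dvd_of_mem_divisors hb) hb0'.ne', inv_div,
        show (-(1 / 2) : ℝ) = -(3 / 2) + 1 by norm_num, Real.rpow_add hb0', Real.rpow_one]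
      ring
    rw [Finset.sum_congr rfl hfg, ArithmeticFunction.sum_Ioc_mul_eq_sum_sum]
    refine Finset.sum_le_sum fun b hb => ?_
    obtain ⟨hb0, hbQ⟩ := Finset.mem_Ioc.mp hb
    have hfb : f b = (b : ℝ) ^ (-(3 / 2) : ℝ) := by
      simp only [f, ArithmeticFunction.coe_mk, if_neg hb0.ne']
    rw [hfb]
    gcongr
    have h6 := harmonic_le_one_add_log (Q / b)
    rw [harmonic_eq_sum_Icc] at h6
    push_cast at h6
    have h7 : Real.log ((Q / b : ℕ) : ℝ) ≤ Real.log Q := by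
      have : 0 < Q / b := Nat.div_pos hbQ hb0
      refine Real.log_le_log (by exact_mod_cast this) ?_
      exact_mod_cast Nat.div_le_self Q b
    exact h6.trans (by linarith)
  rw [← Finset.sum_mul] at h5
  calc 4 * Z * _ ≤ 4 * Z * (Z * (1 + Real.log Q)) := by
        gcongr
        refine h5.trans ?_
        gcongr
        exact hZs _
    _ = _ := by ring

/-- Selberg's mollifier coefficients: the Möbius function smoothly cut off between `X` and
`X ^ 2`. -/
noncomputable def selbergWeight (X : ℝ) (d : ℕ) : ℝ :=
  ((ArithmeticFunction.moebius d : ℤ) : ℝ) *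
    ((Real.posLog (X ^ 2 / d) - Real.posLog (X / d)) / Real.log X)

/-- The sum of `selbergWeight X d * d ^ (-s)` over the multiples `d` of `q`. -/
noncomputable def selbergSum (X s : ℝ) (q : ℕ) : ℝ :=
  ∑ d ∈ Finset.Ioc 0 ⌊X ^ 2⌋₊ with q ∣ d, selbergWeight X d * (d : ℝ) ^ (-s)

theorem abs_moebius_cast_le_one (d : ℕ) :
    |((ArithmeticFunction.moebius d : ℤ) : ℝ)| ≤ 1 := by
  exact_mod_cast ArithmeticFunction.abs_moebius_le_one

theorem selbergWeight_of_le {X : ℝ} (hX : 1 < X) {d : ℕ} (hd : 0 < d) (hdX : (d : ℝ) ≤ X) :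
    selbergWeight X d = ((ArithmeticFunction.moebius d : ℤ) : ℝ) := by
  have hd0 : (0 : ℝ) < d := by exact_mod_cast hd
  have hX0 : 0 < X := by linarith
  have hl := Real.log_pos hX
  rw [selbergWeight, posLog_eq_max_log, posLog_eq_max_log, max_eq_right, max_eq_right,
    Real.log_div (by positivity) hd0.ne', Real.log_div hX0.ne' hd0.ne', Real.log_pow]
  · field_simp
    push_cast
    ring
  · exact Real.log_nonneg (by rwa [one_le_div hd0])
  · exact Real.log_nonneg (by rw [one_le_div hd0]; nlinarith)

theorem selbergWeight_of_sq_le {X : ℝ} (hX : 1 < X) {d : ℕ} (hdX : X ^ 2 ≤ d) :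
    selbergWeight X d = 0 := by
  have hd0 : (0 : ℝ) < d := by nlinarith
  have hX0 : 0 < X := by linarith
  rw [selbergWeight, posLog_eq_max_log, posLog_eq_max_log, max_eq_left, max_eq_left]
  · simp
  · refine Real.log_nonpos (by positivity) ?_
    rw [div_le_one hd0]
    nlinarith
  · refine Real.log_nonpos (by positivity) ?_
    rwa [div_le_one hd0]

theorem moebius_mul_eq (q m : ℕ) : ((ArithmeticFunction.moebius (q * m) : ℤ) : ℝ) =
    ((ArithmeticFunction.moebius q : ℤ) : ℝ) * coprimeMoebius q m := by
  simp only [coprimeMoebius, ArithmeticFunction.coe_mk]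
  split_ifs with h
  · rw [ArithmeticFunction.isMultiplicative_moebius.map_mul_of_coprime h.symm]
    push_cast
    ring
  · rw [ArithmeticFunction.moebius_eq_zero_of_not_squarefree]
    · simp
    · rw [Nat.squarefree_mul_iff]
      exact fun hc => h hc.1.symm

theorem selbergSum_eq (X s : ℝ) (q : ℕ) (hq : 0 < q) :
    selbergSum X s q = ((ArithmeticFunction.moebius q : ℤ) : ℝ) * (q : ℝ) ^ (-s) / Real.log X *
      (∑ m ∈ Finset.Ioc 0 (⌊X ^ 2⌋₊ / q),
        coprimeMoebius q m * (m : ℝ) ^ (-s) * Real.posLog (X ^ 2 / q / m) -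
      ∑ m ∈ Finset.Ioc 0 (⌊X ^ 2⌋₊ / q),
        coprimeMoebius q m * (m : ℝ) ^ (-s) * Real.posLog (X / q / m)) := by
  rw [selbergSum, ← Finset.sum_sub_distrib, Finset.mul_sum]
  refine Finset.sum_bij' (fun d _ => d / q) (fun m _ => q * m) ?_ ?_ ?_ ?_ ?_
  · intro d hd
    rw [Finset.mem_filter, Finset.mem_Ioc] at hd
    rw [Finset.mem_Ioc]
    exact ⟨Nat.div_pos (Nat.le_of_dvd hd.1.1 hd.2) hq, Nat.div_le_div_right hd.1.2⟩
  · intro m hm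
    rw [Finset.mem_Ioc] at hm
    rw [Finset.mem_filter, Finset.mem_Ioc]
    exact ⟨⟨Nat.mul_pos hq hm.1, by rw [mul_comm]; exact (Nat.le_div_iff_mul_le hq).mp hm.2⟩,
      Nat.dvd_mul_right _ _⟩
  · intro d hd
    exact Nat.mul_div_cancel' (Finset.mem_filter.mp hd).2
  · intro m _
    exact Nat.mul_div_cancel_left m hq
  · intro d hd
    obtain ⟨m, rfl⟩ := (Finset.mem_filter.mp hd).2
    rw [Nat.mul_div_cancel_left m hq, selbergWeight, moebius_mul_eq]
    push_cast
    rw [Real.mul_rpow (by positivity) (by positivity), div_div, div_div]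
    ring

theorem selbergSum_eq_zero_of_not_squarefree (X s : ℝ) (q : ℕ) (hq : 0 < q)
    (h : ¬ Squarefree q) : selbergSum X s q = 0 := by
  rw [selbergSum_eq X s q hq, ArithmeticFunction.moebius_eq_zero_of_not_squarefree h]
  simp

theorem abs_selbergSum_le {X ε : ℝ} (hX : 1 < X) (hε : 0 ≤ ε) (hεX : ε * Real.log (X ^ 2) ≤ 1)
    (q : ℕ) (hq : 0 < q) :
    |selbergSum X (1 + ε) q| ≤ 120 * eulerFactor q * (q : ℝ) ^ (-(1 + ε)) / Real.log X := by
  have hX0 : 0 < X := by linarith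
  have hl := Real.log_pos hX
  have hq1 : (1 : ℝ) ≤ q := by exact_mod_cast hq
  have hq0 : (0 : ℝ) < q := by linarith
  have hlog : ∀ Y : ℝ, 0 < Y → Y ≤ X ^ 2 → ε * Real.log (Y / q) ≤ 1 := by
    intro Y hY hYX
    refine le_trans (mul_le_mul_of_nonneg_left (Real.log_le_log (by positivity) ?_) hε) hεX
    exact (div_le_self hY.le hq1).trans hYX
  have hfl : ∀ Y : ℝ, Y ≤ X ^ 2 → ⌊Y / q⌋₊ ≤ ⌊X ^ 2⌋₊ / q := by
    intro Y hYX
    rw [Nat.floor_div_natCast]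
    exact Nat.div_le_div_right (Nat.floor_le_floor hYX)
  have hXX : X ≤ X ^ 2 := by nlinarith
  have h1 := abs_sum_coprimeMoebius_rpow_mul_posLog_le q hq.ne' (⌊X ^ 2⌋₊ / q) (X ^ 2 / q) ε
    (by positivity) (hfl _ le_rfl) hε (hlog _ (by positivity) le_rfl)
  have h2 := abs_sum_coprimeMoebius_rpow_mul_posLog_le q hq.ne' (⌊X ^ 2⌋₊ / q) (X / q) ε
    (by positivity) (hfl _ hXX) hε (hlog _ (by positivity) hXX)
  rw [selbergSum_eq X _ q hq, abs_mul, abs_div, abs_mul, abs_of_pos hl,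
    abs_of_pos (Real.rpow_pos_of_pos hq0 _)]
  have h3 := (abs_sub (∑ m ∈ Finset.Ioc 0 (⌊X ^ 2⌋₊ / q),
        coprimeMoebius q m * (m : ℝ) ^ (-(1 + ε)) * Real.posLog (X ^ 2 / q / m))
      (∑ m ∈ Finset.Ioc 0 (⌊X ^ 2⌋₊ / q),
        coprimeMoebius q m * (m : ℝ) ^ (-(1 + ε)) * Real.posLog (X / q / m))).trans
        (add_le_add h1 h2)
  have hP := one_le_eulerFactor q
  calc _ ≤ 1 * (q : ℝ) ^ (-(1 + ε)) / Real.log X *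
        (60 * eulerFactor q + 60 * eulerFactor q) := by
        gcongr
        exact abs_moebius_cast_le_one q
    _ = _ := by ring

theorem exists_sum_selbergSum_sq_le : ∃ C : ℝ, 0 < C ∧ ∀ X ε : ℝ, 2 ≤ X → 0 ≤ ε →
    ε * Real.log (X ^ 2) ≤ 1 →
    ∑ q ∈ Finset.Ioc 0 ⌊X ^ 2⌋₊, (q : ℝ) ^ (1 + ε) * selbergSum X (1 + ε) q ^ 2 ≤
      C / Real.log X := by
  obtain ⟨C, hC, h⟩ := exists_sum_eulerFactor_sq_div_le
  refine ⟨120 ^ 2 * C * 4, by positivity, fun X ε hX hε hεX => ?_⟩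
  have hX0 : 0 < X := by linarith
  have hl : 1 / 2 ≤ Real.log X := by
    have := Real.log_two_gt_d9
    have := Real.log_le_log (by norm_num) hX
    linarith
  have hD : 1 ≤ ⌊X ^ 2⌋₊ := (Nat.one_le_floor_iff _).mpr (by nlinarith)
  have h1 : ∑ q ∈ Finset.Ioc 0 ⌊X ^ 2⌋₊, (q : ℝ) ^ (1 + ε) * selbergSum X (1 + ε) q ^ 2 ≤
      ∑ q ∈ Finset.Ioc 0 ⌊X ^ 2⌋₊ with Squarefree q,
        (120 / Real.log X) ^ 2 * (eulerFactor q ^ 2 / q) := by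
    rw [Finset.sum_filter]
    refine Finset.sum_le_sum fun q hq => ?_
    have hq0 := (Finset.mem_Ioc.mp hq).1
    split_ifs with hs
    · have hq1 : (1 : ℝ) ≤ q := by exact_mod_cast hq0
      have hb := abs_selbergSum_le (by linarith) hε hεX q hq0
      rw [← sq_abs (selbergSum X (1 + ε) q)]
      calc (q : ℝ) ^ (1 + ε) * |selbergSum X (1 + ε) q| ^ 2 ≤ (q : ℝ) ^ (1 + ε) *
            (120 * eulerFactor q * (q : ℝ) ^ (-(1 + ε)) / Real.log X) ^ 2 := by gcongr
        _ = (120 / Real.log X) ^ 2 * (eulerFactor q ^ 2 * (q : ℝ) ^ (-(1 + ε))) *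
            ((q : ℝ) ^ (1 + ε) * (q : ℝ) ^ (-(1 + ε))) := by ring
        _ ≤ _ := by
          rw [← Real.rpow_add (by linarith), add_neg_cancel, Real.rpow_zero, mul_one,
            div_eq_mul_inv (eulerFactor q ^ 2), ← Real.rpow_neg_one]
          gcongr
          linarith
    · rw [selbergSum_eq_zero_of_not_squarefree X _ q hq0 hs]
      simp
  refine h1.trans ?_
  rw [← Finset.mul_sum]
  have h2 := h _ hD
  have h3 : Real.log (⌊X ^ 2⌋₊ : ℝ) ≤ 2 * Real.log X := by
    rw [show 2 * Real.log X = Real.log (X ^ 2) by rw [Real.log_pow]; norm_num]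
    exact Real.log_le_log (by exact_mod_cast hD) (Nat.floor_le (by positivity))
  calc (120 / Real.log X) ^ 2 * _ ≤ (120 / Real.log X) ^ 2 * (C * (4 * Real.log X)) := by
        gcongr
        refine h2.trans ?_
        gcongr
        linarith
    _ = _ := by
      field_simp

/-- The Dirichlet coefficients of `ζ` times the mollifier. -/
noncomputable def mollifiedCoeff (X : ℝ) (n : ℕ) : ℝ := ∑ d ∈ n.divisors, selbergWeight X d

theorem tsum_rpow_neg_le {ε : ℝ} (hε : 0 < ε) :
    ∑' n : ℕ, ((n + 1 : ℕ) : ℝ) ^ (-(1 + ε)) ≤ 1 + 1 / ε := by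
  refine Real.tsum_le_of_sum_range_le (fun n => by positivity) fun N => ?_
  rcases N with _ | N
  · simp; positivity
  rw [Finset.sum_range_succ']
  have h : AntitoneOn (fun x : ℝ => x ^ (-(1 + ε))) (Set.Icc 1 (1 + (N : ℕ))) := by
    intro x hx y hy hxy
    exact Real.rpow_le_rpow_of_nonpos (by linarith [hx.1]) hxy (by linarith)
  have h1 := h.sum_le_integral
  rw [integral_rpow (Or.inr ⟨by linarith, by
    rw [Set.uIcc_of_le (by simp)]
    simp⟩)] at h1
  have h2 : (((1 + (N : ℕ) : ℝ)) ^ (-(1 + ε) + 1) - 1 ^ (-(1 + ε) + 1)) / (-(1 + ε) + 1) ≤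
      1 / ε := by
    rw [Real.one_rpow, show -(1 + ε) + 1 = -ε by ring, div_neg, ← neg_div]
    gcongr
    have : 0 ≤ (1 + (N : ℝ)) ^ (-ε) := by positivity
    linarith
  have h3 : ∑ k ∈ Finset.range N, ((k + 1 + 1 : ℕ) : ℝ) ^ (-(1 + ε)) =
      ∑ i ∈ Finset.range N, (1 + ((i + 1 : ℕ) : ℝ)) ^ (-(1 + ε)) := by
    refine Finset.sum_congr rfl fun i _ => ?_
    push_cast
    ring_nf
  rw [h3]
  simp only [zero_add, Nat.cast_one, Real.one_rpow]
  linarith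

/-- Jordan's totient-like function `∏ (p ^ s - 1)`. -/
noncomputable def jordanTotient (s : ℝ) : ArithmeticFunction ℝ :=
  ArithmeticFunction.prodPrimeFactors fun p => (p : ℝ) ^ s - 1

theorem jordanTotient_isMultiplicative (s : ℝ) : (jordanTotient s).IsMultiplicative :=
  ArithmeticFunction.IsMultiplicative.prodPrimeFactors _

theorem sum_divisors_jordanTotient (s : ℝ) {n : ℕ} (hn : Squarefree n) :
    ∑ r ∈ n.divisors, jordanTotient s r = (n : ℝ) ^ s := by
  rw [← (jordanTotient_isMultiplicative s).prodPrimeFactors_one_add_of_squarefree hn]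
  have h1 : ∀ p ∈ n.primeFactors, 1 + jordanTotient s p = (p : ℝ) ^ s := by
    intro p hp
    have hp' := Nat.prime_of_mem_primeFactors hp
    rw [jordanTotient, ArithmeticFunction.prodPrimeFactors_apply hp'.ne_zero,
      Nat.Prime.primeFactors hp', Finset.prod_singleton]
    ring
  rw [Finset.prod_congr rfl h1, Real.finsetProd_rpow _ _ (fun _ _ => by positivity)]
  congr 1
  rw [← Nat.cast_prod, Nat.prod_primeFactors_of_squarefree hn]

theorem jordanTotient_le {s : ℝ} (hs : 0 ≤ s) (n : ℕ) (hn : Squarefree n) :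
    jordanTotient s n ≤ (n : ℝ) ^ s := by
  rw [jordanTotient, ArithmeticFunction.prodPrimeFactors_apply hn.ne_zero]
  have h1 : (n : ℝ) = ∏ p ∈ n.primeFactors, (p : ℝ) := by
    rw [← Nat.cast_prod, Nat.prod_primeFactors_of_squarefree hn]
  rw [h1, ← Real.finsetProd_rpow _ _ (fun _ _ => by positivity)]
  refine Finset.prod_le_prod (fun p hp => ?_) (fun p _ => by linarith)
  have : (1 : ℝ) ≤ p := by exact_mod_cast (Nat.prime_of_mem_primeFactors hp).one_lt.le
  linarith [Real.one_le_rpow this hs]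

theorem mollifiedCoeff_eq {X : ℝ} (hX : 1 < X) (n : ℕ) (hn : 0 < n) :
    mollifiedCoeff X n =
      ∑ d ∈ Finset.Ioc 0 ⌊X ^ 2⌋₊, if d ∣ n then selbergWeight X d else 0 := by
  rw [mollifiedCoeff, ← Finset.sum_filter]
  have h1 : ∀ S : Finset ℕ, ∑ d ∈ S, selbergWeight X d =
      ∑ d ∈ S with d ≤ ⌊X ^ 2⌋₊, selbergWeight X d := by
    intro S
    refine (Finset.sum_filter_of_ne fun d _ hd => ?_).symm
    by_contra hlt
    refine hd (selbergWeight_of_sq_le hX ?_)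
    exact ((Nat.floor_lt (by positivity)).mp (not_le.mp hlt)).le
  rw [h1]
  refine Finset.sum_congr ?_ fun _ _ => rfl
  ext d
  simp only [Finset.mem_filter, Nat.mem_divisors, Finset.mem_Ioc]
  constructor
  · rintro ⟨⟨h1, h2⟩, h3⟩
    exact ⟨⟨Nat.pos_of_dvd_of_pos h1 hn, h3⟩, h1⟩
  · rintro ⟨⟨h1, h2⟩, h3⟩
    exact ⟨⟨h3, hn.ne'⟩, h2⟩

theorem mollifiedCoeff_one {X : ℝ} (hX : 1 < X) : mollifiedCoeff X 1 = 1 := by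
  simp [mollifiedCoeff, selbergWeight_of_le hX one_pos (by simpa using hX.le)]

theorem mollifiedCoeff_of_le {X : ℝ} (hX : 1 < X) {n : ℕ} (hn : 2 ≤ n) (hnX : (n : ℝ) ≤ X) :
    mollifiedCoeff X n = 0 := by
  have h1 : ∀ d ∈ n.divisors, selbergWeight X d = ((ArithmeticFunction.moebius d : ℤ) : ℝ) := by
    intro d hd
    refine selbergWeight_of_le hX (Nat.pos_of_mem_divisors hd) (le_trans ?_ hnX)
    exact_mod_cast Nat.divisor_le hd
  rw [mollifiedCoeff, Finset.sum_congr rfl h1]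
  have h2 := congrArg (fun f => f n) ArithmeticFunction.moebius_mul_coe_zeta
  simp only [ArithmeticFunction.coe_mul_zeta_apply, ArithmeticFunction.one_apply,
    if_neg (by omega : ¬ n = 1)] at h2
  exact_mod_cast h2

theorem hasSum_indicator_dvd_rpow {ε : ℝ} (hε : 0 < ε) (l : ℕ) (hl : 0 < l) :
    HasSum (fun n : ℕ => if l ∣ n + 1 then ((n + 1 : ℕ) : ℝ) ^ (-(1 + ε)) else 0)
      ((l : ℝ) ^ (-(1 + ε)) * ∑' n : ℕ, ((n + 1 : ℕ) : ℝ) ^ (-(1 + ε))) := by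
  have hs : Summable fun n : ℕ => ((n + 1 : ℕ) : ℝ) ^ (-(1 + ε)) :=
    (summable_nat_add_iff 1).mpr (Real.summable_nat_rpow.mpr (by linarith))
  have h1 := hs.hasSum.mul_left ((l : ℝ) ^ (-(1 + ε)))
  let g : ℕ → ℕ := fun n => l * (n + 1) - 1
  have hg1 : ∀ n, g n + 1 = l * (n + 1) := fun n =>
    Nat.sub_add_cancel (Nat.mul_pos hl (Nat.succ_pos n))
  have hg : Function.Injective g := by
    intro a b hab
    have : l * (a + 1) = l * (b + 1) := by rw [← hg1, ← hg1, hab]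
    have := Nat.eq_of_mul_eq_mul_left hl this
    omega
  rw [← hg.hasSum_iff]
  · refine h1.congr_fun ?_ 
    intro n
    simp only [Function.comp, hg1, Nat.dvd_mul_right, if_true]
    push_cast
    rw [Real.mul_rpow (by positivity) (by positivity)]
  · intro n hn
    rw [if_neg]
    rintro ⟨m, hm⟩
    refine hn ⟨m - 1, ?_⟩
    have hm0 : m ≠ 0 := by rintro rfl; simp at hm
    have : g (m - 1) + 1 = n + 1 := by rw [hg1, hm, Nat.sub_add_cancel (by omega)]
    omega

theorem sum_mollifiedCoeff_sq_le {X ε : ℝ} (hX : 1 < X) (hε : 0 < ε) (N : ℕ) :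
    ∑ n ∈ Finset.Ioc 0 N, mollifiedCoeff X n ^ 2 * (n : ℝ) ^ (-(1 + ε)) ≤
      (1 + 1 / ε) *
        ∑ r ∈ Finset.Ioc 0 ⌊X ^ 2⌋₊, (r : ℝ) ^ (1 + ε) * selbergSum X (1 + ε) r ^ 2 := by
  set D := Finset.Ioc 0 ⌊X ^ 2⌋₊ with hD
  set Z := ∑' n : ℕ, ((n + 1 : ℕ) : ℝ) ^ (-(1 + ε)) with hZ
  have hD0 : ∀ d ∈ D, 0 < d := fun d hd => (Finset.mem_Ioc.mp hd).1
  have hsq : ∀ n : ℕ, mollifiedCoeff X (n + 1) ^ 2 * ((n + 1 : ℕ) : ℝ) ^ (-(1 + ε)) =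
      ∑ d ∈ D, ∑ e ∈ D, selbergWeight X d * selbergWeight X e *
        (if d.lcm e ∣ n + 1 then ((n + 1 : ℕ) : ℝ) ^ (-(1 + ε)) else 0) := by
    intro n
    rw [mollifiedCoeff_eq hX _ (Nat.succ_pos n), sq, Finset.sum_mul_sum, Finset.sum_mul]
    refine Finset.sum_congr rfl fun d _ => ?_
    rw [Finset.sum_mul]
    refine Finset.sum_congr rfl fun e _ => ?_
    simp only [Nat.lcm_dvd_iff]
    split_ifs <;> simp_all
  have hsum : HasSum (fun n : ℕ => mollifiedCoeff X (n + 1) ^ 2 *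
      ((n + 1 : ℕ) : ℝ) ^ (-(1 + ε))) (∑ d ∈ D, ∑ e ∈ D, selbergWeight X d * selbergWeight X e *
        (((d.lcm e : ℕ) : ℝ) ^ (-(1 + ε)) * Z)) := by
    simp_rw [hsq]
    refine hasSum_sum fun d hd => hasSum_sum fun e he => HasSum.mul_left _ ?_
    exact hasSum_indicator_dvd_rpow hε _ (Nat.lcm_pos (hD0 d hd) (hD0 e he))
  have h1 : ∑ n ∈ Finset.Ioc 0 N, mollifiedCoeff X n ^ 2 * (n : ℝ) ^ (-(1 + ε)) ≤
      ∑ d ∈ D, ∑ e ∈ D, selbergWeight X d * selbergWeight X e *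
        (((d.lcm e : ℕ) : ℝ) ^ (-(1 + ε)) * Z) := by
    refine le_trans (le_of_eq ?_) (sum_le_hasSum (Finset.range N) (fun n _ => by positivity) hsum)
    rw [Finset.range_eq_Ico, Finset.sum_Ico_add'
      (fun n : ℕ => mollifiedCoeff X n ^ 2 * (n : ℝ) ^ (-(1 + ε)))]
    refine Finset.sum_congr ?_ fun _ _ => rfl
    ext n
    simp only [Finset.mem_Ioc, Finset.mem_Ico]
    omega
  have h2 : ∑ d ∈ D, ∑ e ∈ D, selbergWeight X d * selbergWeight X e *
        (((d.lcm e : ℕ) : ℝ) ^ (-(1 + ε)) * Z) =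
      Z * ∑ r ∈ D, jordanTotient (1 + ε) r * selbergSum X (1 + ε) r ^ 2 := by
    have h3 : ∀ d ∈ D, ∀ e ∈ D, selbergWeight X d * selbergWeight X e *
        (((d.lcm e : ℕ) : ℝ) ^ (-(1 + ε)) * Z) = Z * ∑ r ∈ D, jordanTotient (1 + ε) r *
        ((if r ∣ d then selbergWeight X d * (d : ℝ) ^ (-(1 + ε)) else 0) *
         (if r ∣ e then selbergWeight X e * (e : ℝ) ^ (-(1 + ε)) else 0)) := by
      intro d hd e he
      by_cases hds : Squarefree d
      swap
      · simp [selbergWeight, ArithmeticFunction.moebius_eq_zero_of_not_squarefree hds]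
      have hd0 := hD0 d hd
      have he0 := hD0 e he
      have hg := sum_divisors_jordanTotient (1 + ε)
        (hds.squarefree_of_dvd (Nat.gcd_dvd_left d e))
      have h4 : ∑ r ∈ D, jordanTotient (1 + ε) r *
        ((if r ∣ d then selbergWeight X d * (d : ℝ) ^ (-(1 + ε)) else 0) *
         (if r ∣ e then selbergWeight X e * (e : ℝ) ^ (-(1 + ε)) else 0)) =
         ∑ r ∈ (d.gcd e).divisors, jordanTotient (1 + ε) r *
          (selbergWeight X d * (d : ℝ) ^ (-(1 + ε)) *
            (selbergWeight X e * (e : ℝ) ^ (-(1 + ε)))) := by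
        have h5 : (d.gcd e).divisors = D.filter (fun r => r ∣ d ∧ r ∣ e) := by
          ext r
          simp only [Nat.mem_divisors, Finset.mem_filter, Nat.dvd_gcd_iff, hD, Finset.mem_Ioc]
          constructor
          · rintro ⟨h, _⟩
            refine ⟨⟨Nat.pos_of_dvd_of_pos h.1 hd0, ?_⟩, h⟩
            exact (Nat.le_of_dvd hd0 h.1).trans (Finset.mem_Ioc.mp hd).2
          · rintro ⟨_, h⟩
            exact ⟨h, (Nat.gcd_pos_of_pos_left e hd0).ne'⟩
        rw [h5, Finset.sum_filter]
        refine Finset.sum_congr rfl fun r _ => ?_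
        split_ifs <;> simp_all
      rw [h4, ← Finset.sum_mul, hg]
      have h6 : ((d.lcm e : ℕ) : ℝ) = d * e / (d.gcd e : ℕ) := by
        have hg0 : ((d.gcd e : ℕ) : ℝ) ≠ 0 := by
          exact_mod_cast (Nat.gcd_pos_of_pos_left e hd0).ne'
        rw [eq_div_iff hg0, mul_comm]
        exact_mod_cast Nat.gcd_mul_lcm d e
      rw [h6, Real.div_rpow (by positivity) (by positivity), Real.mul_rpow (by positivity)
        (by positivity), Real.rpow_neg (x := ((d.gcd e : ℕ) : ℝ)) (by positivity), div_inv_eq_mul]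
      ring
    rw [Finset.sum_congr rfl fun d hd => Finset.sum_congr rfl (h3 d hd)]
    simp_rw [← Finset.mul_sum]
    congr 1
    rw [Finset.sum_congr rfl fun d _ => Finset.sum_comm, Finset.sum_comm]
    refine Finset.sum_congr rfl fun r _ => ?_
    simp_rw [← Finset.mul_sum]
    rw [← Finset.sum_mul, sq, selbergSum, Finset.sum_filter]
  rw [h2] at h1
  refine h1.trans ?_
  have hZ0 : 0 ≤ Z := tsum_nonneg fun n => by positivity
  have hterm : ∑ r ∈ D, jordanTotient (1 + ε) r * selbergSum X (1 + ε) r ^ 2 ≤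
      ∑ r ∈ D, (r : ℝ) ^ (1 + ε) * selbergSum X (1 + ε) r ^ 2 := by
    refine Finset.sum_le_sum fun r hr => ?_
    by_cases hs : Squarefree r
    · gcongr
      exact jordanTotient_le (by linarith) r hs
    · rw [selbergSum_eq_zero_of_not_squarefree X _ r (hD0 r hr) hs]
      simp
  have h0 : 0 ≤ ∑ r ∈ D, (r : ℝ) ^ (1 + ε) * selbergSum X (1 + ε) r ^ 2 :=
    Finset.sum_nonneg fun _ _ => by positivity
  exact (mul_le_mul_of_nonneg_left hterm hZ0).trans
    (mul_le_mul_of_nonneg_right (tsum_rpow_neg_le hε) h0)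

open scoped ComplexConjugate

theorem norm_eq_one_of_mem_nthRootsFinset {q : ℕ} (hq : 0 < q) {z : ℂ}
    (hz : z ∈ Polynomial.nthRootsFinset q (1 : ℂ)) : ‖z‖ = 1 :=
  Complex.norm_eq_one_of_pow_eq_one ((Polynomial.mem_nthRootsFinset hq _).mp hz) hq.ne'

theorem sum_pow_nthRootsFinset {q : ℕ} (hq : 0 < q) (k : ℕ) :
    ∑ z ∈ Polynomial.nthRootsFinset q (1 : ℂ), z ^ k = if q ∣ k then (q : ℂ) else 0 := by
  have hζ := Complex.isPrimitiveRoot_exp q hq.ne'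
  set ζ := Complex.exp (2 * Real.pi * Complex.I / q)
  split_ifs with h
  · obtain ⟨l, rfl⟩ := h
    rw [Finset.sum_congr rfl (g := fun _ => (1 : ℂ))]
    · simp [hζ.card_nthRootsFinset]
    · intro z hz
      rw [pow_mul, (Polynomial.mem_nthRootsFinset hq _).mp hz, one_pow]
  · have h1 : ζ ^ k * ∑ z ∈ Polynomial.nthRootsFinset q (1 : ℂ), z ^ k =
        ∑ z ∈ Polynomial.nthRootsFinset q (1 : ℂ), z ^ k := by
      rw [Finset.mul_sum]
      have hζ0 : ζ ≠ 0 := hζ.ne_zero hq.ne'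
      refine Finset.sum_bij' (fun z _ => ζ * z) (fun z _ => ζ⁻¹ * z) ?_ ?_ ?_ ?_ ?_
      · intro z hz
        rw [Polynomial.mem_nthRootsFinset hq] at hz ⊢
        rw [mul_pow, hz, hζ.pow_eq_one, one_mul]
      · intro z hz
        rw [Polynomial.mem_nthRootsFinset hq] at hz ⊢
        rw [mul_pow, hz, inv_pow, hζ.pow_eq_one, inv_one, one_mul]
      · intro z _
        exact inv_mul_cancel_left₀ hζ0 z
      · intro z _
        exact mul_inv_cancel_left₀ hζ0 z
      · intro z _
        rw [mul_pow]
    have h2 : ζ ^ k ≠ 1 := fun hc => h (hζ.dvd_of_pow_eq_one k hc)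
    have h3 : (ζ ^ k - 1) * ∑ z ∈ Polynomial.nthRootsFinset q (1 : ℂ), z ^ k = 0 := by
      rw [sub_mul, h1, one_mul, sub_self]
    exact (mul_eq_zero.mp h3).resolve_left (sub_ne_zero.mpr h2)

theorem sum_range_pow_eq_mod {r : ℕ} {z : ℂ} (hz : z ^ r = 1) (hz1 : z ≠ 1) (N : ℕ) :
    ∑ m ∈ Finset.range N, z ^ m = ∑ m ∈ Finset.range (N % r), z ^ m := by
  rw [geom_sum_eq hz1, geom_sum_eq hz1, pow_eq_pow_mod N hz]

theorem norm_sum_range_pow_le {r : ℕ} (hr : 0 < r) {z : ℂ} (hz : z ^ r = 1) (hz1 : z ≠ 1)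
    (N : ℕ) : ‖∑ m ∈ Finset.range N, z ^ m‖ ≤ r := by
  rw [sum_range_pow_eq_mod hz hz1]
  have hn := Complex.norm_eq_one_of_pow_eq_one hz hr.ne'
  refine (norm_sum_le _ _).trans ?_
  simp only [norm_pow, hn, one_pow, Finset.sum_const, Finset.card_range, nsmul_eq_mul, mul_one]
  exact_mod_cast (Nat.mod_lt N hr).le

/-- A weak form of the large sieve inequality for roots of unity. -/
theorem sum_norm_sq_trigPoly_le (S : Finset ℂ) (b : ℂ → ℂ) (R : ℝ) (hS : ∀ z ∈ S, ‖z‖ = 1)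
    (hR0 : 0 ≤ R)
    (hR : ∀ z ∈ S, ∀ w ∈ S, z ≠ w → ∃ r : ℕ, 0 < r ∧ (r : ℝ) ≤ R ∧ z ^ r = w ^ r) (A W : ℕ) :
    ∑ m ∈ Finset.range W, ‖∑ z ∈ S, b z * z ^ (A + m)‖ ^ 2 ≤
      (W + R * S.card) * ∑ z ∈ S, ‖b z‖ ^ 2 := by
  set c : ℂ → ℂ := fun z => b z * z ^ A with hc
  have hcb : ∀ z ∈ S, ‖c z‖ = ‖b z‖ := fun z hz => by simp [hc, hS z hz]
  have h1 : ((∑ m ∈ Finset.range W, ‖∑ z ∈ S, b z * z ^ (A + m)‖ ^ 2 : ℝ) : ℂ) =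
      ∑ z ∈ S, ∑ w ∈ S, c z * conj (c w) * ∑ m ∈ Finset.range W, (z * conj w) ^ m := by
    push_cast
    have : ∀ m ∈ Finset.range W, (‖∑ z ∈ S, b z * z ^ (A + m)‖ : ℂ) ^ 2 =
        ∑ z ∈ S, ∑ w ∈ S, c z * conj (c w) * (z * conj w) ^ m := by
      intro m _
      rw [← Complex.mul_conj', map_sum, Finset.sum_mul_sum]
      refine Finset.sum_congr rfl fun z _ => Finset.sum_congr rfl fun w _ => ?_
      simp only [hc, map_mul, map_pow, pow_add, mul_pow]
      ring
    rw [Finset.sum_congr rfl this, Finset.sum_comm]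
    refine Finset.sum_congr rfl fun z _ => ?_
    rw [Finset.sum_comm]
    refine Finset.sum_congr rfl fun w _ => ?_
    rw [Finset.mul_sum]
  have h0 : 0 ≤ ∑ m ∈ Finset.range W, ‖∑ z ∈ S, b z * z ^ (A + m)‖ ^ 2 := by positivity
  have h2 : ∑ m ∈ Finset.range W, ‖∑ z ∈ S, b z * z ^ (A + m)‖ ^ 2 ≤
      ∑ z ∈ S, ∑ w ∈ S, (‖b z‖ * ‖b w‖ * R + if z = w then ‖b z‖ ^ 2 * W else 0) := by
    have : ∑ m ∈ Finset.range W, ‖∑ z ∈ S, b z * z ^ (A + m)‖ ^ 2 =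
        ‖((∑ m ∈ Finset.range W, ‖∑ z ∈ S, b z * z ^ (A + m)‖ ^ 2 : ℝ) : ℂ)‖ := by
      rw [Complex.norm_real, Real.norm_of_nonneg h0]
    rw [this, h1]
    refine (norm_sum_le _ _).trans (Finset.sum_le_sum fun z hz => ?_)
    refine (norm_sum_le _ _).trans (Finset.sum_le_sum fun w hw => ?_)
    rw [norm_mul, norm_mul, RCLike.norm_conj, hcb z hz, hcb w hw]
    split_ifs with hzw
    · subst hzw
      have h3 : ‖∑ m ∈ Finset.range W, (z * conj z) ^ m‖ ≤ W := by
        refine (norm_sum_le _ _).trans ?_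
        simp [hS z hz]
      have : 0 ≤ ‖b z‖ * ‖b z‖ * R := by positivity
      have := mul_le_mul_of_nonneg_left h3 (by positivity : 0 ≤ ‖b z‖ * ‖b z‖)
      linarith
    · obtain ⟨r, hr0, hrR, hr⟩ := hR z hz w hw hzw
      have hw1 : w * conj w = 1 := by
        rw [Complex.mul_conj', hS w hw]
        simp
      have h3 : ‖∑ m ∈ Finset.range W, (z * conj w) ^ m‖ ≤ r := by
        refine norm_sum_range_pow_le hr0 ?_ ?_ W
        · rw [mul_pow, hr, ← mul_pow, hw1, one_pow]
        · intro h
          apply hzw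
          calc z = z * (w * conj w) := by rw [hw1, mul_one]
            _ = (z * conj w) * w := by ring
            _ = w := by rw [h, one_mul]
      rw [add_zero]
      gcongr
      exact h3.trans hrR
  refine h2.trans ?_
  simp_rw [Finset.sum_add_distrib]
  have h4 : ∑ z ∈ S, ∑ w ∈ S, (if z = w then ‖b z‖ ^ 2 * W else 0) =
      W * ∑ z ∈ S, ‖b z‖ ^ 2 := by
    rw [Finset.mul_sum]
    refine Finset.sum_congr rfl fun z hz => ?_
    rw [Finset.sum_ite_eq, if_pos hz, mul_comm]
  have h5 : ∑ z ∈ S, ∑ w ∈ S, ‖b z‖ * ‖b w‖ * R = R * (∑ z ∈ S, ‖b z‖) ^ 2 := by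
    rw [sq, Finset.sum_mul_sum, Finset.mul_sum]
    refine Finset.sum_congr rfl fun z _ => ?_
    rw [Finset.mul_sum]
    exact Finset.sum_congr rfl fun w _ => mul_comm _ _
  have h6 := sq_sum_le_card_mul_sum_sq (s := S) (f := fun z => ‖b z‖)
  rw [h4, h5]
  have := mul_le_mul_of_nonneg_left h6 hR0
  linarith

theorem sum_norm_sq_geomSum_le {q : ℕ} (hq : 0 < q) (H : ℕ) :
    ∑ z ∈ (Polynomial.nthRootsFinset q (1 : ℂ)).erase 1,
      ‖∑ h ∈ Finset.range H, z ^ h‖ ^ 2 ≤ q * min (q : ℝ) H := by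
  set r := H % q with hr
  have hrq : r < q := Nat.mod_lt H hq
  have h1 : ∑ z ∈ (Polynomial.nthRootsFinset q (1 : ℂ)).erase 1,
      ‖∑ h ∈ Finset.range H, z ^ h‖ ^ 2 ≤
      ∑ z ∈ Polynomial.nthRootsFinset q (1 : ℂ), ‖∑ h ∈ Finset.range r, z ^ h‖ ^ 2 := by
    refine le_trans (le_of_eq (Finset.sum_congr rfl fun z hz => ?_))
      (Finset.sum_le_sum_of_subset_of_nonneg (Finset.erase_subset _ _) fun _ _ _ => by positivity)
    rw [Finset.mem_erase, Polynomial.mem_nthRootsFinset hq] at hz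
    rw [sum_range_pow_eq_mod hz.2 hz.1]
  have h2 : ((∑ z ∈ Polynomial.nthRootsFinset q (1 : ℂ),
      ‖∑ h ∈ Finset.range r, z ^ h‖ ^ 2 : ℝ) : ℂ) = ((q * r : ℝ) : ℂ) := by
    push_cast
    have h3 : ∀ z ∈ Polynomial.nthRootsFinset q (1 : ℂ),
        (‖∑ h ∈ Finset.range r, z ^ h‖ : ℂ) ^ 2 =
        ∑ h ∈ Finset.range r, ∑ k ∈ Finset.range r, z ^ (h + (q - k)) := by
      intro z hz
      have hz1 := norm_eq_one_of_mem_nthRootsFinset hq hz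
      rw [Polynomial.mem_nthRootsFinset hq] at hz
      rw [← Complex.mul_conj', map_sum, Finset.sum_mul_sum]
      refine Finset.sum_congr rfl fun h _ => Finset.sum_congr rfl fun k hk => ?_
      have hk' : k < q := (Finset.mem_range.mp hk).trans hrq
      rw [pow_add, map_pow]
      congr 1
      have hzz : (z * conj z) = 1 := by rw [Complex.mul_conj', hz1]; simp
      calc conj z ^ k = z ^ q * conj z ^ k := by rw [hz, one_mul]
        _ = z ^ (q - k) * (z ^ k * conj z ^ k) := by
          rw [← mul_assoc, ← pow_add, Nat.sub_add_cancel hk'.le]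
        _ = z ^ (q - k) := by rw [← mul_pow, hzz, one_pow, mul_one]
    rw [Finset.sum_congr rfl h3, Finset.sum_comm]
    have h4 : ∀ h ∈ Finset.range r, ∑ z ∈ Polynomial.nthRootsFinset q (1 : ℂ),
        ∑ k ∈ Finset.range r, z ^ (h + (q - k)) = q := by
      intro h hh
      rw [Finset.sum_comm]
      simp_rw [sum_pow_nthRootsFinset hq]
      rw [Finset.sum_eq_single h]
      · rw [if_pos]
        rw [Nat.add_sub_cancel' ((Finset.mem_range.mp hh).trans hrq).le]
      · intro k hk hkh
        rw [if_neg]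
        intro hd
        have hk' := (Finset.mem_range.mp hk).trans hrq
        have hh' := (Finset.mem_range.mp hh).trans hrq
        obtain ⟨l, hl⟩ := hd
        have hl1 : l = 1 := by
          have hlt : l < 2 := by
            by_contra hcon
            have : q * 2 ≤ q * l := Nat.mul_le_mul_left q (by omega)
            omega
          have : l ≠ 0 := by rintro rfl; omega
          omega
        subst hl1
        omega
      · exact fun hc => absurd hh hc
    rw [Finset.sum_congr rfl h4]
    simp [mul_comm]
  have h5 : ∑ z ∈ Polynomial.nthRootsFinset q (1 : ℂ),
      ‖∑ h ∈ Finset.range r, z ^ h‖ ^ 2 = q * r := by exact_mod_cast h2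
  rw [h5] at h1
  refine h1.trans ?_
  gcongr
  refine le_min (by exact_mod_cast hrq.le) ?_
  exact_mod_cast Nat.mod_le H q

theorem sum_nthRootsFinset_eq_sum_primitiveRoots (d : ℕ) (f : ℂ → ℂ) :
    ∑ z ∈ Polynomial.nthRootsFinset d (1 : ℂ), f z =
      ∑ q ∈ d.divisors, ∑ z ∈ primitiveRoots q ℂ, f z := by
  rw [IsPrimitiveRoot.nthRoots_one_eq_biUnion_primitiveRoots, Finset.sum_biUnion]
  intro a _ b _ hab
  exact IsPrimitiveRoot.disjoint hab

theorem mollifiedCoeff_eq_sum_primitiveRoots {X : ℝ} (hX : 1 < X) (n : ℕ) (hn : 0 < n) :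
    (mollifiedCoeff X n : ℂ) =
      ∑ q ∈ Finset.Ioc 0 ⌊X ^ 2⌋₊, (selbergSum X 1 q : ℂ) * ∑ z ∈ primitiveRoots q ℂ, z ^ n := by
  rw [mollifiedCoeff_eq hX n hn]
  set D := Finset.Ioc 0 ⌊X ^ 2⌋₊ with hD
  have h1 : ∀ d ∈ D, ((if d ∣ n then selbergWeight X d else 0 : ℝ) : ℂ) =
      ∑ q ∈ D, if q ∣ d then (selbergWeight X d * (d : ℝ) ^ (-1 : ℝ) : ℝ) *
        ∑ z ∈ primitiveRoots q ℂ, z ^ n else 0 := by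
    intro d hd
    have hd' := Finset.mem_Ioc.mp hd
    have hdiv : d.divisors = D.filter (fun q => q ∣ d) := by
      ext q
      simp only [Nat.mem_divisors, Finset.mem_filter, hD, Finset.mem_Ioc]
      constructor
      · rintro ⟨h, _⟩
        exact ⟨⟨Nat.pos_of_dvd_of_pos h hd'.1, (Nat.le_of_dvd hd'.1 h).trans hd'.2⟩, h⟩
      · rintro ⟨_, h⟩
        exact ⟨h, hd'.1.ne'⟩
    rw [← Finset.sum_filter, ← hdiv, ← Finset.mul_sum,
      ← sum_nthRootsFinset_eq_sum_primitiveRoots d, sum_pow_nthRootsFinset hd'.1]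
    have hd0 : (d : ℂ) ≠ 0 := by exact_mod_cast hd'.1.ne'
    split_ifs
    · rw [Real.rpow_neg_one]
      push_cast
      field_simp
    · simp
  push_cast
  push_cast at h1
  rw [Finset.sum_congr rfl h1, Finset.sum_comm]
  refine Finset.sum_congr rfl fun q _ => ?_
  rw [selbergSum, ← Finset.sum_filter, ← Finset.sum_mul]
  push_cast
  rfl

/-- The points of the large sieve: the roots of unity of orders `2, …, ⌊X ^ 2⌋`. -/
noncomputable def farey (X : ℝ) : Finset ℂ :=
  (Finset.Ioc 1 ⌊X ^ 2⌋₊).biUnion fun q => primitiveRoots q ℂ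

theorem sum_farey {E : Type*} [AddCommMonoid E] (X : ℝ) (f : ℂ → E) :
    ∑ z ∈ farey X, f z = ∑ q ∈ Finset.Ioc 1 ⌊X ^ 2⌋₊, ∑ z ∈ primitiveRoots q ℂ, f z := by
  rw [farey, Finset.sum_biUnion]
  intro a _ b _ hab
  exact IsPrimitiveRoot.disjoint hab

theorem mem_farey {X : ℝ} {z : ℂ} (hz : z ∈ farey X) :
    0 < orderOf z ∧ orderOf z ≤ ⌊X ^ 2⌋₊ := by
  obtain ⟨q, hq, hzq⟩ := Finset.mem_biUnion.mp hz
  rw [Finset.mem_Ioc] at hq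
  rw [← (isPrimitiveRoot_of_mem_primitiveRoots hzq).eq_orderOf]
  exact ⟨by omega, hq.2⟩

theorem card_farey_le (X : ℝ) : (farey X).card ≤ ⌊X ^ 2⌋₊ ^ 2 := by
  refine (Finset.card_biUnion_le_card_mul _ _ ⌊X ^ 2⌋₊ fun q hq => ?_).trans ?_
  · rw [Complex.card_primitiveRoots]
    exact (Nat.totient_le q).trans (Finset.mem_Ioc.mp hq).2
  · rw [Nat.card_Ioc, sq ⌊X ^ 2⌋₊]
    exact Nat.mul_le_mul_right _ (Nat.sub_le _ _)

theorem mollifiedCoeff_sub_eq {X : ℝ} (hX : 1 < X) (n : ℕ) (hn : 0 < n) :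
    ((mollifiedCoeff X n - selbergSum X 1 1 : ℝ) : ℂ) =
      ∑ z ∈ farey X, (selbergSum X 1 (orderOf z) : ℂ) * z ^ n := by
  have hD : 1 ≤ ⌊X ^ 2⌋₊ := (Nat.one_le_floor_iff _).mpr (by nlinarith)
  have hsplit : Finset.Ioc 0 ⌊X ^ 2⌋₊ = insert 1 (Finset.Ioc 1 ⌊X ^ 2⌋₊) := by
    ext q
    simp only [Finset.mem_Ioc, Finset.mem_insert]
    omega
  push_cast
  rw [mollifiedCoeff_eq_sum_primitiveRoots hX n hn, hsplit, Finset.sum_insert (by simp),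
    sum_farey]
  simp only [IsPrimitiveRoot.primitiveRoots_one, Finset.sum_singleton, one_pow, mul_one,
    add_sub_cancel_left]
  refine Finset.sum_congr rfl fun q _ => ?_
  rw [Finset.mul_sum]
  refine Finset.sum_congr rfl fun z hz => ?_
  rw [← (isPrimitiveRoot_of_mem_primitiveRoots hz).eq_orderOf]

/-- Mean square of the error terms of short sums of the mollified coefficients. -/
theorem sum_sq_shortSum_le {X : ℝ} (hX : 1 < X) (A W H : ℕ) (hW : ⌊X ^ 2⌋₊ ^ 4 ≤ W) :
    ∑ m ∈ Finset.range W,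
      (∑ h ∈ Finset.range H, (mollifiedCoeff X (A + m + h + 1) - selbergSum X 1 1)) ^ 2 ≤
    2 * W * ∑ q ∈ Finset.Ioc 0 ⌊X ^ 2⌋₊, selbergSum X 1 q ^ 2 * (q * min (q : ℝ) H) := by
  set D := ⌊X ^ 2⌋₊ with hD
  set b : ℂ → ℂ := fun z => (selbergSum X 1 (orderOf z) : ℂ) * ∑ h ∈ Finset.range H, z ^ h with hb
  have h1 : ∀ m ∈ Finset.range W,
      (∑ h ∈ Finset.range H, (mollifiedCoeff X (A + m + h + 1) - selbergSum X 1 1)) ^ 2 =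
      ‖∑ z ∈ farey X, b z * z ^ (A + 1 + m)‖ ^ 2 := by
    intro m _
    rw [← sq_abs, ← Real.norm_eq_abs, ← Complex.norm_real]
    congr 2
    rw [Complex.ofReal_sum, Finset.sum_congr rfl fun h _ =>
      mollifiedCoeff_sub_eq hX (A + m + h + 1) (Nat.succ_pos _), Finset.sum_comm]
    refine Finset.sum_congr rfl fun z _ => ?_
    rw [hb, ← Finset.mul_sum, mul_assoc, Finset.sum_mul]
    congr 1
    refine Finset.sum_congr rfl fun h _ => ?_
    rw [← pow_add]
    congr 1
    ring
  rw [Finset.sum_congr rfl h1]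
  have hnorm : ∀ z ∈ farey X, ‖z‖ = 1 := fun z hz =>
    Complex.norm_eq_one_of_pow_eq_one (pow_orderOf_eq_one z) (mem_farey hz).1.ne'
  have hLS := sum_norm_sq_trigPoly_le (farey X) b ((D : ℝ) ^ 2) hnorm (by positivity)
    (fun z hz w hw _ => ⟨orderOf z * orderOf w, Nat.mul_pos (mem_farey hz).1 (mem_farey hw).1, by
      have h2 := (mem_farey hz).2
      have h3 := (mem_farey hw).2
      rw [sq]
      exact_mod_cast Nat.mul_le_mul h2 h3, by
      rw [pow_mul, pow_orderOf_eq_one, one_pow, mul_comm, pow_mul, pow_orderOf_eq_one,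
        one_pow]⟩) (A + 1) W
  refine hLS.trans ?_
  have hcard : ((farey X).card : ℝ) ≤ (D : ℝ) ^ 2 := by exact_mod_cast card_farey_le X
  have hW' : ((D : ℝ)) ^ 4 ≤ W := by exact_mod_cast hW
  have hsum : ∑ z ∈ farey X, ‖b z‖ ^ 2 ≤
      ∑ q ∈ Finset.Ioc 0 D, selbergSum X 1 q ^ 2 * (q * min (q : ℝ) H) := by
    rw [sum_farey]
    refine le_trans (Finset.sum_le_sum fun q hq => ?_)
      (Finset.sum_le_sum_of_subset_of_nonneg (Finset.Ioc_subset_Ioc_left zero_le_one)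
        fun _ _ _ => by positivity)
    have hq1 := (Finset.mem_Ioc.mp hq).1
    have hq0 : 0 < q := by omega
    have h2 : ∀ z ∈ primitiveRoots q ℂ, ‖b z‖ ^ 2 =
        selbergSum X 1 q ^ 2 * ‖∑ h ∈ Finset.range H, z ^ h‖ ^ 2 := by
      intro z hz
      simp only [hb]
      rw [← (isPrimitiveRoot_of_mem_primitiveRoots hz).eq_orderOf, norm_mul, mul_pow,
        Complex.norm_real, Real.norm_eq_abs, sq_abs]
    rw [Finset.sum_congr rfl h2, ← Finset.mul_sum]
    refine mul_le_mul_of_nonneg_left (le_trans ?_ (sum_norm_sq_geomSum_le hq0 H)) (sq_nonneg _)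
    refine Finset.sum_le_sum_of_subset_of_nonneg ?_ fun _ _ _ => by positivity
    intro z hz
    have hz' := isPrimitiveRoot_of_mem_primitiveRoots hz
    rw [Finset.mem_erase, Polynomial.mem_nthRootsFinset hq0]
    exact ⟨hz'.ne_one hq1, hz'.pow_eq_one⟩
  have h0 : 0 ≤ ∑ z ∈ farey X, ‖b z‖ ^ 2 := Finset.sum_nonneg fun _ _ => by positivity
  refine mul_le_mul ?_ hsum h0 (by positivity)
  have : (D : ℝ) ^ 2 * (farey X).card ≤ (D : ℝ) ^ 2 * (D : ℝ) ^ 2 := by gcongr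
  nlinarith

/-- The error in the sum of the mollified coefficients over `(u, κ * u]`; the main term is
only subtracted for `u > T`. -/
noncomputable def shortSumError (X T κ u : ℝ) : ℝ :=
  ∑ n ∈ Finset.Ioc ⌊u⌋₊ ⌊κ * u⌋₊, (if n = 1 then 0 else mollifiedCoeff X n) -
    if T < u then (κ - 1) * u * selbergSum X 1 1 else 0

theorem sum_Ioc_add_eq_sum_range (f : ℕ → ℝ) (m H : ℕ) :
    ∑ n ∈ Finset.Ioc m (m + H), f n = ∑ h ∈ Finset.range H, f (m + h + 1) := by
  induction H with
  | zero => simp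
  | succ H ih =>
    rw [Finset.sum_range_succ, ← ih, ← add_assoc, ← Finset.insert_Ioc_right_eq_Ioc_add_one
      (by omega), Finset.sum_insert (by simp), add_comm]

theorem shortSumError_sq_le {X T κ u : ℝ} (hT : 1 ≤ T) (hu : T < u) (hκ : 1 < κ) (j W : ℕ)
    (hjW : (j : ℝ) * W ≤ u) (huW : u < j * W + W) (hW : (κ - 1) * W ≤ 1 / 3) :
    shortSumError X T κ u ^ 2 ≤
      2 * ∑ i ∈ Finset.range 3,
        (∑ h ∈ Finset.range (⌊(κ - 1) * (j * W)⌋₊ + i),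
          (mollifiedCoeff X (⌊u⌋₊ + h + 1) - selbergSum X 1 1)) ^ 2 + 2 * selbergSum X 1 1 ^ 2 := by
  set y := selbergSum X 1 1
  set H₀ := ⌊(κ - 1) * (j * W)⌋₊
  set m := ⌊u⌋₊
  have hu0 : 0 < u := by linarith
  have hκu : u ≤ κ * u := by nlinarith
  obtain ⟨H, hH⟩ : ∃ H, ⌊κ * u⌋₊ = m + H := Nat.exists_eq_add_of_le (Nat.floor_le_floor hκu)
  have hm1 : 1 ≤ m := (Nat.one_le_floor_iff _).mpr (by linarith)
  have a1 : (m : ℝ) ≤ u := Nat.floor_le hu0.le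
  have a2 : u < m + 1 := Nat.lt_floor_add_one u
  have a3 : ((m + H : ℕ) : ℝ) ≤ κ * u := hH ▸ Nat.floor_le (by linarith)
  have a4 : κ * u < ((m + H : ℕ) : ℝ) + 1 := hH ▸ Nat.lt_floor_add_one (κ * u)
  have b0 : 0 ≤ (κ - 1) * (j * W) := mul_nonneg (by linarith) (by positivity)
  have b1 : (H₀ : ℝ) ≤ (κ - 1) * (j * W) := Nat.floor_le b0
  have b2 : (κ - 1) * (j * W) < H₀ + 1 := Nat.lt_floor_add_one _
  have c1 : (κ - 1) * (j * W) ≤ (κ - 1) * u := mul_le_mul_of_nonneg_left hjW (by linarith)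
  have c2 : (κ - 1) * u ≤ (κ - 1) * (j * W + W) :=
    mul_le_mul_of_nonneg_left huW.le (by linarith)
  push_cast at a3 a4
  have d1 : (H₀ : ℝ) < H + 1 := by nlinarith
  have d2 : (H : ℝ) < H₀ + 3 := by nlinarith
  have e1 : H₀ < H + 1 := by exact_mod_cast d1
  have e2 : H < H₀ + 3 := by exact_mod_cast d2
  have hB : shortSumError X T κ u = ∑ h ∈ Finset.range H, (mollifiedCoeff X (m + h + 1) - y) +
      y * (H - (κ - 1) * u) := by
    rw [shortSumError, if_pos hu, hH, sum_Ioc_add_eq_sum_range, Finset.sum_sub_distrib]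
    have : ∀ h ∈ Finset.range H, (if m + h + 1 = 1 then 0 else mollifiedCoeff X (m + h + 1)) =
        mollifiedCoeff X (m + h + 1) := fun h _ => if_neg (by omega)
    rw [Finset.sum_congr rfl this]
    simp only [Finset.sum_const, Finset.card_range, nsmul_eq_mul]
    ring
  have hs : (∑ h ∈ Finset.range H, (mollifiedCoeff X (m + h + 1) - y)) ^ 2 ≤
      ∑ i ∈ Finset.range 3, (∑ h ∈ Finset.range (H₀ + i),
          (mollifiedCoeff X (m + h + 1) - y)) ^ 2 := by
    have := Finset.single_le_sum (s := Finset.range 3) (f := fun i =>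
      (∑ h ∈ Finset.range (H₀ + i), (mollifiedCoeff X (m + h + 1) - y)) ^ 2)
      (fun _ _ => sq_nonneg _) (Finset.mem_range.mpr (by omega : H - H₀ < 3))
    simpa only [Nat.add_sub_cancel' (by omega : H₀ ≤ H)] using this
  have hy : (y * (H - (κ - 1) * u)) ^ 2 ≤ y ^ 2 := by
    rw [mul_pow]
    refine mul_le_of_le_one_right (sq_nonneg _) ?_
    rw [sq_le_one_iff_abs_le_one, abs_le]
    constructor <;> nlinarith
  rw [hB]
  have := add_sq_le (a := ∑ h ∈ Finset.range H, (mollifiedCoeff X (m + h + 1) - y))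
    (b := y * (H - (κ - 1) * u))
  linarith

theorem lintegral_Ico_natCast_le (f : ℝ → ENNReal) (n W : ℕ) :
    ∫⁻ u in Set.Ico (n : ℝ) (n + W), f u ≤
      ∑ m ∈ Finset.range W, ∫⁻ u in Set.Ico ((n + m : ℕ) : ℝ) ((n + m : ℕ) + 1), f u := by
  induction W with
  | zero => simp
  | succ W ih =>
    rw [Finset.sum_range_succ]
    have h : Set.Ico (n : ℝ) (n + (W + 1 : ℕ)) =
        Set.Ico (n : ℝ) (n + W) ∪ Set.Ico ((n + W : ℕ) : ℝ) ((n + W : ℕ) + 1) := by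
      push_cast
      rw [Set.Ico_union_Ico_eq_Ico (by simp) (by simp), add_assoc]
    rw [h]
    exact (lintegral_union_le _ _ _).trans (by gcongr)

theorem min_le_rpow_mul_rpow {x y η : ℝ} (hx : 0 < x) (hy : 0 < y) (hη0 : 0 ≤ η) (hη1 : η ≤ 1) :
    min x y ≤ x ^ η * y ^ (1 - η) := by
  have h : 0 < min x y := lt_min hx hy
  calc min x y = min x y ^ η * min x y ^ (1 - η) := by
        rw [← Real.rpow_add h, add_sub_cancel, Real.rpow_one]
    _ ≤ x ^ η * y ^ (1 - η) := by
        gcongr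
        · exact min_le_left _ _
        · exact min_le_right _ _

/-- Bound for the integral over one block. -/
theorem lintegral_shortSumError_block_le {X T κ p : ℝ} (hX : 1 < X) (hT : 1 ≤ T) (hκ : 1 < κ)
    (hp : 0 ≤ p) (j W : ℕ) (hj : 1 ≤ j) (hW0 : ⌊X ^ 2⌋₊ ^ 4 ≤ W) (hW : (κ - 1) * W ≤ 1 / 3)
    (hW1 : 1 ≤ W) :
    ∫⁻ u in Set.Ioi T ∩ Set.Ico ((j * W : ℕ) : ℝ) ((j * W : ℕ) + W),
      ENNReal.ofReal (shortSumError X T κ u ^ 2 * u ^ (-p)) ≤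
    ENNReal.ofReal (14 * W * ((j : ℝ) * W) ^ (-p) *
      ∑ q ∈ Finset.Ioc 0 ⌊X ^ 2⌋₊, selbergSum X 1 q ^ 2 * (q * min (q : ℝ) (3 * j))) := by
  set y := selbergSum X 1 1 with hy
  set H₀ := ⌊(κ - 1) * (j * W)⌋₊ with hH₀
  set Y := ∑ q ∈ Finset.Ioc 0 ⌊X ^ 2⌋₊, selbergSum X 1 q ^ 2 * (q * min (q : ℝ) (3 * j)) with hY
  have hj1 : (1 : ℝ) ≤ j := by exact_mod_cast hj
  have hW1' : (1 : ℝ) ≤ W := by exact_mod_cast hW1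
  have hjW : 0 < (j : ℝ) * W := by positivity
  set g : ℕ → ℝ := fun m => 2 * ∑ i ∈ Finset.range 3, (∑ h ∈ Finset.range (H₀ + i),
          (mollifiedCoeff X (m + h + 1) - y)) ^ 2 + 2 * y ^ 2 with hg
  have hg0 : ∀ m, 0 ≤ g m := fun m => by positivity
  have hD : 1 ≤ ⌊X ^ 2⌋₊ := (Nat.one_le_floor_iff _).mpr (by nlinarith)
  have hyY : y ^ 2 ≤ Y := by
    have := Finset.single_le_sum (s := Finset.Ioc 0 ⌊X ^ 2⌋₊)
      (f := fun q : ℕ => selbergSum X 1 q ^ 2 * (q * min (q : ℝ) (3 * j)))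
      (fun q _ => by positivity) (Finset.mem_Ioc.mpr ⟨zero_lt_one, hD⟩)
    refine le_trans (le_of_eq ?_) this
    simp only [Nat.cast_one, one_mul]
    rw [min_eq_left (by linarith), mul_one]
  have hH₀j : H₀ + 2 ≤ 3 * j := by
    have b0 : 0 ≤ (κ - 1) * (j * W) := mul_nonneg (by linarith) (by positivity)
    have b1 : (H₀ : ℝ) ≤ (κ - 1) * (j * W) := Nat.floor_le b0
    have : (H₀ : ℝ) + 2 ≤ 3 * j := by nlinarith
    exact_mod_cast this
  have hsum : ∑ m ∈ Finset.range W, g (j * W + m) ≤ 14 * W * Y := by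
    have h1 : ∀ i ∈ Finset.range 3, ∑ m ∈ Finset.range W, (∑ h ∈ Finset.range (H₀ + i),
          (mollifiedCoeff X (j * W + m + h + 1) - y)) ^ 2 ≤ 2 * W * Y := by
      intro i hi
      refine (sum_sq_shortSum_le hX (j * W) W (H₀ + i) hW0).trans ?_
      have h2 : ((H₀ + i : ℕ) : ℝ) ≤ 3 * j := by
        have := Finset.mem_range.mp hi
        exact_mod_cast (by omega : H₀ + i ≤ 3 * j)
      rw [hY]
      gcongr
    have h3 := Finset.sum_le_sum h1
    rw [Finset.sum_comm] at h3
    simp only [Finset.sum_const, Finset.card_range, nsmul_eq_mul] at h3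
    simp only [hg]
    rw [Finset.sum_add_distrib, ← Finset.mul_sum]
    simp only [Finset.sum_const, Finset.card_range, nsmul_eq_mul]
    push_cast at h3
    nlinarith
  calc _ ≤ ∫⁻ u in Set.Ico ((j * W : ℕ) : ℝ) ((j * W : ℕ) + W),
        ENNReal.ofReal (g ⌊u⌋₊ * ((j : ℝ) * W) ^ (-p)) := by
        refine (setLIntegral_mono' (measurableSet_Ioi.inter measurableSet_Ico)
          fun u hu => ENNReal.ofReal_le_ofReal ?_).trans (lintegral_mono_set Set.inter_subset_right)
        obtain ⟨hu1, hu2, hu3⟩ := hu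
        push_cast at hu2 hu3
        exact mul_le_mul (shortSumError_sq_le hT hu1 hκ j W hu2 hu3 hW)
          (Real.rpow_le_rpow_of_nonpos hjW hu2 (by linarith))
          (Real.rpow_nonneg (by linarith) _) (hg0 _)
    _ ≤ ∑ m ∈ Finset.range W, ENNReal.ofReal (g (j * W + m) * ((j : ℝ) * W) ^ (-p)) := by
        refine (lintegral_Ico_natCast_le _ _ _).trans (Finset.sum_le_sum fun m _ => ?_)
        rw [setLIntegral_congr_fun measurableSet_Ico
          (g := fun _ => ENNReal.ofReal (g (j * W + m) * ((j : ℝ) * W) ^ (-p)))]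
        · simp
        · intro u hu
          have : ⌊u⌋₊ = j * W + m := by
            rw [Nat.floor_eq_iff (le_trans (by positivity) hu.1)]
            exact hu
          simp only [this]
    _ = ENNReal.ofReal ((∑ m ∈ Finset.range W, g (j * W + m)) * ((j : ℝ) * W) ^ (-p)) := by
        rw [Finset.sum_mul, ENNReal.ofReal_sum_of_nonneg]
        exact fun m _ => mul_nonneg (hg0 _) (by positivity)
    _ ≤ _ := by
        apply ENNReal.ofReal_le_ofReal
        calc _ ≤ 14 * W * Y * ((j : ℝ) * W) ^ (-p) := by gcongr
          _ = _ := by ring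

theorem kappa_sub_one_le {T : ℝ} (hT : 1 ≤ T) : Real.exp (1 / (6 * T)) - 1 ≤ 1 / (3 * T) := by
  have h0 : 0 ≤ 1 / (6 * T) := by positivity
  have h1 : 1 / (6 * T) ≤ 1 := by
    rw [div_le_one (by positivity)]; linarith
  have h := Real.abs_exp_sub_one_le (x := 1 / (6 * T)) (by rwa [abs_of_nonneg h0])
  rw [abs_of_nonneg h0] at h
  have h2 : 2 * (1 / (6 * T)) = 1 / (3 * T) := by field_simp; norm_num
  linarith [le_abs_self (Real.exp (1 / (6 * T)) - 1)]

theorem rpow_div_log {T : ℝ} (hT : 1 < T) (x : ℝ) : T ^ (x / Real.log T) = Real.exp x := by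
  rw [Real.rpow_def_of_pos (by linarith), mul_div_cancel₀ _ (Real.log_pos hT).ne']

theorem one_lt_of_le_log {T : ℝ} (hT : 0 < T) (hL : 100 ≤ Real.log T) : 101 ≤ T := by
  have := Real.add_one_le_exp (Real.log T)
  rw [Real.exp_log hT] at this
  linarith

theorem floor_rpow_sq_pow_four_le {T : ℝ} (hT : 101 ≤ T) :
    ⌊(T ^ (1 / 100 : ℝ)) ^ 2⌋₊ ^ 4 ≤ ⌊T⌋₊ := by
  rw [Nat.le_floor_iff (by linarith)]
  push_cast
  calc ((⌊(T ^ (1 / 100 : ℝ)) ^ 2⌋₊ : ℝ)) ^ 4 ≤ ((T ^ (1 / 100 : ℝ)) ^ 2) ^ 4 := by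
        gcongr
        exact Nat.floor_le (by positivity)
    _ = T ^ (8 / 100 : ℝ) := by
        rw [← pow_mul, ← Real.rpow_natCast, ← Real.rpow_mul (by linarith)]
        norm_num
    _ ≤ T ^ (1 : ℝ) := Real.rpow_le_rpow_of_exponent_le (by linarith) (by norm_num)
    _ = T := Real.rpow_one T

theorem two_le_rpow_of_le_log {T : ℝ} (hT : 0 < T) (hL : 100 ≤ Real.log T) :
    2 ≤ T ^ (1 / 100 : ℝ) := by
  rw [Real.rpow_def_of_pos hT]
  have := Real.add_one_le_exp (Real.log T * (1 / 100))
  linarith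

theorem exists_lintegral_shortSumError_Ioi_le (a : ℝ) (ha : 0 < a) : ∃ C : ℝ, 0 < C ∧ ∀ T : ℝ,
    0 < T → 100 ≤ Real.log T → 2 * a + 1 ≤ Real.log T →
    ∫⁻ u in Set.Ioi T, ENNReal.ofReal
      (shortSumError (T ^ (1 / 100 : ℝ)) T (Real.exp (1 / (6 * T))) u ^ 2 *
        u ^ (-(2 - 2 * (a / Real.log T)))) ≤ ENNReal.ofReal (C / T) := by
  obtain ⟨C, hC, hCy⟩ := exists_sum_selbergSum_sq_le
  refine ⟨14 * 3 * Real.exp (2 * a + 1) * (2 * Real.exp (2 * a)) * (200 * C), by positivity,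
    fun T hT0 hL ha1 => ?_⟩
  have hT := one_lt_of_le_log hT0 hL
  set L := Real.log T with hLdef
  set X := T ^ (1 / 100 : ℝ) with hXdef
  set κ := Real.exp (1 / (6 * T)) with hκdef
  set p := 2 - 2 * (a / L) with hp
  set W := ⌊T⌋₊ with hWdef
  have hL0 : 0 < L := by linarith
  have hX : 2 ≤ X := two_le_rpow_of_le_log hT0 hL
  have hlX : Real.log X = L / 100 := by rw [hXdef, Real.log_rpow hT0]; ring
  have hκ : 1 < κ := by rw [hκdef, Real.one_lt_exp_iff]; positivity
  have hWT : (W : ℝ) ≤ T := Nat.floor_le hT0.le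
  have hWT' : T < W + 1 := Nat.lt_floor_add_one T
  have hW1 : 1 ≤ W := (Nat.one_le_floor_iff _).mpr (by linarith)
  have hW1' : (1 : ℝ) ≤ W := by exact_mod_cast hW1
  have hW0 : (0 : ℝ) < W := by linarith
  have hκW : (κ - 1) * W ≤ 1 / 3 := by
    calc (κ - 1) * W ≤ 1 / (3 * T) * T := by
          gcongr
          exact kappa_sub_one_le (by linarith)
      _ = 1 / 3 := by field_simp
  have haL : 2 * (a / L) ≤ 1 := by
    rw [← mul_div_assoc, div_le_one hL0]; linarith
  have hp0 : 0 ≤ p := by linarith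
  set η := (2 * a + 1) / L with hη
  have hη0 : 0 ≤ η := by positivity
  have hη1 : η ≤ 1 := by rw [hη, div_le_one hL0]; exact ha1
  set Y := ∑ q ∈ Finset.Ioc 0 ⌊X ^ 2⌋₊, (q : ℝ) * selbergSum X 1 q ^ 2 with hY
  have hY0 : 0 ≤ Y := Finset.sum_nonneg fun q _ => by positivity
  have hYC : Y ≤ C / Real.log X := by
    have := hCy X 0 hX le_rfl (by simp)
    simpa only [add_zero, Real.rpow_one] using this
  set D := 14 * 3 * Real.exp (2 * a + 1) * (2 * Real.exp (2 * a)) * Y / T with hD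
  have hD0 : 0 ≤ D := by positivity
  have hcover : Set.Ioi T ⊆ ⋃ i : ℕ,
      Set.Ioi T ∩ Set.Ico (((i + 1) * W : ℕ) : ℝ) (((i + 1) * W : ℕ) + W) := by
    intro u hu
    have hu' : T < u := hu
    have h1 : 1 ≤ ⌊u / W⌋₊ := by
      rw [Nat.one_le_floor_iff, le_div_iff₀ hW0]; linarith
    have h2 : ((⌊u / W⌋₊ : ℕ) : ℝ) ≤ u / W := Nat.floor_le (div_nonneg (by linarith) hW0.le)
    have h3 := Nat.lt_floor_add_one (u / W)
    rw [le_div_iff₀ hW0] at h2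
    rw [div_lt_iff₀ hW0] at h3
    refine Set.mem_iUnion.mpr ⟨⌊u / W⌋₊ - 1, hu, ?_⟩
    rw [Nat.sub_add_cancel h1]
    push_cast
    exact ⟨h2, by linarith⟩
  have hterm : ∀ i : ℕ, 14 * (W : ℝ) * (((i + 1 : ℕ) : ℝ) * W) ^ (-p) *
      ∑ q ∈ Finset.Ioc 0 ⌊X ^ 2⌋₊, selbergSum X 1 q ^ 2 *
        (q * min (q : ℝ) (3 * ((i + 1 : ℕ) : ℝ))) ≤
      D * ((i + 1 : ℕ) : ℝ) ^ (-(1 + 1 / L)) := by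
    intro i
    set j : ℝ := ((i + 1 : ℕ) : ℝ) with hj
    have hj1 : 1 ≤ j := by rw [hj]; push_cast; linarith [(Nat.cast_nonneg i : (0 : ℝ) ≤ i)]
    have hj0 : 0 < j := by linarith
    have h1 : ∑ q ∈ Finset.Ioc 0 ⌊X ^ 2⌋₊, selbergSum X 1 q ^ 2 * (q * min (q : ℝ) (3 * j)) ≤
        Real.exp (2 * a + 1) * (3 * j ^ (1 - η)) * Y := by
      rw [hY, Finset.mul_sum]
      refine Finset.sum_le_sum fun q hq => ?_
      obtain ⟨hq0, hqX⟩ := Finset.mem_Ioc.mp hq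
      have hq0' : (0 : ℝ) < q := by exact_mod_cast hq0
      have hqT : (q : ℝ) ≤ T := by
        have h2 : (q : ℝ) ≤ X ^ 2 := (Nat.le_floor_iff (by positivity)).mp hqX
        have h3 : X ^ 2 ≤ T := by
          rw [hXdef, ← Real.rpow_natCast, ← Real.rpow_mul hT0.le]
          calc T ^ (1 / 100 * ((2 : ℕ) : ℝ)) ≤ T ^ (1 : ℝ) :=
                Real.rpow_le_rpow_of_exponent_le (by linarith) (by norm_num)
            _ = T := Real.rpow_one T
        linarith
      have h4 : (q : ℝ) ^ η ≤ Real.exp (2 * a + 1) := by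
        rw [← rpow_div_log (by linarith : 1 < T) (2 * a + 1)]
        gcongr
      have h5 : (3 * j) ^ (1 - η) ≤ 3 * j ^ (1 - η) := by
        rw [Real.mul_rpow (by norm_num) hj0.le]
        gcongr
        calc (3 : ℝ) ^ (1 - η) ≤ 3 ^ (1 : ℝ) :=
              Real.rpow_le_rpow_of_exponent_le (by norm_num) (by linarith)
          _ = 3 := Real.rpow_one 3
      calc selbergSum X 1 q ^ 2 * (q * min (q : ℝ) (3 * j))
          ≤ selbergSum X 1 q ^ 2 * (q * (Real.exp (2 * a + 1) * (3 * j ^ (1 - η)))) := by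
            gcongr
            exact (min_le_rpow_mul_rpow hq0' (by positivity) hη0 hη1).trans (by gcongr)
        _ = _ := by ring
    have h2 : (W : ℝ) * (W : ℝ) ^ (-p) ≤ 2 * Real.exp (2 * a) / T := by
      have h3 : (W : ℝ) * (W : ℝ) ^ (-p) = (W : ℝ) ^ (2 * a / L) * (W : ℝ)⁻¹ := by
        nth_rewrite 1 [← Real.rpow_one (W : ℝ)]
        rw [← Real.rpow_neg_one, ← Real.rpow_add hW0, ← Real.rpow_add hW0]
        congr 1
        rw [hp]
        ring
      rw [h3]
      have h4 : (W : ℝ) ^ (2 * a / L) ≤ Real.exp (2 * a) := by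
        rw [← rpow_div_log (by linarith : 1 < T) (2 * a)]
        gcongr
      have h5 : (W : ℝ)⁻¹ ≤ 2 / T := by
        rw [inv_le_comm₀ hW0 (by positivity), inv_div]; linarith
      calc _ ≤ Real.exp (2 * a) * (2 / T) := by gcongr
        _ = _ := by ring
    have h6 : j ^ (-p) * j ^ (1 - η) = j ^ (-(1 + 1 / L)) := by
      rw [← Real.rpow_add hj0]
      congr 1
      rw [hp, hη]
      ring
    rw [Real.mul_rpow hj0.le hW0.le]
    calc _ ≤ 14 * (W : ℝ) * (j ^ (-p) * (W : ℝ) ^ (-p)) *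
          (Real.exp (2 * a + 1) * (3 * j ^ (1 - η)) * Y) := by gcongr
      _ = 14 * 3 * Real.exp (2 * a + 1) * Y * (j ^ (-p) * j ^ (1 - η)) *
          ((W : ℝ) * (W : ℝ) ^ (-p)) := by ring
      _ ≤ 14 * 3 * Real.exp (2 * a + 1) * Y * (j ^ (-p) * j ^ (1 - η)) *
          (2 * Real.exp (2 * a) / T) := by gcongr
      _ = D * j ^ (-(1 + 1 / L)) := by rw [h6, hD]; ring
  have hs : Summable fun i : ℕ => ((i + 1 : ℕ) : ℝ) ^ (-(1 + 1 / L)) :=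
    (summable_nat_add_iff 1).mpr (Real.summable_nat_rpow.mpr (by
      have : 0 < 1 / L := by positivity
      linarith))
  calc _ ≤ ∫⁻ u in ⋃ i : ℕ, Set.Ioi T ∩ Set.Ico (((i + 1) * W : ℕ) : ℝ) (((i + 1) * W : ℕ) + W),
        ENNReal.ofReal (shortSumError X T κ u ^ 2 * u ^ (-p)) := lintegral_mono_set hcover
    _ ≤ ∑' i : ℕ, ∫⁻ u in Set.Ioi T ∩
          Set.Ico (((i + 1) * W : ℕ) : ℝ) (((i + 1) * W : ℕ) + W),
        ENNReal.ofReal (shortSumError X T κ u ^ 2 * u ^ (-p)) := lintegral_iUnion_le _ _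
    _ ≤ ∑' i : ℕ, ENNReal.ofReal (D * ((i + 1 : ℕ) : ℝ) ^ (-(1 + 1 / L))) := by
        refine ENNReal.tsum_le_tsum fun i => ?_
        refine (lintegral_shortSumError_block_le (by linarith) (by linarith) hκ hp0 (i + 1) W
          (by omega) (floor_rpow_sq_pow_four_le hT) hκW hW1).trans ?_
        exact ENNReal.ofReal_le_ofReal (hterm i)
    _ = ENNReal.ofReal (∑' i : ℕ, D * ((i + 1 : ℕ) : ℝ) ^ (-(1 + 1 / L))) :=
        (ENNReal.ofReal_tsum_of_nonneg (fun i => by positivity) (hs.mul_left D)).symm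
    _ ≤ _ := by
        apply ENNReal.ofReal_le_ofReal
        rw [tsum_mul_left]
        have h1 := tsum_rpow_neg_le (ε := 1 / L) (by positivity)
        rw [one_div_one_div] at h1
        have h2 : Y * (1 + L) ≤ 200 * C := by
          calc Y * (1 + L) ≤ C / (L / 100) * (2 * L) := by
                rw [← hlX]
                exact mul_le_mul hYC (by linarith) (by linarith) (hY0.trans hYC)
            _ = 200 * C := by field_simp; norm_num
        calc _ ≤ D * (1 + L) := by gcongr
          _ = 14 * 3 * Real.exp (2 * a + 1) * (2 * Real.exp (2 * a)) * (Y * (1 + L)) / T := by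
              rw [hD]; ring
          _ ≤ _ := by gcongr

theorem kappa_le_two {T : ℝ} (hT : 1 ≤ T) : Real.exp (1 / (6 * T)) ≤ 2 := by
  have h := kappa_sub_one_le hT
  have : 1 / (3 * T) ≤ 1 := by
    rw [div_le_one (by positivity)]; linarith
  linarith

theorem shortSumError_sq_mul_le {X T κ u p : ℝ} (hu0 : 0 < u) (hu : u ≤ T) (hκ : 1 < κ)
    (hκ2 : κ ≤ 2) (hκT : (κ - 1) * T ≤ 1 / 3) (hp : 0 ≤ p) :
    ENNReal.ofReal (shortSumError X T κ u ^ 2 * u ^ (-p)) ≤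
      ∑ n ∈ Finset.Ioc 0 ⌊2 * T⌋₊, (Set.Ico ((n : ℝ) / κ) n).indicator
        (fun _ => ENNReal.ofReal (mollifiedCoeff X n ^ 2 * ((n : ℝ) / κ) ^ (-p))) u := by
  rw [shortSumError, if_neg hu.not_gt, sub_zero]
  have h1 : u ≤ κ * u := by nlinarith
  have h2 : κ * u ≤ u + 1 := by nlinarith
  have h3 : ⌊u⌋₊ ≤ ⌊κ * u⌋₊ := Nat.floor_le_floor h1
  have h4 : ⌊κ * u⌋₊ ≤ ⌊u⌋₊ + 1 := by
    rw [← Nat.floor_add_one hu0.le]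
    exact Nat.floor_le_floor h2
  obtain h | h : ⌊κ * u⌋₊ = ⌊u⌋₊ ∨ ⌊κ * u⌋₊ = ⌊u⌋₊ + 1 := by omega
  · simp [h]
  · set m := ⌊u⌋₊ + 1 with hm
    have h5 : Finset.Ioc ⌊u⌋₊ m = {m} := by simp [hm]
    have h6 : (m : ℝ) ≤ κ * u := h ▸ Nat.floor_le (by linarith)
    have h7 : u < m := by rw [hm]; push_cast; exact Nat.lt_floor_add_one u
    have hκ0 : 0 < κ := by linarith
    have hm0 : (0 : ℝ) < m := by linarith
    have h8 : (m : ℝ) / κ ≤ u := by rw [div_le_iff₀ hκ0]; linarith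
    rw [h, h5, Finset.sum_singleton]
    have h9 : m ∈ Finset.Ioc 0 ⌊2 * T⌋₊ := by
      refine Finset.mem_Ioc.mpr ⟨by omega, Nat.le_floor ?_⟩
      nlinarith
    refine le_trans ?_ (Finset.single_le_sum (f := fun n : ℕ =>
      (Set.Ico ((n : ℝ) / κ) n).indicator
        (fun _ => ENNReal.ofReal (mollifiedCoeff X n ^ 2 * ((n : ℝ) / κ) ^ (-p))) u)
      (fun _ _ => zero_le) h9)
    rw [Set.indicator_of_mem (Set.mem_Ico.mpr ⟨h8, h7⟩)]
    apply ENNReal.ofReal_le_ofReal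
    refine mul_le_mul ?_ (Real.rpow_le_rpow_of_nonpos (by positivity) h8 (by linarith))
      (by positivity) (by positivity)
    split_ifs
    · simp only [ne_eq, OfNat.ofNat_ne_zero, not_false_eq_true, zero_pow]; positivity
    · exact le_rfl

theorem exists_lintegral_shortSumError_Ioc_le (a : ℝ) (ha : 0 < a) : ∃ C : ℝ, 0 < C ∧ ∀ T : ℝ,
    0 < T → 100 ≤ Real.log T → 2 * a + 1 ≤ Real.log T →
    ∫⁻ u in Set.Ioc 0 T, ENNReal.ofReal
      (shortSumError (T ^ (1 / 100 : ℝ)) T (Real.exp (1 / (6 * T))) u ^ 2 *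
        u ^ (-(2 - 2 * (a / Real.log T)))) ≤ ENNReal.ofReal (C / T) := by
  obtain ⟨C, hC, hCy⟩ := exists_sum_selbergSum_sq_le
  refine ⟨4 * Real.exp (2 * (2 * a + 1)) * (200 * C), by positivity, fun T hT0 hL ha1 => ?_⟩
  have hT := one_lt_of_le_log hT0 hL
  set L := Real.log T with hLdef
  set X := T ^ (1 / 100 : ℝ) with hXdef
  set κ := Real.exp (1 / (6 * T)) with hκdef
  set p := 2 - 2 * (a / L) with hp
  have hL0 : 0 < L := by linarith
  have hX : 2 ≤ X := two_le_rpow_of_le_log hT0 hL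
  have hlX : Real.log X = L / 100 := by rw [hXdef, Real.log_rpow hT0]; ring
  have hκ : 1 < κ := by rw [hκdef, Real.one_lt_exp_iff]; positivity
  have hκ0 : 0 < κ := by linarith
  have hκ2 : κ ≤ 2 := kappa_le_two (by linarith)
  have hκ1 : κ - 1 ≤ 1 / (3 * T) := kappa_sub_one_le (by linarith)
  have hκT : (κ - 1) * T ≤ 1 / 3 := by
    calc (κ - 1) * T ≤ 1 / (3 * T) * T := by gcongr
      _ = 1 / 3 := by field_simp
  have haL : 2 * (a / L) ≤ 1 := by
    rw [← mul_div_assoc, div_le_one hL0]; linarith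
  have haL0 : 0 < a / L := by positivity
  have hp0 : 0 ≤ p := by linarith
  have hterm : ∀ n ∈ Finset.Ioc 0 ⌊2 * T⌋₊,
      mollifiedCoeff X n ^ 2 * ((n : ℝ) / κ) ^ (-p) * (n - n / κ) ≤
      4 * Real.exp (2 * (2 * a + 1)) / T * (mollifiedCoeff X n ^ 2 * (n : ℝ) ^ (-(1 + 1 / L))) := by
    intro n hn
    obtain ⟨hn0, hnT⟩ := Finset.mem_Ioc.mp hn
    have hn0' : (0 : ℝ) < n := by exact_mod_cast hn0
    have hnT' : (n : ℝ) ≤ 2 * T := (Nat.le_floor_iff (by linarith)).mp hnT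
    have h1 : (n : ℝ) - n / κ ≤ n * (1 / T) := by
      have : (n : ℝ) - n / κ = n * ((κ - 1) / κ) := by field_simp
      rw [this]
      refine mul_le_mul_of_nonneg_left ?_ hn0'.le
      rw [div_le_iff₀ hκ0]
      calc κ - 1 ≤ 1 / (3 * T) := hκ1
        _ ≤ 1 / T := by gcongr; linarith
        _ ≤ 1 / T * κ := le_mul_of_one_le_right (by positivity) hκ.le
    have h2 : ((n : ℝ) / κ) ^ (-p) ≤ 4 * (n : ℝ) ^ (-p) := by
      rw [Real.div_rpow hn0'.le hκ0.le, div_eq_mul_inv, ← Real.rpow_neg hκ0.le, neg_neg, mul_comm]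
      gcongr
      calc κ ^ p ≤ κ ^ (2 : ℝ) := Real.rpow_le_rpow_of_exponent_le hκ.le (by linarith)
        _ = κ ^ 2 := by norm_cast
        _ ≤ 4 := by nlinarith
    have h3 : (n : ℝ) ^ (-p) * n = (n : ℝ) ^ (-(1 + 1 / L)) * (n : ℝ) ^ ((2 * a + 1) / L) := by
      nth_rewrite 2 [← Real.rpow_one (n : ℝ)]
      rw [← Real.rpow_add hn0', ← Real.rpow_add hn0']
      congr 1
      rw [hp]
      ring
    have h4 : (n : ℝ) ^ ((2 * a + 1) / L) ≤ Real.exp (2 * (2 * a + 1)) := by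
      calc (n : ℝ) ^ ((2 * a + 1) / L) ≤ (T ^ 2) ^ ((2 * a + 1) / L) := by
            gcongr
            nlinarith
        _ = Real.exp (2 * (2 * a + 1)) := by
            rw [← Real.rpow_natCast, ← Real.rpow_mul hT0.le,
              ← rpow_div_log (by linarith : 1 < T) (2 * (2 * a + 1))]
            congr 1
            push_cast
            ring
    calc _ ≤ mollifiedCoeff X n ^ 2 * (4 * (n : ℝ) ^ (-p)) * (n * (1 / T)) := by
          gcongr
          rw [sub_nonneg]
          exact div_le_self hn0'.le hκ.le
      _ = 4 / T * mollifiedCoeff X n ^ 2 * ((n : ℝ) ^ (-p) * n) := by ring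
      _ = 4 / T * mollifiedCoeff X n ^ 2 *
          ((n : ℝ) ^ (-(1 + 1 / L)) * (n : ℝ) ^ ((2 * a + 1) / L)) := by rw [h3]
      _ ≤ 4 / T * mollifiedCoeff X n ^ 2 *
          ((n : ℝ) ^ (-(1 + 1 / L)) * Real.exp (2 * (2 * a + 1))) := by gcongr
      _ = _ := by ring
  have hsum : ∑ n ∈ Finset.Ioc 0 ⌊2 * T⌋₊, mollifiedCoeff X n ^ 2 * (n : ℝ) ^ (-(1 + 1 / L)) ≤
      200 * C := by
    refine (sum_mollifiedCoeff_sq_le (by linarith) (by positivity) _).trans ?_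
    have h1 := hCy X (1 / L) hX (by positivity) (by
      rw [Real.log_pow, hlX]; field_simp; norm_num)
    rw [one_div_one_div]
    calc _ ≤ (2 * L) * (C / (L / 100)) := by
          rw [← hlX]
          exact mul_le_mul (by linarith) h1 (Finset.sum_nonneg fun _ _ => by positivity)
            (by positivity)
      _ = 200 * C := by field_simp; norm_num
  calc _ ≤ ∫⁻ u in Set.Ioc 0 T, ∑ n ∈ Finset.Ioc 0 ⌊2 * T⌋₊, (Set.Ico ((n : ℝ) / κ) n).indicator
        (fun _ => ENNReal.ofReal (mollifiedCoeff X n ^ 2 * ((n : ℝ) / κ) ^ (-p))) u :=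
        setLIntegral_mono' measurableSet_Ioc fun u hu =>
          shortSumError_sq_mul_le hu.1 hu.2 hκ hκ2 hκT hp0
    _ ≤ ∫⁻ u, ∑ n ∈ Finset.Ioc 0 ⌊2 * T⌋₊, (Set.Ico ((n : ℝ) / κ) n).indicator
        (fun _ => ENNReal.ofReal (mollifiedCoeff X n ^ 2 * ((n : ℝ) / κ) ^ (-p))) u :=
        setLIntegral_le_lintegral _ _
    _ = ∑ n ∈ Finset.Ioc 0 ⌊2 * T⌋₊,
        ENNReal.ofReal (mollifiedCoeff X n ^ 2 * ((n : ℝ) / κ) ^ (-p) * (n - n / κ)) := by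
        rw [lintegral_finsetSum _ fun n _ => measurable_const.indicator measurableSet_Ico]
        refine Finset.sum_congr rfl fun n _ => ?_
        rw [lintegral_indicator_const measurableSet_Ico, Real.volume_Ico,
          ← ENNReal.ofReal_mul (by positivity)]
    _ ≤ ∑ n ∈ Finset.Ioc 0 ⌊2 * T⌋₊, ENNReal.ofReal (4 * Real.exp (2 * (2 * a + 1)) / T *
          (mollifiedCoeff X n ^ 2 * (n : ℝ) ^ (-(1 + 1 / L)))) :=
        Finset.sum_le_sum fun n hn => ENNReal.ofReal_le_ofReal (hterm n hn)
    _ = ENNReal.ofReal (4 * Real.exp (2 * (2 * a + 1)) / T *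
          ∑ n ∈ Finset.Ioc 0 ⌊2 * T⌋₊, mollifiedCoeff X n ^ 2 * (n : ℝ) ^ (-(1 + 1 / L))) := by
        rw [Finset.mul_sum, ENNReal.ofReal_sum_of_nonneg]
        exact fun n _ => by positivity
    _ ≤ _ := by
        apply ENNReal.ofReal_le_ofReal
        calc _ ≤ 4 * Real.exp (2 * (2 * a + 1)) / T * (200 * C) := by gcongr
          _ = _ := by ring

theorem exists_lintegral_shortSumError_le (a : ℝ) (ha : 0 < a) : ∃ C : ℝ, 0 < C ∧ ∀ T : ℝ,
    0 < T → 100 ≤ Real.log T → 2 * a + 1 ≤ Real.log T →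
    ∫⁻ u in Set.Ioi 0, ENNReal.ofReal
      (shortSumError (T ^ (1 / 100 : ℝ)) T (Real.exp (1 / (6 * T))) u ^ 2 *
        u ^ (-(2 - 2 * (a / Real.log T)))) ≤ ENNReal.ofReal (C / T) := by
  obtain ⟨C₁, hC₁, h₁⟩ := exists_lintegral_shortSumError_Ioc_le a ha
  obtain ⟨C₂, hC₂, h₂⟩ := exists_lintegral_shortSumError_Ioi_le a ha
  refine ⟨C₁ + C₂, by positivity, fun T hT hL ha1 => ?_⟩
  rw [← Set.Ioc_union_Ioi_eq_Ioi hT.le, add_div, ENNReal.ofReal_add (by positivity) (by positivity)]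
  exact (lintegral_union_le _ _ _).trans (add_le_add (h₁ T hT hL ha1) (h₂ T hT hL ha1))

open FourierTransform in
/-- The Fourier integral of a function in `L¹ ∩ L²` represents its `L²` Fourier transform. -/
theorem fourier_toLp_ae_eq {f : ℝ → ℂ} (hf : Integrable f) (hf2 : MemLp f 2) :
    (𝓕 (hf2.toLp f) : Lp ℂ 2 (volume : Measure ℝ)) =ᵐ[volume] 𝓕 f := by
  set g : Lp ℂ 2 (volume : Measure ℝ) := 𝓕 (hf2.toLp f) with hg
  have hcont : Continuous (𝓕 f) :=
    VectorFourier.fourierIntegral_continuous Real.continuous_fourierChar (by fun_prop) hf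
  refine ae_eq_of_integral_contDiff_smul_eq ?_ hcont.locallyIntegrable fun φ hφ hφc => ?_
  · exact (Lp.memLp g).locallyIntegrable (by norm_num)
  have hψ : ContDiff ℝ (⊤ : ℕ∞) (fun x => (φ x : ℂ)) := Complex.ofRealCLM.contDiff.comp hφ
  have hψc : HasCompactSupport (fun x => (φ x : ℂ)) :=
    hφc.comp_left (g := fun x : ℝ => (x : ℂ)) Complex.ofReal_zero
  set ψ : SchwartzMap ℝ ℂ := hψc.toSchwartzMap hψ with hψdef
  have hψx : ∀ x, ψ x = (φ x : ℂ) := fun x => rfl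
  have h1 := congrArg (fun S => S ψ) (Lp.fourier_toTemperedDistribution_eq (hf2.toLp f))
  simp only [TemperedDistribution.fourier_apply, Lp.toTemperedDistribution_apply] at h1
  have h2 : ∫ x, (𝓕 ψ) x • f x = ∫ x, ψ x • (𝓕 f) x := by
    have := VectorFourier.integral_fourierIntegral_smul_eq_flip (L := innerₗ ℝ) (μ := volume)
      (ν := volume) (e := Real.fourierChar) (f := ψ) (g := f) Real.continuous_fourierChar
      (by fun_prop) ψ.integrable hf
    simpa using! this
  have h3 : ∫ x, (𝓕 ψ) x • (hf2.toLp f) x = ∫ x, (𝓕 ψ) x • f x := by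
    refine integral_congr_ae ?_
    filter_upwards [hf2.coeFn_toLp] with x hx
    rw [hx]
  have h4 : ∀ h : ℝ → ℂ, ∫ x, φ x • h x = ∫ x, ψ x • h x := fun h => by
    simp only [hψx, Complex.real_smul, smul_eq_mul]
  rw [h4, h4, ← h2, ← h3, ← h1]

open FourierTransform in
theorem lintegral_norm_fourier_sq {f : ℝ → ℂ} (hf : Integrable f) (hf2 : MemLp f 2) :
    ∫⁻ ξ, ENNReal.ofReal (‖𝓕 f ξ‖ ^ 2) = ∫⁻ x, ENNReal.ofReal (‖f x‖ ^ 2) := by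
  have h : ∀ h : ℝ → ℂ, ∫⁻ x, ENNReal.ofReal (‖h x‖ ^ 2) = eLpNorm h 2 volume ^ 2 := fun h => by
    rw [eLpNorm_eq_lintegral_rpow_enorm_toReal (by norm_num) (by norm_num), ← ENNReal.rpow_natCast,
      ← ENNReal.rpow_mul]
    norm_num
  rw [h, h, ← eLpNorm_congr_ae (fourier_toLp_ae_eq hf hf2), ← eLpNorm_congr_ae hf2.coeFn_toLp]
  have h1 := Lp.norm_fourier_eq (hf2.toLp f)
  rw [Lp.norm_def, Lp.norm_def, ENNReal.toReal_eq_toReal_iff' (Lp.eLpNorm_ne_top _)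
    (Lp.eLpNorm_ne_top _)] at h1
  rw [h1]

/-- The error in `⌊u⌋ ≈ u`, with the main term only subtracted for `u > U`. -/
noncomputable def floorError (U u : ℝ) : ℝ := ⌊u⌋₊ - if U < u then u else 0

theorem measurable_floorError (U : ℝ) : Measurable (floorError U) := by
  unfold floorError
  refine Measurable.sub ?_ (Measurable.ite measurableSet_Ioi measurable_id measurable_const)
  exact (measurable_from_nat (f := fun n : ℕ => (n : ℝ))).comp Nat.measurable_floor

theorem abs_floorError_le {U u : ℝ} (hU : 0 < U) : |floorError U u| ≤ 1 + U := by
  rw [floorError]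
  rcases le_or_gt u 0 with hu | hu
  · rw [Nat.floor_of_nonpos hu, if_neg (by linarith)]
    simp; linarith
  have h1 := Nat.floor_le hu.le
  have h2 := Nat.lt_floor_add_one u
  split_ifs with h
  · rw [abs_le]; constructor <;> linarith
  · rw [sub_zero, abs_of_nonneg (by positivity)]; linarith

theorem floorError_eventually_eq_zero {U : ℝ} (hU : 0 < U) :
    ∀ᶠ u in 𝓝[>] 0, floorError U u = 0 := by
  have h : Set.Iio (min 1 U) ∈ 𝓝 (0 : ℝ) := Iio_mem_nhds (by positivity)
  filter_upwards [mem_nhdsWithin_of_mem_nhds h] with u hu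
  have h1 : u < 1 := lt_of_lt_of_le hu (min_le_left _ _)
  have h2 : u < U := lt_of_lt_of_le hu (min_le_right _ _)
  rw [floorError, Nat.floor_eq_zero.mpr h1, if_neg h2.not_gt]
  simp

theorem locallyIntegrableOn_floorError {U : ℝ} (hU : 0 < U) :
    LocallyIntegrableOn (fun u => (floorError U u : ℂ)) (Set.Ioi 0) := by
  refine LocallyIntegrable.locallyIntegrableOn ?_ _
  refine (locallyIntegrable_const (1 + U)).mono
    (Complex.measurable_ofReal.comp (measurable_floorError U)).aestronglyMeasurable
    (Eventually.of_forall fun u => ?_)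
  rw [Complex.norm_real, Real.norm_eq_abs, Real.norm_eq_abs,
    abs_of_nonneg (by linarith : 0 ≤ 1 + U)]
  exact abs_floorError_le hU

theorem floorError_isBigO_atTop {U : ℝ} (hU : 0 < U) :
    (fun u => (floorError U u : ℂ)) =O[atTop] (fun u : ℝ => u ^ (-(0 : ℝ))) := by
  refine Asymptotics.IsBigO.of_bound (1 + U) (Eventually.of_forall fun u => ?_)
  rw [Complex.norm_real, Real.norm_eq_abs, neg_zero, Real.rpow_zero, norm_one, mul_one]
  exact abs_floorError_le hU

theorem floorError_isBigO_zero {U : ℝ} (hU : 0 < U) (b : ℝ) :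
    (fun u => (floorError U u : ℂ)) =O[𝓝[>] 0] (fun u : ℝ => u ^ (-b)) := by
  refine (Asymptotics.isBigO_zero _ _).congr' ?_ EventuallyEq.rfl
  filter_upwards [floorError_eventually_eq_zero hU] with u hu
  rw [hu, Complex.ofReal_zero]

theorem mellinConvergent_floorError {U : ℝ} (hU : 0 < U) {s : ℂ} (hs : 0 < s.re) :
    MellinConvergent (fun u => (floorError U u : ℂ)) (-s) :=
  mellinConvergent_of_isBigO_rpow (locallyIntegrableOn_floorError hU)
    (floorError_isBigO_atTop hU) (by simpa using hs) (floorError_isBigO_zero hU (-s.re - 1))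
    (by simp)

theorem differentiableAt_mellin_floorError {U : ℝ} (hU : 0 < U) {s : ℂ} (hs : 0 < s.re) :
    DifferentiableAt ℂ (mellin fun u => (floorError U u : ℂ)) (-s) :=
  mellin_differentiableAt_of_isBigO_rpow (locallyIntegrableOn_floorError hU)
    (floorError_isBigO_atTop hU) (by simpa using hs) (floorError_isBigO_zero hU (-s.re - 1))
    (by simp)

theorem riemannZeta_eq_mul_integral_floor {s : ℂ} (hs : 1 < s.re) :
    riemannZeta s = s * ∫ u in Set.Ioi (0 : ℝ), (u : ℂ) ^ (-s - 1) * (⌊u⌋₊ : ℂ) := by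
  have h := LSeries_eq_mul_integral (f := 1) (r := 1) zero_le_one hs
    (LSeriesSummable_one_iff.mpr hs) (by
      refine Asymptotics.IsBigO.of_bound 1 (Eventually.of_forall fun n => ?_)
      simp)
  rw [LSeries_one_eq_riemannZeta hs] at h
  rw [h]
  congr 1
  have h1 : ∀ u : ℝ, u ∉ Set.Ici (1 : ℝ) → u ∈ Set.Ioi (0 : ℝ) →
      (u : ℂ) ^ (-s - 1) * (⌊u⌋₊ : ℂ) = 0 := fun u hu _ => by
    rw [Nat.floor_eq_zero.mpr (not_le.mp hu)]; simp
  rw [setIntegral_eq_of_subset_of_forall_sdiff_eq_zero measurableSet_Ioi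
    (Set.Ici_subset_Ioi.mpr zero_lt_one : Set.Ici (1 : ℝ) ⊆ Set.Ioi 0)
    (fun u hu => h1 u hu.2 hu.1), integral_Ici_eq_integral_Ioi]
  refine setIntegral_congr_fun measurableSet_Ioi fun u _ => ?_
  simp only [Pi.one_apply, Finset.sum_const, Nat.card_Icc, nsmul_eq_mul, mul_one]
  rw [Nat.add_sub_cancel, mul_comm, neg_add']

theorem integral_Ioi_cpow_mul_ite {U : ℝ} (hU : 0 < U) {s : ℂ} (hs : 1 < s.re) :
    IntegrableOn (fun u : ℝ => (u : ℂ) ^ (-s - 1) * ((if U < u then u else 0 : ℝ) : ℂ))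
      (Set.Ioi 0) ∧
    ∫ u in Set.Ioi (0 : ℝ), (u : ℂ) ^ (-s - 1) * ((if U < u then u else 0 : ℝ) : ℂ) =
      (U : ℂ) ^ (1 - s) / (s - 1) := by
  have h1 : Set.EqOn (fun u : ℝ => (u : ℂ) ^ (-s - 1) * ((if U < u then u else 0 : ℝ) : ℂ))
      ((Set.Ioi U).indicator fun u : ℝ => (u : ℂ) ^ (-s)) (Set.Ioi 0) := by
    intro u hu
    have hu0 : (u : ℂ) ≠ 0 := Complex.ofReal_ne_zero.mpr (ne_of_gt hu)
    by_cases h : U < u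
    · simp only [h, if_true, Set.indicator_of_mem (Set.mem_Ioi.mpr h)]
      nth_rewrite 2 [← Complex.cpow_one (u : ℂ)]
      rw [← Complex.cpow_add _ _ hu0, sub_add_cancel]
    · simp [h]
  have h2 : (-s).re < -1 := by simpa using hs
  have h3 := integrableOn_Ioi_cpow_of_lt h2 hU
  refine ⟨(integrableOn_congr_fun h1 measurableSet_Ioi).mpr ?_, ?_⟩
  · exact ((integrable_indicator_iff measurableSet_Ioi).mpr h3).integrableOn
  · rw [setIntegral_congr_fun measurableSet_Ioi h1, setIntegral_indicator measurableSet_Ioi,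
      Set.inter_eq_right.mpr (Set.Ioi_subset_Ioi hU.le), integral_Ioi_cpow_of_lt h2 hU,
      neg_add_eq_sub, neg_div, ← div_neg, neg_sub]

theorem mellin_floorError_of_one_lt {U : ℝ} (hU : 0 < U) {s : ℂ} (hs : 1 < s.re) :
    mellin (fun u => (floorError U u : ℂ)) (-s) =
      riemannZeta s / s - (U : ℂ) ^ (1 - s) / (s - 1) := by
  have hs0 : s ≠ 0 := fun h => by rw [h] at hs; simp at hs; linarith
  obtain ⟨h1, h2⟩ := integral_Ioi_cpow_mul_ite hU hs
  have h3 := mellinConvergent_floorError hU (by linarith : 0 < s.re)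
  rw [riemannZeta_eq_mul_integral_floor hs, mul_div_cancel_left₀ _ hs0, ← h2, mellin,
    eq_sub_iff_add_eq]
  rw [MellinConvergent] at h3
  rw [← integral_add h3 h1]
  refine setIntegral_congr_fun measurableSet_Ioi fun u _ => ?_
  simp only [floorError, smul_eq_mul]
  push_cast
  ring

theorem differentiable_update_sub_one_mul_riemannZeta :
    Differentiable ℂ (Function.update (fun s => (s - 1) * riemannZeta s) 1 1) := by
  have h1 : DifferentiableOn ℂ (Function.update (fun s => (s - 1) * riemannZeta s) 1 1)
      (Set.univ \ {1}) := by
    intro s hs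
    have hs1 : s ≠ 1 := hs.2
    refine DifferentiableAt.differentiableWithinAt ?_
    refine DifferentiableAt.congr_of_eventuallyEq (f := fun s => (s - 1) * riemannZeta s) ?_ ?_
    · exact (differentiableAt_id.sub_const 1).mul (differentiableAt_riemannZeta hs1)
    · filter_upwards [isOpen_ne.mem_nhds hs1] with z hz
      exact Function.update_of_ne hz _ _
  rw [← differentiableOn_univ]
  refine (Complex.differentiableOn_compl_singleton_and_continuousAt_iff (c := 1) univ_mem).mp
    ⟨h1, ?_⟩
  rw [continuousAt_update_same]
  exact riemannZeta_residue_one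

theorem hasMellin_floorError {U : ℝ} (hU : 0 < U) {s : ℂ} (hs : 0 < s.re) (hs1 : s ≠ 1) :
    HasMellin (fun u => (floorError U u : ℂ)) (-s)
      (riemannZeta s / s - (U : ℂ) ^ (1 - s) / (s - 1)) := by
  refine ⟨mellinConvergent_floorError hU hs, ?_⟩
  set Z := Function.update (fun s => (s - 1) * riemannZeta s) 1 1 with hZ
  set H := {z : ℂ | 0 < z.re} with hH
  have hHo : IsOpen H := isOpen_lt continuous_const Complex.continuous_re
  have hU0 : (U : ℂ) ≠ 0 := Complex.ofReal_ne_zero.mpr hU.ne'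
  have hf : DifferentiableOn ℂ (fun z => mellin (fun u => (floorError U u : ℂ)) (-z) *
      (z * (z - 1))) H := by
    intro z hz
    refine DifferentiableAt.differentiableWithinAt ?_
    exact ((differentiableAt_mellin_floorError hU hz).comp z differentiableAt_id.neg).mul
      (by fun_prop)
  have hg : DifferentiableOn ℂ (fun z => Z z - z * (U : ℂ) ^ (1 - z)) H := by
    refine (differentiable_update_sub_one_mul_riemannZeta.sub ?_).differentiableOn
    exact differentiable_id.mul ((differentiable_const 1 |>.sub differentiable_id).const_cpow
      (Or.inl hU0))
  have heq : Set.EqOn (fun z => mellin (fun u => (floorError U u : ℂ)) (-z) * (z * (z - 1)))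
      (fun z => Z z - z * (U : ℂ) ^ (1 - z)) H := by
    refine (hf.analyticOnNhd hHo).eqOn_of_preconnected_of_eventuallyEq (hg.analyticOnNhd hHo)
      (convex_halfSpace_re_gt 0).isPreconnected (z₀ := 2) (by simp [hH]) ?_
    have h2 : {z : ℂ | 1 < z.re} ∈ 𝓝 (2 : ℂ) :=
      (isOpen_lt continuous_const Complex.continuous_re).mem_nhds (by simp)
    filter_upwards [h2] with z hz
    have hz1 : z ≠ 1 := fun h => by rw [h] at hz; simp at hz
    have hz0 : z ≠ 0 := fun h => by rw [h] at hz; simp at hz; linarith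
    have hz2 : z - 1 ≠ 0 := sub_ne_zero.mpr hz1
    rw [mellin_floorError_of_one_lt hU hz, hZ, Function.update_of_ne hz1]
    field_simp
  have hs0 : s ≠ 0 := fun h => by rw [h] at hs; simp at hs
  have hs2 : s - 1 ≠ 0 := sub_ne_zero.mpr hs1
  have h := heq (show s ∈ H from hs)
  simp only [hZ, Function.update_of_ne hs1] at h
  rw [← mul_left_inj' (mul_ne_zero hs0 hs2), h]
  field_simp

theorem HasMellin.congr_Ioi {f g : ℝ → ℂ} {s m : ℂ} (h : HasMellin f s m)
    (hfg : Set.EqOn f g (Set.Ioi 0)) : HasMellin g s m := by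
  have h1 : Set.EqOn (fun t : ℝ => (t : ℂ) ^ (s - 1) • f t) (fun t : ℝ => (t : ℂ) ^ (s - 1) • g t)
      (Set.Ioi 0) := fun t ht => by simp only [hfg ht]
  exact ⟨(integrableOn_congr_fun h1 measurableSet_Ioi).mp h.1,
    (setIntegral_congr_fun measurableSet_Ioi h1).symm.trans h.2⟩

theorem hasMellin_sum {ι : Type*} (S : Finset ι) {f : ι → ℝ → ℂ} {s : ℂ} {m : ι → ℂ}
    (h : ∀ i ∈ S, HasMellin (f i) s (m i)) :
    HasMellin (fun t => ∑ i ∈ S, f i t) s (∑ i ∈ S, m i) := by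
  have h1 : ∀ t : ℝ, (t : ℂ) ^ (s - 1) • ∑ i ∈ S, f i t = ∑ i ∈ S, (t : ℂ) ^ (s - 1) • f i t :=
    fun t => Finset.smul_sum
  constructor
  · simp only [MellinConvergent, h1]
    exact integrable_finsetSum S fun i hi => (h i hi).1
  · simp only [mellin, h1]
    rw [integral_finsetSum S fun i hi => (h i hi).1]
    exact Finset.sum_congr rfl fun i hi => (h i hi).2

theorem hasMellin_floorError_mul {T b : ℝ} (hT : 0 < T) (hb : 0 < b) {s : ℂ} (hs : 0 < s.re)
    (hs1 : s ≠ 1) : HasMellin (fun u => (floorError (b * T) (b * u) : ℂ)) (-s)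
      ((b : ℂ) ^ s * (riemannZeta s / s) - b * ((T : ℂ) ^ (1 - s) / (s - 1))) := by
  have h := hasMellin_floorError (mul_pos hb hT) hs hs1
  have hb0 : (b : ℂ) ≠ 0 := Complex.ofReal_ne_zero.mpr hb.ne'
  refine ⟨(MellinConvergent.comp_mul_left (f := fun u => (floorError (b * T) u : ℂ)) hb).mpr h.1,
    ?_⟩
  rw [mellin_comp_mul_left (fun u => (floorError (b * T) u : ℂ)) (-s) hb, h.2, neg_neg,
    Complex.ofReal_mul, Complex.mul_cpow_ofReal_nonneg hb.le hT.le, Complex.cpow_sub _ _ hb0,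
    Complex.cpow_one, smul_eq_mul]
  have : (b : ℂ) ^ s ≠ 0 := fun h => hb0 ((Complex.cpow_eq_zero_iff _ _).mp h).1
  field_simp

theorem hasMellin_indicator_Ico {κ : ℝ} (hκ : 1 < κ) {s : ℂ} (hs : s ≠ 0) :
    HasMellin (fun u => (((Set.Ico (1 / κ) 1).indicator (fun _ => (1 : ℝ)) u : ℝ) : ℂ)) (-s)
      (((κ : ℂ) ^ s - 1) / s) := by
  have hκ0 : 0 < κ := by linarith
  have hκ1 : 1 / κ ≤ 1 := by rw [div_le_one hκ0]; exact hκ.le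
  have hκ2 : 0 < 1 / κ := by positivity
  have h0 : (0 : ℝ) ∉ Set.uIcc (1 / κ) 1 := by
    rw [Set.uIcc_of_le hκ1]; exact fun h => absurd h.1 (by linarith)
  have h1 : (fun u : ℝ => (u : ℂ) ^ (-s - 1) •
      (((Set.Ico (1 / κ) 1).indicator (fun _ => (1 : ℝ)) u : ℝ) : ℂ)) =
      (Set.Ico (1 / κ) 1).indicator fun u : ℝ => (u : ℂ) ^ (-s - 1) := by
    ext u
    by_cases hu : u ∈ Set.Ico (1 / κ) 1
    · rw [Set.indicator_of_mem hu, Set.indicator_of_mem hu, Complex.ofReal_one, smul_eq_mul,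
        mul_one]
    · rw [Set.indicator_of_notMem hu, Set.indicator_of_notMem hu, Complex.ofReal_zero, smul_zero]
  have hint : IntegrableOn (fun u : ℝ => (u : ℂ) ^ (-s - 1)) (Set.Ico (1 / κ) 1) := by
    have := intervalIntegral.intervalIntegrable_cpow (μ := volume) (r := -s - 1) (Or.inr h0)
    rw [intervalIntegrable_iff_integrableOn_Ico_of_le hκ1] at this
    exact this
  constructor
  · rw [MellinConvergent, h1]
    exact ((integrable_indicator_iff measurableSet_Ico).mpr hint).integrableOn
  · have hsub : Set.Ico (1 / κ) 1 ⊆ Set.Ioi 0 := fun u hu => lt_of_lt_of_le hκ2 hu.1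
    rw [mellin, h1, setIntegral_indicator measurableSet_Ico, Set.inter_eq_right.mpr hsub,
      integral_Ico_eq_integral_Ioc,
      ← intervalIntegral.integral_of_le hκ1, integral_cpow]
    · rw [sub_add_cancel, Complex.ofReal_one, Complex.one_cpow, Complex.ofReal_div,
        Complex.ofReal_one, one_div, Complex.inv_cpow, Complex.cpow_neg, inv_inv, div_neg,
        ← neg_div, neg_sub]
      rw [Complex.arg_ofReal_of_nonneg hκ0.le]
      exact Real.pi_pos.ne
    · refine Or.inr ⟨fun h => hs ?_, h0⟩
      linear_combination -h

theorem sum_Ioc_mollifiedCoeff {X : ℝ} (hX : 1 < X) (N : ℕ) :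
    ∑ n ∈ Finset.Ioc 0 N, mollifiedCoeff X n =
      ∑ d ∈ Finset.Ioc 0 ⌊X ^ 2⌋₊, selbergWeight X d * (N / d : ℕ) := by
  rw [Finset.sum_congr rfl fun n hn => mollifiedCoeff_eq hX n (Finset.mem_Ioc.mp hn).1,
    Finset.sum_comm]
  refine Finset.sum_congr rfl fun d _ => ?_
  rw [← Finset.sum_filter, Finset.sum_const, Nat.Ioc_filter_dvd_card_eq_div, nsmul_eq_mul, mul_comm]

theorem sum_Ioc_ite_mollifiedCoeff {X : ℝ} (hX : 1 < X) (N : ℕ) :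
    ∑ n ∈ Finset.Ioc 0 N, (if n = 1 then 0 else mollifiedCoeff X n) =
      ∑ d ∈ Finset.Ioc 0 ⌊X ^ 2⌋₊, selbergWeight X d * (N / d : ℕ) - if 1 ≤ N then 1 else 0 := by
  rw [← sum_Ioc_mollifiedCoeff hX, eq_sub_iff_add_eq]
  have : (if 1 ≤ N then (1 : ℝ) else 0) = ∑ n ∈ Finset.Ioc 0 N, if n = 1 then 1 else 0 := by
    rw [Finset.sum_ite_eq' (Finset.Ioc 0 N) 1 (fun _ => (1 : ℝ))]
    simp
  rw [this, ← Finset.sum_add_distrib]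
  refine Finset.sum_congr rfl fun n _ => ?_
  split_ifs with h
  · rw [h, mollifiedCoeff_one hX, zero_add]
  · rw [add_zero]

theorem selbergSum_one_one (X : ℝ) : selbergSum X 1 1 =
    ∑ d ∈ Finset.Ioc 0 ⌊X ^ 2⌋₊, selbergWeight X d * (1 / d) := by
  rw [selbergSum, Finset.filter_true_of_mem fun d _ => one_dvd d]
  refine Finset.sum_congr rfl fun d _ => ?_
  rw [Real.rpow_neg_one, one_div]

theorem shortSumError_eq {X T κ u : ℝ} (hX : 1 < X) (hκ : 1 < κ) (hu : 0 < u) :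
    shortSumError X T κ u = ∑ d ∈ Finset.Ioc 0 ⌊X ^ 2⌋₊, selbergWeight X d *
      (floorError (κ / d * T) (κ / d * u) - floorError (1 / d * T) (1 / d * u)) -
      (Set.Ico (1 / κ) 1).indicator (fun _ => (1 : ℝ)) u := by
  have hκ0 : 0 < κ := by linarith
  have h1 : u ≤ κ * u := by nlinarith
  have h2 := Finset.sum_Ioc_consecutive (fun n => if n = 1 then 0 else mollifiedCoeff X n)
    (Nat.zero_le ⌊u⌋₊) (Nat.floor_le_floor h1)
  rw [sum_Ioc_ite_mollifiedCoeff hX, sum_Ioc_ite_mollifiedCoeff hX] at h2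
  have h3 : (Set.Ico (1 / κ) 1).indicator (fun _ => (1 : ℝ)) u =
      (if 1 ≤ ⌊κ * u⌋₊ then 1 else 0) - if 1 ≤ ⌊u⌋₊ then 1 else 0 := by
    simp only [Set.indicator_apply, Set.mem_Ico, div_le_iff₀' hκ0, Nat.one_le_floor_iff]
    split_ifs <;> first | (exfalso; grind) | norm_num
  have h4 : ∀ d ∈ Finset.Ioc 0 ⌊X ^ 2⌋₊, selbergWeight X d *
      (floorError (κ / d * T) (κ / d * u) - floorError (1 / d * T) (1 / d * u)) =
      selbergWeight X d * ((⌊κ * u⌋₊ / d : ℕ)) - selbergWeight X d * ((⌊u⌋₊ / d : ℕ)) -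
        (if T < u then (κ - 1) * u else 0) * (selbergWeight X d * (1 / d)) := by
    intro d hd
    have hd0 : (0 : ℝ) < d := by exact_mod_cast (Finset.mem_Ioc.mp hd).1
    have h5 : κ / d * T < κ / d * u ↔ T < u := mul_lt_mul_iff_right₀ (by positivity)
    have h6 : 1 / d * T < 1 / d * u ↔ T < u := mul_lt_mul_iff_right₀ (by positivity)
    have h7 : ⌊κ / d * u⌋₊ = ⌊κ * u⌋₊ / d := by
      rw [← Nat.floor_div_natCast]; congr 1; ring
    have h8 : ⌊1 / d * u⌋₊ = ⌊u⌋₊ / d := by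
      rw [← Nat.floor_div_natCast]; congr 1; ring
    rw [floorError, floorError, h7, h8]
    simp only [h5, h6]
    split_ifs <;> ring
  rw [Finset.sum_congr rfl h4, Finset.sum_sub_distrib, Finset.sum_sub_distrib, ← Finset.mul_sum,
    ← selbergSum_one_one, h3, shortSumError]
  have h9 : (if T < u then (κ - 1) * u * selbergSum X 1 1 else 0) =
      (if T < u then (κ - 1) * u else 0) * selbergSum X 1 1 := by split_ifs <;> ring
  rw [h9]
  linarith

/-- The Dirichlet polynomial with coefficients `selbergWeight X d`. -/
noncomputable def mollifier (X : ℝ) (s : ℂ) : ℂ :=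
  ∑ d ∈ Finset.Ioc 0 ⌊X ^ 2⌋₊, (selbergWeight X d : ℂ) * (d : ℂ) ^ (-s)

theorem hasMellin_shortSumError {X T κ : ℝ} (hX : 1 < X) (hT : 0 < T) (hκ : 1 < κ) {s : ℂ}
    (hs : 0 < s.re) (hs1 : s ≠ 1) :
    HasMellin (fun u => (shortSumError X T κ u : ℂ)) (-s)
      ((riemannZeta s * mollifier X s - 1) * (((κ : ℂ) ^ s - 1) / s) -
        selbergSum X 1 1 * (κ - 1) * ((T : ℂ) ^ (1 - s) / (s - 1))) := by
  have hκ0 : 0 < κ := by linarith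
  have hs0 : s ≠ 0 := fun h => by rw [h] at hs; simp at hs
  have hd : ∀ d ∈ Finset.Ioc 0 ⌊X ^ 2⌋₊, HasMellin (fun u => (selbergWeight X d : ℂ) *
      ((floorError (κ / d * T) (κ / d * u) : ℂ) - (floorError (1 / d * T) (1 / d * u) : ℂ))) (-s)
      ((selbergWeight X d : ℂ) * (((d : ℂ) ^ (-s)) * (((κ : ℂ) ^ s - 1) / s) * riemannZeta s -
        (κ - 1) / d * ((T : ℂ) ^ (1 - s) / (s - 1)))) := by
    intro d hd
    have hd0 : (0 : ℝ) < d := by exact_mod_cast (Finset.mem_Ioc.mp hd).1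
    have h1 := hasMellin_floorError_mul hT (by positivity : 0 < κ / d) hs hs1
    have h2 := hasMellin_floorError_mul hT (by positivity : (0 : ℝ) < 1 / d) hs hs1
    have h3 := hasMellin_sub h1.1 h2.1
    have h4 := hasMellin_const_smul h3.1 (selbergWeight X d : ℂ)
    refine ⟨h4.1, h4.2.trans ?_⟩
    rw [h3.2, h1.2, h2.2, smul_eq_mul]
    congr 1
    have h5 : ((κ / d : ℝ) : ℂ) ^ s = (κ : ℂ) ^ s * (d : ℂ) ^ (-s) := by
      rw [div_eq_mul_inv, Complex.ofReal_mul, Complex.mul_cpow_ofReal_nonneg hκ0.le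
        (by positivity), Complex.ofReal_inv, Complex.ofReal_natCast, Complex.inv_cpow,
        Complex.cpow_neg]
      rw [Complex.natCast_arg]
      exact Real.pi_pos.ne
    have h6 : ((1 / d : ℝ) : ℂ) ^ s = (d : ℂ) ^ (-s) := by
      rw [one_div, Complex.ofReal_inv, Complex.ofReal_natCast, Complex.inv_cpow,
        Complex.cpow_neg]
      rw [Complex.natCast_arg]
      exact Real.pi_pos.ne
    rw [h5, h6]
    push_cast
    ring
  have h1 := hasMellin_sum _ hd
  have h2 := hasMellin_indicator_Ico hκ hs0
  have h3 := hasMellin_sub h1.1 h2.1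
  have h4 : HasMellin _ _ _ := h3.congr_Ioi (g := fun u => (shortSumError X T κ u : ℂ)) (by
    intro u hu
    simp only
    rw [shortSumError_eq hX hκ hu]
    push_cast
    rfl)
  refine ⟨h4.1, h4.2.trans ?_⟩
  rw [h1.2, h2.2, mollifier, selbergSum_one_one]
  push_cast
  generalize ((κ : ℂ) ^ s - 1) / s = K
  generalize (T : ℂ) ^ (1 - s) / (s - 1) = V
  have h5 : ∀ d ∈ Finset.Ioc 0 ⌊X ^ 2⌋₊, (selbergWeight X d : ℂ) *
      ((d : ℂ) ^ (-s) * K * riemannZeta s - (κ - 1) / d * V) =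
      riemannZeta s * K * ((selbergWeight X d : ℂ) * (d : ℂ) ^ (-s)) -
        (κ - 1) * V * ((selbergWeight X d : ℂ) * (1 / d)) := fun d _ => by ring
  rw [Finset.sum_congr rfl h5, Finset.sum_sub_distrib, ← Finset.mul_sum, ← Finset.mul_sum]
  ring

theorem image_exp_neg_univ : (fun x => Real.exp (-x)) '' Set.univ = Set.Ioi (0 : ℝ) := by
  rw [← Function.comp_def Real.exp, Set.image_comp, Set.image_univ_of_surjective neg_surjective,
    Set.image_univ, Real.range_exp]

theorem hasDerivWithinAt_exp_neg (x : ℝ) :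
    HasDerivWithinAt (fun x => Real.exp (-x)) (-Real.exp (-x)) Set.univ x :=
  mul_neg_one (Real.exp (-x)) ▸
    ((Real.hasDerivAt_exp (-x)).comp x (hasDerivAt_neg x)).hasDerivWithinAt

theorem injOn_exp_neg : Set.univ.InjOn fun x => Real.exp (-x) :=
  fun _ _ _ _ h => neg_injective (Real.exp_injective h)

theorem lintegral_Ioi_eq_lintegral_exp_neg (h : ℝ → ENNReal) :
    ∫⁻ u in Set.Ioi (0 : ℝ), h u = ∫⁻ x, ENNReal.ofReal (Real.exp (-x)) * h (Real.exp (-x)) := by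
  rw [← image_exp_neg_univ, lintegral_image_eq_lintegral_abs_deriv_mul MeasurableSet.univ
    (fun x _ => hasDerivWithinAt_exp_neg x) injOn_exp_neg, Measure.restrict_univ]
  simp only [abs_neg, Real.abs_exp]

theorem lintegral_comp_mul_right (h : ℝ → ENNReal) {a : ℝ} (ha : a ≠ 0) :
    ∫⁻ t, h (t * a) = ENNReal.ofReal |a⁻¹| * ∫⁻ t, h t := by
  have h1 := (measurableEmbedding_mulRight₀ ha).lintegral_map (μ := volume) h
  rw [Real.map_volume_mul_right ha, lintegral_smul_measure] at h1
  exact h1.symm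

theorem lintegral_norm_mellin_neg_sq {f : ℝ → ℂ} {σ : ℝ} (hf : MellinConvergent f (-σ : ℂ))
    (hf2 : ∫⁻ u in Set.Ioi (0 : ℝ), ENNReal.ofReal (‖f u‖ ^ 2 * u ^ (-(2 * σ) - 1)) ≠ ⊤) :
    ∫⁻ t : ℝ, ENNReal.ofReal (‖mellin f (-(σ + t * Complex.I))‖ ^ 2) =
      ENNReal.ofReal (2 * Real.pi) *
        ∫⁻ u in Set.Ioi (0 : ℝ), ENNReal.ofReal (‖f u‖ ^ 2 * u ^ (-(2 * σ) - 1)) := by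
  set g : ℝ → ℂ := fun x => Real.exp (σ * x) • f (Real.exp (-x)) with hg
  have hgi : Integrable g := by
    have h1 := hf
    rw [MellinConvergent, ← image_exp_neg_univ,
      integrableOn_image_iff_integrableOn_abs_deriv_smul MeasurableSet.univ
        (fun x _ => hasDerivWithinAt_exp_neg x) injOn_exp_neg, integrableOn_univ] at h1
    refine h1.congr (Eventually.of_forall fun x => ?_)
    simp only [hg, abs_neg, Real.abs_exp, Complex.real_smul, smul_eq_mul]
    rw [← mul_assoc]
    congr 1
    rw [Complex.cpow_def_of_ne_zero (by exact_mod_cast (Real.exp_pos _).ne'),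
      ← Complex.ofReal_log (Real.exp_pos _).le, Real.log_exp]
    push_cast
    rw [← Complex.exp_add]
    congr 1
    ring
  have h2 : ∫⁻ u in Set.Ioi (0 : ℝ), ENNReal.ofReal (‖f u‖ ^ 2 * u ^ (-(2 * σ) - 1)) =
      ∫⁻ x, ENNReal.ofReal (‖g x‖ ^ 2) := by
    rw [lintegral_Ioi_eq_lintegral_exp_neg]
    refine lintegral_congr fun x => ?_
    rw [← ENNReal.ofReal_mul (Real.exp_pos _).le]
    congr 1
    rw [hg, norm_smul, Real.norm_eq_abs, Real.abs_exp, mul_pow, ← Real.exp_mul,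
      ← Real.exp_nat_mul, mul_left_comm, ← Real.exp_add, mul_comm]
    congr 2
    push_cast
    ring
  have hg2 : MemLp g 2 := by
    refine ⟨hgi.1, ?_⟩
    rw [eLpNorm_lt_top_iff_lintegral_rpow_enorm_lt_top (by norm_num) (by norm_num)]
    rw [h2] at hf2
    refine lt_of_eq_of_lt (lintegral_congr fun x => ?_) hf2.lt_top
    rw [ENNReal.toReal_ofNat, ENNReal.rpow_ofNat, ← ofReal_norm, ENNReal.ofReal_pow (norm_nonneg _)]
  have hm : ∀ t : ℝ, mellin f (-(σ + t * Complex.I)) =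
      FourierTransform.fourier g (t * (-(2 * Real.pi)⁻¹)) := by
    intro t
    rw [mellin_eq_fourier]
    simp [hg, div_eq_mul_inv]
  simp only [hm]
  rw [lintegral_comp_mul_right (fun ξ => ENNReal.ofReal (‖FourierTransform.fourier g ξ‖ ^ 2))
    (by simp [Real.pi_ne_zero]), lintegral_norm_fourier_sq hgi hg2, h2]
  congr 2
  rw [inv_neg, inv_inv, abs_neg, abs_of_pos (by positivity)]

theorem norm_div_two_le_norm_exp_sub_one {z : ℂ} (hx : 0 ≤ z.re) (hy : |z.im| ≤ Real.pi) :
    ‖z‖ / 2 ≤ ‖Complex.exp z - 1‖ := by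
  refine le_of_sq_le_sq ?_ (norm_nonneg _)
  have h1 : 1 + z.re ≤ Real.exp z.re := by linarith [Real.add_one_le_exp z.re]
  have h2 := Real.cos_le_one_sub_mul_cos_sq hy
  have h3 : 1 / 5 ≤ 2 / Real.pi ^ 2 := by
    rw [div_le_div_iff₀ (by norm_num) (by positivity)]
    have := Real.pi_lt_d2
    have := Real.pi_pos
    nlinarith
  have h4 : 1 / 5 * z.im ^ 2 ≤ 1 - Real.cos z.im := by
    nlinarith [sq_nonneg z.im, mul_le_mul_of_nonneg_right h3 (sq_nonneg z.im)]
  rw [div_pow, Complex.sq_norm, Complex.sq_norm, Complex.normSq_apply, Complex.normSq_apply,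
    Complex.sub_re, Complex.sub_im, Complex.exp_re, Complex.exp_im, Complex.one_re, Complex.one_im]
  have h5 := Real.sin_sq_add_cos_sq z.im
  set e := Real.exp z.re
  have h6 : (e * Real.cos z.im - 1) * (e * Real.cos z.im - 1) +
      (e * Real.sin z.im - 0) * (e * Real.sin z.im - 0) =
      (e - 1) ^ 2 + 2 * e * (1 - Real.cos z.im) := by linear_combination e ^ 2 * h5
  rw [h6]
  have h7 : z.re ^ 2 ≤ (e - 1) ^ 2 := pow_le_pow_left₀ hx (by linarith) 2
  have h8 : 0 ≤ 1 - Real.cos z.im := by linarith [Real.cos_le_one z.im]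
  have h9 : 2 * (1 - Real.cos z.im) ≤ 2 * e * (1 - Real.cos z.im) :=
    mul_le_mul_of_nonneg_right (by linarith) h8
  nlinarith [sq_nonneg z.re, sq_nonneg z.im]

theorem exists_abs_selbergSum_one_le : ∃ C : ℝ, 0 < C ∧ ∀ X : ℝ, 3 ≤ X →
    |selbergSum X 1 1| ≤ C := by
  obtain ⟨C, hC, h⟩ := exists_sum_selbergSum_sq_le
  refine ⟨C + 1, by positivity, fun X hX => ?_⟩
  have h1 := h X 0 (by linarith) le_rfl (by simp)
  have hl : 1 ≤ Real.log X := by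
    rw [Real.le_log_iff_exp_le (by linarith)]
    linarith [Real.exp_one_lt_d9]
  have h2 : C / Real.log X ≤ C := div_le_self hC.le hl
  have h3 : (1 : ℕ) ∈ Finset.Ioc 0 ⌊X ^ 2⌋₊ :=
    Finset.mem_Ioc.mpr ⟨one_pos, Nat.le_floor (by push_cast; nlinarith)⟩
  have h4 := Finset.single_le_sum (f := fun q : ℕ => (q : ℝ) ^ (1 + (0 : ℝ)) *
    selbergSum X (1 + 0) q ^ 2) (fun q _ => by positivity) h3
  simp only [Nat.cast_one, Real.one_rpow, one_mul, add_zero] at h1 h4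
  have h5 : |selbergSum X 1 1| ^ 2 ≤ C := by rw [sq_abs]; linarith
  nlinarith [abs_nonneg (selbergSum X 1 1)]

theorem shortSumError_eq_zero {X T κ u : ℝ} (hX : 1 < X) (hκ : 0 < κ) (hu : 0 ≤ u)
    (hκu : κ * u ≤ X) (huT : u ≤ T) : shortSumError X T κ u = 0 := by
  rw [shortSumError, if_neg (not_lt.mpr huT), sub_zero]
  refine Finset.sum_eq_zero fun n hn => ?_
  split_ifs with h
  · rfl
  · rw [Finset.mem_Ioc] at hn
    exact mollifiedCoeff_of_le hX (by omega)
      (((Nat.le_floor_iff (by positivity)).mp hn.2).trans hκu)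

theorem norm_zeta_mul_mollifier_sub_one_le {X T : ℝ} (hX : 1 < X) (hT : 101 ≤ T) {σ t : ℝ}
    (hσ : 0 < σ) (ht : T - 1 ≤ t) (ht' : t ≤ 2 * T + 1) :
    ‖riemannZeta (σ + t * Complex.I) * mollifier X (σ + t * Complex.I) - 1‖ ≤
      12 * T * (‖mellin (fun u => (shortSumError X T (Real.exp (1 / (6 * T))) u : ℂ))
        (-(σ + t * Complex.I))‖ + |selbergSum X 1 1| * T ^ (-σ - 1)) := by
  set s : ℂ := σ + t * Complex.I with hs
  have hre : s.re = σ := by simp [hs]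
  have him : s.im = t := by simp [hs]
  have hT0 : 0 < T := by linarith
  have hδ : 0 < 1 / (6 * T) := by positivity
  set κ := Real.exp (1 / (6 * T)) with hκd
  have hκ : 1 < κ := Real.one_lt_exp_iff.mpr hδ
  have hs1 : s ≠ 1 := fun h => by
    have := congrArg Complex.im h
    rw [him, Complex.one_im] at this
    linarith
  have hm := (hasMellin_shortSumError hX hT0 hκ (hre ▸ hσ) hs1).2
  have hκs : (κ : ℂ) ^ s = Complex.exp ((1 / (6 * T) : ℝ) * s) := by
    rw [Complex.cpow_def_of_ne_zero (by exact_mod_cast (Real.exp_pos _).ne'),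
      ← Complex.ofReal_log (Real.exp_pos _).le, Real.log_exp]
  have h1 : ‖s‖ ≤ 12 * T * ‖(κ : ℂ) ^ s - 1‖ := by
    have h := norm_div_two_le_norm_exp_sub_one (z := (1 / (6 * T) : ℝ) * s)
      (by rw [Complex.re_ofReal_mul, hre]; positivity) (by
        rw [Complex.im_ofReal_mul, him, abs_of_nonneg (by apply mul_nonneg hδ.le; linarith),
          one_div_mul_eq_div, div_le_iff₀ (by positivity)]
        nlinarith [Real.pi_gt_three])
    rw [← hκs, norm_mul, Complex.norm_real, Real.norm_of_nonneg hδ.le] at h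
    calc ‖s‖ = 12 * T * (1 / (6 * T) * ‖s‖ / 2) := by field_simp; ring
      _ ≤ _ := by gcongr
  have hs0 : 0 < ‖s‖ := norm_pos_iff.mpr fun h => by rw [h] at hre; simp at hre; linarith
  have hκ0 : 0 < ‖(κ : ℂ) ^ s - 1‖ := by
    by_contra! h
    nlinarith [norm_nonneg ((κ : ℂ) ^ s - 1)]
  set V : ℂ := selbergSum X 1 1 * (κ - 1) * ((T : ℂ) ^ (1 - s) / (s - 1)) with hV
  have h2 : ‖riemannZeta s * mollifier X s - 1‖ ≤
      12 * T * ‖mellin (fun u => (shortSumError X T κ u : ℂ)) (-s) + V‖ := by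
    have : mellin (fun u => (shortSumError X T κ u : ℂ)) (-s) + V =
        (riemannZeta s * mollifier X s - 1) * (((κ : ℂ) ^ s - 1) / s) := by rw [hm]; ring
    rw [this, norm_mul, norm_div]
    calc ‖riemannZeta s * mollifier X s - 1‖ =
        ‖riemannZeta s * mollifier X s - 1‖ * (‖s‖ / ‖s‖) := by rw [div_self hs0.ne', mul_one]
      _ ≤ ‖riemannZeta s * mollifier X s - 1‖ * (12 * T * ‖(κ : ℂ) ^ s - 1‖ / ‖s‖) := by gcongr
      _ = _ := by ring
  have h3 : ‖V‖ ≤ |selbergSum X 1 1| * T ^ (-σ - 1) := by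
    rw [hV, norm_mul, norm_mul, Complex.norm_real, Real.norm_eq_abs, mul_assoc]
    refine mul_le_mul_of_nonneg_left ?_ (abs_nonneg _)
    have h4 : ‖(κ : ℂ) - 1‖ ≤ 1 / (3 * T) := by
      rw [← Complex.ofReal_one, ← Complex.ofReal_sub, Complex.norm_real,
        Real.norm_of_nonneg (by linarith)]
      exact kappa_sub_one_le (by linarith)
    have h5 : T / 3 ≤ ‖s - 1‖ := by
      refine le_trans ?_ (Complex.abs_im_le_norm _)
      rw [Complex.sub_im, him, Complex.one_im, sub_zero]
      exact le_trans (by linarith) (le_abs_self t)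
    rw [norm_div, Complex.norm_cpow_eq_rpow_re_of_pos hT0, Complex.sub_re, hre, Complex.one_re]
    calc ‖(κ : ℂ) - 1‖ * (T ^ (1 - σ) / ‖s - 1‖) ≤ 1 / (3 * T) * (T ^ (1 - σ) / (T / 3)) := by
          gcongr
      _ = T ^ (-σ - 1) := by
          rw [show -σ - 1 = 1 - σ - 2 by ring, Real.rpow_sub hT0 (1 - σ) 2, Real.rpow_two]
          field_simp
  refine h2.trans (mul_le_mul_of_nonneg_left ?_ (by positivity))
  exact (norm_add_le _ _).trans (by gcongr)

theorem lintegral_shortSumError_sq_mul_le {X T κ b σ : ℝ} (hX : 2 ≤ X) (hXT : X ≤ T) (hκ : 0 < κ)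
    (hκ2 : κ ≤ 2) (hσ : 1 / 2 - b ≤ σ) :
    ∫⁻ u in Set.Ioi (0 : ℝ),
        ENNReal.ofReal (‖(shortSumError X T κ u : ℂ)‖ ^ 2 * u ^ (-(2 * σ) - 1)) ≤
      ENNReal.ofReal ((X / 2) ^ (-(2 * (σ - (1 / 2 - b))))) *
        ∫⁻ u in Set.Ioi (0 : ℝ),
          ENNReal.ofReal (shortSumError X T κ u ^ 2 * u ^ (-(2 - 2 * b))) := by
  rw [← lintegral_const_mul' _ _ ENNReal.ofReal_ne_top]
  refine setLIntegral_mono' measurableSet_Ioi fun u hu => ?_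
  have hu0 : 0 < u := hu
  rw [← ENNReal.ofReal_mul (by positivity)]
  refine ENNReal.ofReal_le_ofReal ?_
  rw [Complex.norm_real, Real.norm_eq_abs, sq_abs]
  rcases lt_or_ge u (X / 2) with h | h
  · rw [shortSumError_eq_zero (by linarith) hκ hu0.le (by nlinarith) (by linarith)]
    simp
  · rw [show -(2 * σ) - 1 = -(2 * (σ - (1 / 2 - b))) + -(2 - 2 * b) by ring, Real.rpow_add hu0,
      mul_left_comm]
    refine mul_le_mul_of_nonneg_right ?_ (by positivity)
    exact Real.rpow_le_rpow_of_nonpos (by linarith) h (by linarith)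

theorem rpow_le_self_of_log {T : ℝ} (hT : 1 ≤ T) : T ^ (1 / 100 : ℝ) ≤ T := by
  calc T ^ (1 / 100 : ℝ) ≤ T ^ (1 : ℝ) := Real.rpow_le_rpow_of_exponent_le hT (by norm_num)
    _ = T := Real.rpow_one T

theorem rpow_neg_le_rpow_half {T a σ : ℝ} (hT : 1 < T)
    (hσ : 1 / 2 - a / Real.log T ≤ σ) :
    T ^ (-(2 * σ)) ≤ Real.exp (2 * a) * (T ^ (1 / 100 : ℝ) / 2) ^
      (-(2 * (σ - (1 / 2 - a / Real.log T)))) / T := by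
  have hT0 : 0 < T := by linarith
  have h1 : T ^ (-(2 * σ)) =
      Real.exp (2 * a) * T ^ (-(2 * (σ - (1 / 2 - a / Real.log T)))) / T := by
    rw [← rpow_div_log hT, ← Real.rpow_add hT0, div_eq_mul_inv, ← Real.rpow_neg_one,
      ← Real.rpow_add hT0]
    congr 1
    ring
  rw [h1]
  gcongr ?_ * ?_ / _
  refine Real.rpow_le_rpow_of_nonpos (by positivity) ?_ (by linarith)
  linarith [rpow_le_self_of_log hT.le]

theorem MellinConvergent.of_re_eq {f : ℝ → ℂ} {s s' : ℂ} (h : MellinConvergent f s)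
    (hs : s.re = s'.re) : MellinConvergent f s' := by
  have h1 : ∀ t ∈ Set.Ioi (0 : ℝ), (t : ℂ) ^ (s' - s) * ((t : ℂ) ^ (s - 1) • f t) =
      (t : ℂ) ^ (s' - 1) • f t := by
    intro t ht
    rw [smul_eq_mul, smul_eq_mul, ← mul_assoc,
      ← Complex.cpow_add _ _ (Complex.ofReal_ne_zero.mpr (ne_of_gt ht)), sub_add_sub_cancel]
  refine IntegrableOn.congr_fun ?_ h1 measurableSet_Ioi
  refine Integrable.bdd_mul (c := 1) h ?_ ?_
  · refine ContinuousOn.aestronglyMeasurable ?_ measurableSet_Ioi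
    intro t ht
    exact (Complex.continuousAt_ofReal_cpow_const _ _ (Or.inr (ne_of_gt ht))).continuousWithinAt
  · filter_upwards [ae_restrict_mem measurableSet_Ioi] with t ht
    rw [Complex.norm_cpow_eq_rpow_re_of_pos ht, Complex.sub_re, hs, sub_self, Real.rpow_zero]

theorem exists_lintegral_zeta_mul_mollifier_sub_one_le (a : ℝ) (ha : 0 < a) :
    ∃ C : ℝ, 0 < C ∧ ∀ T : ℝ, 0 < T → 200 ≤ Real.log T → 2 * a + 1 ≤ Real.log T →
      ∀ σ : ℝ, 1 / 2 - a / Real.log T ≤ σ →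
      ∫⁻ t in Set.Icc (T - 1) (2 * T + 1),
        ENNReal.ofReal (‖riemannZeta (σ + t * Complex.I) *
          mollifier (T ^ (1 / 100 : ℝ)) (σ + t * Complex.I) - 1‖ ^ 2) ≤
      ENNReal.ofReal (C * T * (T ^ (1 / 100 : ℝ) / 2) ^
        (-(2 * (σ - (1 / 2 - a / Real.log T))))) := by
  obtain ⟨C, hC, h⟩ := exists_lintegral_shortSumError_le a ha
  obtain ⟨D, hD, h'⟩ := exists_abs_selbergSum_one_le
  refine ⟨288 * (2 * Real.pi * C + 2 * D ^ 2 * Real.exp (2 * a)), by positivity,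
    fun T hT hL hLa σ hσ => ?_⟩
  have hT1 : 101 ≤ T := one_lt_of_le_log hT (by linarith)
  have hX3 : 3 ≤ T ^ (1 / 100 : ℝ) := by
    rw [Real.rpow_def_of_pos hT]
    linarith [Real.add_one_le_exp (Real.log T * (1 / 100))]
  have hXT := rpow_le_self_of_log (T := T) (by linarith)
  have hI := h T hT (by linarith) hLa
  have hD1 := h' _ hX3
  have hκ2 := kappa_le_two (T := T) (by linarith)
  have hT2 := rpow_neg_le_rpow_half (by linarith) hσ
  have hb : a / Real.log T < 1 / 2 := by
    rw [div_lt_iff₀ (by linarith)]; linarith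
  set X := T ^ (1 / 100 : ℝ)
  set b := a / Real.log T
  set κ := Real.exp (1 / (6 * T)) with hκ
  have hκ1 : 1 < κ := Real.one_lt_exp_iff.mpr (by positivity)
  have hσ0 : 0 < σ := by linarith
  set R := (X / 2) ^ (-(2 * (σ - (1 / 2 - b))))
  have hR : 0 < R := by positivity
  have h1 := (lintegral_shortSumError_sq_mul_le (by linarith) hXT (by linarith) hκ2 hσ).trans
    (mul_le_mul_right hI _)
  rw [← ENNReal.ofReal_mul hR.le] at h1
  have hconv : MellinConvergent (fun u => (shortSumError X T κ u : ℂ)) (-σ : ℂ) := by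
    have hs1 : (σ + Complex.I : ℂ) ≠ 1 := fun h => by simpa using congrArg Complex.im h
    have := (hasMellin_shortSumError (by linarith : 1 < X) hT hκ1 (by simpa using hσ0) hs1).1
    exact this.of_re_eq (by simp)
  have h2 := lintegral_norm_mellin_neg_sq hconv (h1.trans_lt ENNReal.ofReal_lt_top).ne
  set m : ℝ → ℂ := fun t => mellin (fun u => (shortSumError X T κ u : ℂ)) (-(σ + t * Complex.I))
  set y := |selbergSum X 1 1|
  have h3 : ∀ t ∈ Set.Icc (T - 1) (2 * T + 1),
      ENNReal.ofReal (‖riemannZeta (σ + t * Complex.I) * mollifier X (σ + t * Complex.I) - 1‖ ^ 2) ≤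
      ENNReal.ofReal (288 * T ^ 2) * ENNReal.ofReal (‖m t‖ ^ 2) +
        ENNReal.ofReal (288 * T ^ 2 * (D * T ^ (-σ - 1)) ^ 2) := by
    intro t ht
    rw [← ENNReal.ofReal_mul (by positivity), ← ENNReal.ofReal_add (by positivity) (by positivity)]
    refine ENNReal.ofReal_le_ofReal ?_
    have h4 := norm_zeta_mul_mollifier_sub_one_le (by linarith : 1 < X) hT1 hσ0 ht.1 ht.2
    have h5 : y * T ^ (-σ - 1) ≤ D * T ^ (-σ - 1) := by gcongr
    have h6 := h4.trans (mul_le_mul_of_nonneg_left (add_le_add_right h5 ‖m t‖) (by positivity))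
    refine (pow_le_pow_left₀ (norm_nonneg _) h6 2).trans ?_
    rw [mul_pow]
    have := add_sq_le (a := ‖m t‖) (b := D * T ^ (-σ - 1))
    nlinarith [sq_nonneg T]
  refine (setLIntegral_mono' measurableSet_Icc h3).trans ?_
  rw [lintegral_add_right _ measurable_const, lintegral_const, Measure.restrict_apply_univ,
    Real.volume_Icc, ← ENNReal.ofReal_mul (by positivity),
    lintegral_const_mul' _ _ ENNReal.ofReal_ne_top]
  have h7 : ∫⁻ t in Set.Icc (T - 1) (2 * T + 1), ENNReal.ofReal (‖m t‖ ^ 2) ≤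
      ENNReal.ofReal (2 * Real.pi * (R * (C / T))) := by
    refine (setLIntegral_le_lintegral _ _).trans ?_
    rw [h2, ENNReal.ofReal_mul (p := 2 * Real.pi) (q := R * (C / T)) (by positivity)]
    exact mul_le_mul_right h1 _
  refine (add_le_add_left (mul_le_mul_right h7 _) _).trans ?_
  rw [← ENNReal.ofReal_mul (by positivity), ← ENNReal.ofReal_add (by positivity)
    (mul_nonneg (by positivity) (by linarith))]
  refine ENNReal.ofReal_le_ofReal ?_
  have h8 : (T ^ (-σ - 1)) ^ 2 = T ^ (-(2 * σ)) / T ^ 2 := by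
    rw [← Real.rpow_natCast, ← Real.rpow_mul hT.le, ← Real.rpow_natCast, ← Real.rpow_sub hT]
    congr 1
    push_cast
    ring
  rw [mul_pow, h8]
  have h9 : 288 * T ^ 2 * (2 * Real.pi * (R * (C / T))) = 288 * (2 * Real.pi * C) * T * R := by
    field_simp
  have h10 : 288 * T ^ 2 * (D ^ 2 * (T ^ (-(2 * σ)) / T ^ 2)) * (2 * T + 1 - (T - 1)) =
      288 * D ^ 2 * T ^ (-(2 * σ)) * (T + 2) := by field_simp; ring
  rw [h9, h10]
  have h11 : 288 * D ^ 2 * T ^ (-(2 * σ)) * (T + 2) ≤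
      288 * D ^ 2 * (Real.exp (2 * a) * R) * (2 * T) := by
    gcongr
    · exact hT2.trans (div_le_self (by positivity) (by linarith))
    · linarith
  linarith

theorem lintegral_Ioi_one_rpow_neg_two :
    ∫⁻ u in Set.Ioi (1 : ℝ), ENNReal.ofReal (u ^ (-2 : ℝ)) = 1 := by
  rw [← ofReal_integral_eq_lintegral_ofReal
    (integrableOn_Ioi_rpow_of_lt (by norm_num) one_pos), integral_Ioi_rpow_of_lt (by norm_num)
      one_pos]
  · norm_num
  · filter_upwards [ae_restrict_mem measurableSet_Ioi] with u hu
    exact Real.rpow_nonneg (zero_le_one.trans (le_of_lt hu)) _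

theorem ofReal_norm_mellin_shortSumError_le {X T κ b σ t : ℝ} (hX : 3 ≤ X) (hXT : X ≤ T)
    (hκ : 0 < κ) (hκ2 : κ ≤ 2) (hb : 0 ≤ b) (hσ : 2 ≤ σ) :
    ENNReal.ofReal ‖mellin (fun u => (shortSumError X T κ u : ℂ)) (-(σ + t * Complex.I))‖ ≤
      ENNReal.ofReal ((X / 2) ^ (-(σ - 2))) *
        ((∫⁻ u in Set.Ioi (0 : ℝ), ENNReal.ofReal
          (shortSumError X T κ u ^ 2 * u ^ (-(2 - 2 * b)))) + 1) := by
  have h1 : ∀ u ∈ Set.Ioi (0 : ℝ),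
      ‖(u : ℂ) ^ (-(σ + t * Complex.I) - 1 : ℂ) • (shortSumError X T κ u : ℂ)‖ₑ ≤
      ENNReal.ofReal ((X / 2) ^ (-(σ - 2))) *
        (ENNReal.ofReal (shortSumError X T κ u ^ 2 * u ^ (-(2 - 2 * b))) +
          (Set.Ioi (1 : ℝ)).indicator (fun u => ENNReal.ofReal (u ^ (-2 : ℝ))) u) := by
    intro u hu
    have hu0 : 0 < u := hu
    rcases lt_or_ge u (X / 2) with h | h
    · rw [shortSumError_eq_zero (by linarith) hκ hu0.le (by nlinarith) (by linarith)]
      simp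
    · have hu1 : 1 < u := by linarith
      rw [Set.indicator_of_mem (Set.mem_Ioi.mpr hu1),
        ← ENNReal.ofReal_add (by positivity) (by positivity),
        ← ENNReal.ofReal_mul (by positivity), ← ofReal_norm]
      refine ENNReal.ofReal_le_ofReal ?_
      rw [norm_smul, Complex.norm_cpow_eq_rpow_re_of_pos hu0, Complex.norm_real, Real.norm_eq_abs]
      have hre : (-(σ + t * Complex.I) - 1 : ℂ).re = -(σ - 2) + (-(1 - b) + -(2 + b)) := by
        simp; ring
      rw [hre, Real.rpow_add hu0, mul_assoc]
      have h2 : u ^ (-(σ - 2)) ≤ (X / 2) ^ (-(σ - 2)) :=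
        Real.rpow_le_rpow_of_nonpos (by linarith) h (by linarith)
      refine mul_le_mul h2 ?_ (by positivity) (by positivity)
      rw [Real.rpow_add hu0]
      have h3 : u ^ (-(2 - 2 * b)) = (u ^ (-(1 - b))) ^ 2 := by
        rw [← Real.rpow_natCast, ← Real.rpow_mul hu0.le]; congr 1; push_cast; ring
      have h4 : u ^ (-(2 + b)) ≤ u ^ (-2 : ℝ) :=
        Real.rpow_le_rpow_of_exponent_le hu1.le (by linarith)
      have h5 : u ^ (-(2 + b)) ≤ 1 := Real.rpow_le_one_of_one_le_of_nonpos hu1.le (by linarith)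
      have h6 : 0 < u ^ (-(2 + b)) := by positivity
      rw [h3, ← sq_abs (shortSumError X T κ u)]
      set p := u ^ (-(1 - b))
      set q := u ^ (-(2 + b))
      set B := |shortSumError X T κ u|
      nlinarith [sq_nonneg (p * B - q), sq_nonneg (p * B)]
  rw [ofReal_norm, mellin]
  refine (enorm_integral_le_lintegral_enorm _).trans ?_
  refine (setLIntegral_mono' measurableSet_Ioi h1).trans ?_
  rw [lintegral_const_mul' _ _ ENNReal.ofReal_ne_top, lintegral_add_right]
  · gcongr
    rw [← lintegral_Ioi_one_rpow_neg_two,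
      ← lintegral_indicator (s := Set.Ioi (1 : ℝ)) measurableSet_Ioi]
    exact setLIntegral_le_lintegral _ _
  · exact Measurable.indicator (by fun_prop) measurableSet_Ioi

theorem exists_norm_zeta_mul_mollifier_sub_one_le (a : ℝ) (ha : 0 < a) :
    ∃ C : ℝ, 0 < C ∧ ∀ T : ℝ, 0 < T → 200 ≤ Real.log T → 2 * a + 1 ≤ Real.log T →
      ∀ σ t : ℝ, 2 ≤ σ → T - 1 ≤ t → t ≤ 2 * T + 1 →
      ‖riemannZeta (σ + t * Complex.I) *
          mollifier (T ^ (1 / 100 : ℝ)) (σ + t * Complex.I) - 1‖ ≤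
        C * T * (T ^ (1 / 100 : ℝ) / 2) ^ (-(σ - 2)) := by
  obtain ⟨C, hC, h⟩ := exists_lintegral_shortSumError_le a ha
  obtain ⟨D, hD, h'⟩ := exists_abs_selbergSum_one_le
  refine ⟨12 * (C + 1 + D), by positivity, fun T hT hL hLa σ t hσ ht ht' => ?_⟩
  have hT1 : 101 ≤ T := one_lt_of_le_log hT (by linarith)
  have hX3 : 3 ≤ T ^ (1 / 100 : ℝ) := by
    rw [Real.rpow_def_of_pos hT]
    linarith [Real.add_one_le_exp (Real.log T * (1 / 100))]
  have hXT := rpow_le_self_of_log (T := T) (by linarith)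
  have hI := h T hT (by linarith) hLa
  have hD1 := h' _ hX3
  have hκ2 := kappa_le_two (T := T) (by linarith)
  have hb : 0 ≤ a / Real.log T := by have : 0 < Real.log T := by linarith
                                     positivity
  set X := T ^ (1 / 100 : ℝ)
  refine (norm_zeta_mul_mollifier_sub_one_le (by linarith) hT1 (by linarith) ht ht').trans ?_
  set R := (X / 2) ^ (-(σ - 2))
  have h1 := ofReal_norm_mellin_shortSumError_le (t := t) hX3 hXT (Real.exp_pos _) hκ2 hb hσ
  have h2 := h1.trans (mul_le_mul_right (add_le_add_left hI 1) _)
  rw [← ENNReal.ofReal_one, ← ENNReal.ofReal_add (by positivity) zero_le_one,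
    ← ENNReal.ofReal_mul (by positivity), ENNReal.ofReal_le_ofReal_iff (by positivity)] at h2
  have h3 : C / T ≤ C := div_le_self hC.le (by linarith)
  have h4 : T ^ (-σ - 1) ≤ R := by
    calc T ^ (-σ - 1) ≤ T ^ (-(σ - 2)) :=
          Real.rpow_le_rpow_of_exponent_le (by linarith) (by linarith)
      _ ≤ _ := Real.rpow_le_rpow_of_nonpos (by linarith) (by linarith) (by linarith)
  calc _ ≤ 12 * T * (R * (C + 1) + D * R) := by
        gcongr
        exact h2.trans (by gcongr)
    _ = _ := by ring

theorem analyticAt_riemannZeta {s : ℂ} (hs : s ≠ 1) : AnalyticAt ℂ riemannZeta s :=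
  analyticOn_riemannZeta s hs

theorem analyticOrderAt_riemannZeta_ne_top {s : ℂ} (hs : s ≠ 1) :
    analyticOrderAt riemannZeta s ≠ ⊤ := by
  refine analyticOn_riemannZeta.analyticOrderAt_ne_top_of_isPreconnected (x := 2)
    (isConnected_compl_singleton_of_one_lt_rank (by simp) 1).isPreconnected (by simp) hs ?_
  rw [analyticOrderAt_eq_zero.mpr (Or.inr (riemannZeta_ne_zero_of_one_lt_re (by norm_num)))]
  exact ENat.zero_ne_top

theorem natCast_zetaZeroOrder {s : ℂ} (hs : s ≠ 1) :
    (zetaZeroOrder s : ℕ∞) = analyticOrderAt riemannZeta s := by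
  obtain ⟨n, hn⟩ := ENat.ne_top_iff_exists.mp (analyticOrderAt_riemannZeta_ne_top hs)
  have h :=
    (analyticOrderAt_eq_nat_iff_iteratedDeriv_eq_zero (analyticAt_riemannZeta hs)).mp hn.symm
  rw [← hn, Nat.cast_inj]
  exact IsLeast.csInf_eq ⟨h.2, fun m hm => not_lt.mp fun hlt => hm (h.1 m hlt)⟩

theorem iteratedDeriv_riemannZeta_conj (m : ℕ) :
    iteratedDeriv m riemannZeta = conj ∘ iteratedDeriv m riemannZeta ∘ conj := by
  induction m with
  | zero =>
    ext s
    simp [riemannZeta_conj]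
  | succ m ih => rw [iteratedDeriv_succ, ← deriv_conj_conj, ← ih]

theorem zetaZeroOrder_conj (s : ℂ) : zetaZeroOrder (conj s) = zetaZeroOrder s := by
  unfold zetaZeroOrder
  congr 1
  ext m
  have h := congrFun (iteratedDeriv_riemannZeta_conj m) s
  rw [Set.mem_ofPred_eq, Set.mem_ofPred_eq, h]
  simp

theorem analyticOrderAt_riemannZeta_eq_completed {s : ℂ} (hs0 : 0 < s.re) (hs : s ≠ 1) :
    analyticOrderAt riemannZeta s = analyticOrderAt completedRiemannZeta s := by
  have hs' : s ≠ 0 := fun h => by rw [h] at hs0; simp at hs0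
  have h1 : riemannZeta =ᶠ[𝓝 s] completedRiemannZeta * fun s => (Complex.Gammaℝ s)⁻¹ := by
    filter_upwards [isOpen_compl_singleton.mem_nhds hs'] with z hz
    rw [riemannZeta_def_of_ne_zero hz, Pi.mul_apply, div_eq_mul_inv]
  have h2 : AnalyticAt ℂ completedRiemannZeta s := by
    rw [Complex.analyticAt_iff_eventually_differentiableAt]
    filter_upwards [isOpen_compl_singleton.mem_nhds hs', isOpen_compl_singleton.mem_nhds hs]
      with z hz hz1
    exact differentiableAt_completedZeta hz hz1
  rw [analyticOrderAt_congr h1, analyticOrderAt_mul h2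
    (Complex.differentiable_Gammaℝ_inv.analyticAt s),
    analyticOrderAt_eq_zero (f := fun s => (Complex.Gammaℝ s)⁻¹) |>.mpr
      (Or.inr (inv_ne_zero (Complex.Gammaℝ_ne_zero_of_re_pos hs0))),
    add_zero]

theorem zetaZeroOrder_one_sub {s : ℂ} (hs0 : 0 < s.re) (hs1 : s.re < 1) :
    zetaZeroOrder (1 - s) = zetaZeroOrder s := by
  have h1 : s ≠ 1 := fun h => by rw [h] at hs1; simp at hs1
  have h2 : 1 - s ≠ 1 := fun h => by
    have := congrArg Complex.re h
    simp only [Complex.sub_re, Complex.one_re] at this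
    linarith
  have h3 : 0 < (1 - s).re := by rw [Complex.sub_re, Complex.one_re]; linarith
  rw [← Nat.cast_inj (R := ℕ∞), natCast_zetaZeroOrder h1, natCast_zetaZeroOrder h2,
    analyticOrderAt_riemannZeta_eq_completed hs0 h1, analyticOrderAt_riemannZeta_eq_completed h3 h2]
  have h4 : completedRiemannZeta ∘ (fun z => 1 - z) = completedRiemannZeta :=
    funext fun z => completedRiemannZeta_one_sub z
  have h5 : HasDerivAt (fun z : ℂ => 1 - z) (-1) s := by
    simpa using (hasDerivAt_id s).const_sub 1
  have h6 : AnalyticAt ℂ (fun z : ℂ => 1 - z) s := by fun_prop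
  have h7 := analyticOrderAt_comp_of_deriv_ne_zero (f := completedRiemannZeta) h6
    (by rw [h5.deriv]; norm_num)
  rw [h4] at h7
  exact h7.symm

theorem zetaZeroOrder_one_sub_conj {s : ℂ} (hs0 : 0 < s.re) (hs1 : s.re < 1) :
    zetaZeroOrder (1 - conj s) = zetaZeroOrder s := by
  rw [zetaZeroOrder_one_sub (by simpa using hs0) (by simpa using hs1), zetaZeroOrder_conj]

/-- The nontrivial zeros of the Riemann zeta function with imaginary part in `(a, b]`. -/
def zetaZerosBetween (a b : ℝ) : Set ℂ :=
  {z : ℂ | riemannZeta z = 0 ∧ 0 < z.re ∧ z.re < 1 ∧ a < z.im ∧ z.im ≤ b}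

theorem finite_zetaZerosBetween (a b : ℝ) : (zetaZerosBetween a b).Finite := by
  refine ((isCompact_Icc (a := (0 : ℝ)) (b := 1)).reProdIm
    (isCompact_Icc (a := a) (b := b))).inter_riemannZetaZeros_finite.subset ?_
  rintro z ⟨h0, h1, h2, h3, h4⟩
  exact ⟨⟨⟨h1.le, h2.le⟩, ⟨h3.le, h4⟩⟩, h0⟩

theorem zetaN_eq_sum (t : ℝ) :
    zetaN t = ∑ z ∈ (finite_zetaZerosBetween 0 t).toFinset, (zetaZeroOrder z : ℝ) := by
  rw [← Finset.tsum_subtype', Set.Finite.coe_toFinset]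
  rfl

theorem zetaN_sub_zetaN {t h : ℝ} (ht : 0 ≤ t) (hh : 0 ≤ h) : zetaN (t + h) - zetaN t =
    ∑ z ∈ (finite_zetaZerosBetween t (t + h)).toFinset, (zetaZeroOrder z : ℝ) := by
  rw [zetaN_eq_sum, zetaN_eq_sum, sub_eq_iff_eq_add, ← Finset.sum_union]
  · congr 1
    ext z
    simp only [Set.Finite.mem_toFinset, Finset.mem_union, zetaZerosBetween, Set.mem_ofPred_eq]
    grind
  · rw [Finset.disjoint_left]
    intro z h1 h2
    simp only [Set.Finite.mem_toFinset, zetaZerosBetween, Set.mem_ofPred_eq] at h1 h2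
    linarith [h1.2.2.2.1, h2.2.2.2.2]

theorem zetaN_mono : Monotone zetaN := by
  intro a b hab
  rw [zetaN_eq_sum, zetaN_eq_sum]
  refine Finset.sum_le_sum_of_subset_of_nonneg ?_ fun _ _ _ => Nat.cast_nonneg _
  intro z h
  simp only [Set.Finite.mem_toFinset, zetaZerosBetween, Set.mem_ofPred_eq] at h ⊢
  grind

theorem zetaN_sub_zetaN_le {t h : ℝ} (ht : 0 ≤ t) (hh : 0 ≤ h) : zetaN (t + h) - zetaN t ≤
    2 * ∑ z ∈ (finite_zetaZerosBetween t (t + h)).toFinset with 1 / 2 ≤ z.re,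
      (zetaZeroOrder z : ℝ) := by
  rw [zetaN_sub_zetaN ht hh, ← Finset.sum_filter_add_sum_filter_not _ (fun z : ℂ => 1 / 2 ≤ z.re),
    two_mul, add_le_add_iff_left]
  have h1 : ∀ z ∈ (finite_zetaZerosBetween t (t + h)).toFinset.filter (fun z => ¬ 1 / 2 ≤ z.re),
      (zetaZeroOrder z : ℝ) = zetaZeroOrder (1 - conj z) := by
    intro z hz
    simp only [Finset.mem_filter, Set.Finite.mem_toFinset, zetaZerosBetween,
      Set.mem_ofPred_eq] at hz
    rw [zetaZeroOrder_one_sub_conj hz.1.2.1 hz.1.2.2.1]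
  have hinj : Set.InjOn (fun z : ℂ => 1 - conj z)
      ((finite_zetaZerosBetween t (t + h)).toFinset.filter
      (fun z => ¬ 1 / 2 ≤ z.re)) := fun z _ w _ hzw =>
    (starRingEnd ℂ).injective (by simpa using hzw)
  rw [Finset.sum_congr rfl h1, ← Finset.sum_image (f := fun z => (zetaZeroOrder z : ℝ)) hinj]
  refine Finset.sum_le_sum_of_subset_of_nonneg ?_ fun _ _ _ => Nat.cast_nonneg _
  intro w hw
  obtain ⟨z, hz, rfl⟩ := Finset.mem_image.mp hw
  simp only [Finset.mem_filter, Set.Finite.mem_toFinset, zetaZerosBetween,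
      Set.mem_ofPred_eq] at hz ⊢
  obtain ⟨⟨h0, h2, h3, h4, h5⟩, h6⟩ := hz
  have h7 : riemannZeta (1 - conj z) = 0 := by
    rw [riemannZeta_one_sub, riemannZeta_conj, h0]
    · simp
    · intro n hn
      have := congrArg Complex.re hn
      simp at this
      have : (0 : ℝ) ≤ n := n.cast_nonneg
      linarith
    · intro hn
      have := congrArg Complex.re hn
      simp at this
      linarith
  rw [not_le] at h6
  simp only [Complex.sub_re, Complex.one_re, Complex.conj_re, Complex.sub_im, Complex.one_im,
    Complex.conj_im]
  exact ⟨⟨h7, by linarith, by linarith, by linarith, by linarith⟩, by linarith⟩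

/-- Jensen's formula as an upper bound for a weighted count of zeros. -/
theorem sum_natCast_mul_le_circleAverage_log_norm_sub {f : ℂ → ℂ} {c : ℂ} {R δ : ℝ} (hR : 0 < R)
    (hf : AnalyticOnNhd ℂ f (Metric.closedBall c R)) (hc : f c ≠ 0) (S : Finset ℂ) (m : ℂ → ℕ)
    (hm : ∀ u ∈ S, (m u : ℕ∞) ≤ analyticOrderAt f u) (hδ : 0 ≤ δ)
    (hS : ∀ u ∈ S, ‖c - u‖ * Real.exp δ ≤ R) :
    (∑ u ∈ S, (m u : ℝ)) * δ ≤
      Real.circleAverage (fun z => Real.log ‖f z‖) c R - Real.log ‖f c‖ := by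
  set D := MeromorphicOn.divisor f (Metric.closedBall c R) with hD
  have hcb : c ∈ Metric.closedBall c R := Metric.mem_closedBall_self hR.le
  have hjensen := AnalyticOnNhd.circleAverage_log_norm (c := c) (f := f) hR.ne'
    (by rwa [abs_of_pos hR]) hc
  rw [abs_of_pos hR, ← hD] at hjensen
  have hfin : Set.Finite (Function.support D) := D.finiteSupport (isCompact_closedBall c R)
  have hnonneg : ∀ u, 0 ≤ (D u : ℝ) * Real.log (R * ‖c - u‖⁻¹) := by
    intro u
    by_cases hu : u ∈ Metric.closedBall c R
    · rw [Metric.mem_closedBall, dist_comm, dist_eq_norm] at hu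
      refine mul_nonneg (mod_cast MeromorphicOn.AnalyticOnNhd.divisor_nonneg hf u) ?_
      rcases (norm_nonneg (c - u)).eq_or_lt with h | h
      · simp [← h]
      · exact Real.log_nonneg (by rwa [← div_eq_mul_inv, one_le_div h])
    · simp [hD, hu]
  have hle : ∀ u ∈ S, (m u : ℝ) * δ ≤ (D u : ℝ) * Real.log (R * ‖c - u‖⁻¹) := by
    intro u hu
    rcases Nat.eq_zero_or_pos (m u) with h0 | h0
    · simpa [h0] using hnonneg u
    have hub : u ∈ Metric.closedBall c R := by
      rw [Metric.mem_closedBall, dist_comm, dist_eq_norm]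
      exact (le_mul_of_one_le_right (norm_nonneg _) (Real.one_le_exp hδ)).trans (hS u hu)
    have htop : analyticOrderAt f u ≠ ⊤ := by
      refine hf.analyticOrderAt_ne_top_of_isPreconnected
        (convex_closedBall c R).isPreconnected hcb hub ?_
      rw [(hf c hcb).analyticOrderAt_eq_zero.mpr hc]
      exact ENat.zero_ne_top
    obtain ⟨n, hn⟩ := ENat.ne_top_iff_exists.mp htop
    have hmn : m u ≤ n := by
      have := hm u hu
      rw [← hn] at this
      exact_mod_cast this
    have hDu : D u = n := by
      rw [hD, MeromorphicOn.AnalyticOnNhd.divisor_apply hf hub, ← hn]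
      simp
    have hne : 0 < ‖c - u‖ := by
      rw [norm_pos_iff, sub_ne_zero]
      rintro rfl
      have := (hf c hcb).analyticOrderAt_eq_zero.mpr hc
      rw [← hn] at this
      have : n = 0 := by exact_mod_cast this
      omega
    rw [hDu, Int.cast_natCast]
    refine mul_le_mul (by exact_mod_cast hmn) ?_ hδ n.cast_nonneg
    rw [Real.le_log_iff_exp_le (by positivity), ← div_eq_mul_inv, le_div_iff₀ hne, mul_comm]
    exact hS u hu
  rw [Finset.sum_mul, hjensen, add_sub_cancel_right,
    finsum_eq_sum_of_support_subset (s := hfin.toFinset ∪ S)]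
  · exact (Finset.sum_le_sum hle).trans (Finset.sum_le_sum_of_subset_of_nonneg
      Finset.subset_union_right fun u _ _ => hnonneg u)
  · intro u hu
    rw [Finset.coe_union, Set.Finite.coe_toFinset]
    refine Or.inl fun h => hu ?_
    simp [h]

theorem re_mem_of_mem_closedBall {W : ℝ} {w : ℂ} (hw : w ∈ Metric.closedBall (1 + W : ℂ) W) :
    1 ≤ w.re := by
  rw [Metric.mem_closedBall, dist_eq_norm] at hw
  have h := (abs_le.mp ((Complex.abs_re_le_norm _).trans hw)).1
  simp only [Complex.sub_re, Complex.add_re, Complex.one_re, Complex.ofReal_re] at h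
  linarith

/-- The map carrying the half-plane `0 < Re w` to a strip around the line `Im s = t`. -/
noncomputable def logStrip (t c : ℝ) (w : ℂ) : ℂ :=
  1 / 2 + t * Complex.I + (Complex.log w - 2) / c

theorem logStrip_re (t c : ℝ) (w : ℂ) :
    (logStrip t c w).re = 1 / 2 + (Real.log ‖w‖ - 2) / c := by
  rw [logStrip, Complex.add_re, Complex.add_re, Complex.div_ofReal_re]
  simp [Complex.log_re]

theorem logStrip_im (t c : ℝ) (w : ℂ) : (logStrip t c w).im = t + w.arg / c := by
  rw [logStrip, Complex.add_im, Complex.add_im, Complex.div_ofReal_im]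
  simp [Complex.log_im]

theorem abs_arg_div_le {c : ℝ} (hc : 2 ≤ c) {w : ℂ} (hw : 1 ≤ w.re) : |w.arg / c| ≤ 1 := by
  rw [abs_div, abs_of_pos (by linarith : 0 < c), div_le_one (by linarith)]
  have := Complex.abs_arg_le_pi_div_two_iff.mpr (by linarith : 0 ≤ w.re)
  linarith [Real.pi_lt_four]

theorem hasDerivAt_logStrip (t c : ℝ) {w : ℂ} (hw : w ∈ Complex.slitPlane) :
    HasDerivAt (logStrip t c) (w⁻¹ / c) w :=
  ((((Complex.hasDerivAt_log hw).sub_const 2).div_const (c : ℂ)).const_add _)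

theorem analyticAt_logStrip (t c : ℝ) {w : ℂ} (hw : w ∈ Complex.slitPlane) :
    AnalyticAt ℂ (logStrip t c) w :=
  (analyticAt_const.add (((analyticAt_clog hw).sub analyticAt_const).div_const))

theorem logStrip_exp {t c : ℝ} (hc : 0 < c) {s : ℂ} (hs : |c * (s.im - t)| < Real.pi) :
    logStrip t c (Complex.exp (c * (s - 1 / 2 - t * Complex.I) + 2)) = s := by
  have hc' : (c : ℂ) ≠ 0 := by exact_mod_cast hc.ne'
  have him : (c * (s - 1 / 2 - t * Complex.I) + 2 : ℂ).im = c * (s.im - t) := by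
    simp
  rw [abs_lt] at hs
  rw [logStrip, Complex.log_exp (by rw [him]; exact hs.1) (by rw [him]; exact hs.2.le)]
  field_simp
  ring

theorem neg_log_norm_le {z : ℂ} (hz : ‖z - 1‖ ≤ 1 / 2) : -Real.log ‖z‖ ≤ 2 * ‖z - 1‖ := by
  have h1 : 1 - ‖z - 1‖ ≤ ‖z‖ := by
    have := norm_sub_norm_le (1 : ℂ) (1 - z)
    rw [norm_one, sub_sub_cancel, norm_sub_rev] at this
    exact this
  have hpos : 0 < ‖z‖ := by linarith
  have h2 := Real.one_sub_inv_le_log_of_pos hpos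
  have h3 : ‖z‖⁻¹ ≤ 1 + 2 * ‖z - 1‖ := by
    rw [inv_le_iff_one_le_mul₀ hpos]
    nlinarith [norm_nonneg (z - 1)]
  linarith

theorem norm_center_sub_mul_exp_le {W : ℝ} (hW : 0 < W) {w : ℂ} (h2 : 2 ≤ w.re)
    (hw : (‖w‖ + 1) ^ 2 ≤ W) : ‖(1 + W : ℂ) - w‖ * Real.exp (1 / (2 * W)) ≤ W := by
  have h1 : ‖(1 + W : ℂ) - w‖ ^ 2 ≤ W ^ 2 - W := by
    have e1 : ‖w‖ ^ 2 = w.re ^ 2 + w.im ^ 2 := by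
      rw [Complex.sq_norm, Complex.normSq_apply]; ring
    rw [Complex.sq_norm, Complex.normSq_apply]
    simp only [Complex.sub_re, Complex.add_re, Complex.one_re, Complex.ofReal_re, Complex.sub_im,
      Complex.add_im, Complex.one_im, Complex.ofReal_im]
    nlinarith [norm_nonneg w]
  have h3 : Real.exp (1 / W) * (W ^ 2 - W) ≤ W ^ 2 := by
    have h4 := Real.add_one_le_exp (-(1 / W))
    rw [Real.exp_neg] at h4
    have h5 : W ^ 2 - W = W ^ 2 * (-(1 / W) + 1) := by field_simp; ring
    rw [h5]
    calc Real.exp (1 / W) * (W ^ 2 * (-(1 / W) + 1))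
        ≤ Real.exp (1 / W) * (W ^ 2 * (Real.exp (1 / W))⁻¹) := by gcongr
      _ = W ^ 2 := by field_simp
  refine (pow_le_pow_iff_left₀ (by positivity) hW.le two_ne_zero).mp ?_
  rw [mul_pow, ← Real.exp_nat_mul]
  have h6 : ((2 : ℕ) : ℝ) * (1 / (2 * W)) = 1 / W := by push_cast; field_simp
  rw [h6, mul_comm]
  exact (mul_le_mul_of_nonneg_left h1 (Real.exp_pos _).le).trans h3

/-- The number of zeros of `F` close to `1 / 2 + i t` is controlled by a circle average of
`log (1 + |F - 1|)`. -/
theorem sum_order_le_circleAverage {F : ℂ → ℂ} {t c W : ℝ} (hc : 2 ≤ c)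
    (hF : ∀ s : ℂ, t - 1 ≤ s.im → AnalyticAt ℂ F s) (S : Finset ℂ) (m : ℂ → ℕ)
    (hm : ∀ s ∈ S, (m s : ℕ∞) ≤ analyticOrderAt F s)
    (hS : ∀ s ∈ S, 1 / 2 ≤ s.re ∧ s.re ≤ 1 ∧ |c * (s.im - t)| ≤ 1 / 10)
    (hW : (Real.exp (c / 2 + 2) + 1) ^ 2 ≤ W)
    (hW' : ‖F (logStrip t c (1 + W)) - 1‖ ≤ 1 / 2) :
    ∑ s ∈ S, (m s : ℝ) ≤ 2 * W * Real.circleAverage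
        (fun w => Real.log (1 + ‖F (logStrip t c w) - 1‖)) (1 + W) W +
      4 * W * ‖F (logStrip t c (1 + W)) - 1‖ := by
  have hc0 : 0 < c := by linarith
  have hW0 : 0 < W := lt_of_lt_of_le (by positivity) hW
  have hslit : ∀ w ∈ Metric.closedBall (1 + W : ℂ) W, w ∈ Complex.slitPlane := fun w hw =>
    Or.inl (by linarith [re_mem_of_mem_closedBall hw])
  have hG : AnalyticOnNhd ℂ (fun w => F (logStrip t c w)) (Metric.closedBall (1 + W : ℂ) W) := by
    intro w hw
    refine (hF _ ?_).comp (analyticAt_logStrip t c (hslit w hw))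
    rw [logStrip_im]
    linarith [(abs_le.mp (abs_arg_div_le hc (re_mem_of_mem_closedBall hw))).1]
  set e : ℂ → ℂ := fun s => Complex.exp (c * (s - 1 / 2 - t * Complex.I) + 2) with he
  have hge : ∀ s ∈ S, logStrip t c (e s) = s := fun s hs =>
    logStrip_exp hc0 (by linarith [(hS s hs).2.2, Real.pi_gt_three])
  have hinj : Set.InjOn e S := fun s hs s' hs' h => by
    rw [← hge s hs, h, hge s' hs']
  have hre : ∀ s : ℂ, (c * (s - 1 / 2 - t * Complex.I) + 2 : ℂ).re = c * (s.re - 1 / 2) + 2 := by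
    intro s
    simp
  have him : ∀ s : ℂ, (c * (s - 1 / 2 - t * Complex.I) + 2 : ℂ).im = c * (s.im - t) := by
    intro s
    simp
  have hnorm : ∀ s ∈ S, ‖e s‖ ≤ Real.exp (c / 2 + 2) := by
    intro s hs
    rw [he, Complex.norm_exp, hre, Real.exp_le_exp]
    nlinarith [(hS s hs).2.1]
  have hre2 : ∀ s ∈ S, 2 ≤ (e s).re := by
    intro s hs
    rw [he, Complex.exp_re, hre, him]
    have h1 := Real.one_sub_sq_div_two_le_cos (x := c * (s.im - t))
    have h2 : (c * (s.im - t)) ^ 2 ≤ 1 := by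
      rw [sq_le_one_iff_abs_le_one]
      linarith [(hS s hs).2.2]
    have h3 := Real.add_one_le_exp (c * (s.re - 1 / 2) + 1)
    have h4 : Real.exp (c * (s.re - 1 / 2) + 2) =
        Real.exp (c * (s.re - 1 / 2) + 1) * Real.exp 1 := by
      rw [← Real.exp_add]; ring_nf
    have h5 : 0 ≤ c * (s.re - 1 / 2) := mul_nonneg hc0.le (by linarith [(hS s hs).1])
    have h6 := Real.exp_one_gt_d9
    have h7 : 4 ≤ Real.exp (c * (s.re - 1 / 2) + 2) := by rw [h4]; nlinarith
    nlinarith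
  have hcenter : F (logStrip t c (1 + W)) ≠ 0 := by
    intro h
    rw [h] at hW'
    norm_num at hW'
  have hjensen := sum_natCast_mul_le_circleAverage_log_norm_sub (δ := 1 / (2 * W)) hW0 hG hcenter
    (S.image e) (fun w => m (logStrip t c w)) ?_ (by positivity) ?_
  · have h1 : Real.circleAverage (fun w => Real.log ‖F (logStrip t c w)‖) (1 + W) W ≤
        Real.circleAverage (fun w => Real.log (1 + ‖F (logStrip t c w) - 1‖)) (1 + W) W := by
      have hsph : Metric.sphere (1 + W : ℂ) |W| ⊆ Metric.closedBall (1 + W : ℂ) W := by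
        rw [abs_of_pos hW0]
        exact Metric.sphere_subset_closedBall
      refine Real.circleAverage_mono (hG.mono hsph).meromorphicOn.circleIntegrable_log_norm ?_ ?_
      · refine ContinuousOn.circleIntegrable' ?_
        refine ContinuousOn.log (continuousOn_const.add
          (((hG.continuousOn.mono hsph).sub continuousOn_const).norm)) fun w _ => ?_
        positivity
      · intro w _
        rcases (norm_nonneg (F (logStrip t c w))).eq_or_lt with h | h
        · rw [← h, Real.log_zero]
          exact Real.log_nonneg (by linarith [norm_nonneg (F (logStrip t c w) - 1)])
        · refine Real.log_le_log h ?_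
          have := norm_add_le (1 : ℂ) (F (logStrip t c w) - 1)
          rwa [add_sub_cancel, norm_one] at this
    have h2 := neg_log_norm_le hW'
    rw [Finset.sum_image hinj, Finset.sum_congr rfl fun s hs => by rw [hge s hs], mul_one_div,
      div_le_iff₀ (by positivity)] at hjensen
    refine hjensen.trans ?_
    nlinarith
  · intro u hu
    obtain ⟨s, hs, rfl⟩ := Finset.mem_image.mp hu
    have hsl : e s ∈ Complex.slitPlane := Or.inl (by linarith [hre2 s hs])
    have h := analyticOrderAt_comp_of_deriv_ne_zero (f := F) (analyticAt_logStrip t c hsl) (by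
      rw [(hasDerivAt_logStrip t c hsl).deriv]
      exact div_ne_zero (inv_ne_zero (Complex.slitPlane_ne_zero hsl)) (by exact_mod_cast hc0.ne'))
    rw [hge s hs] at h
    rw [hge s hs]
    exact (hm s hs).trans h.ge
  · intro u hu
    obtain ⟨s, hs, rfl⟩ := Finset.mem_image.mp hu
    refine norm_center_sub_mul_exp_le hW0 (hre2 s hs) (le_trans ?_ hW)
    gcongr
    exact hnorm s hs

theorem norm_sq_eq_of_mem_sphere {W : ℝ} {w : ℂ} (hw : w ∈ Metric.sphere (1 + W : ℂ) W) :
    ‖w‖ ^ 2 = 2 * (1 + W) * w.re - (1 + 2 * W) := by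
  rw [Metric.mem_sphere, dist_eq_norm] at hw
  have h : ‖w - (1 + W)‖ ^ 2 = W ^ 2 := by rw [hw]
  rw [Complex.sq_norm, Complex.normSq_apply] at h ⊢
  simp only [Complex.sub_re, Complex.add_re, Complex.one_re, Complex.ofReal_re, Complex.sub_im,
    Complex.add_im, Complex.one_im, Complex.ofReal_im] at h
  linarith

theorem one_le_norm_of_mem_sphere {W : ℝ} {w : ℂ} (hw : w ∈ Metric.sphere (1 + W : ℂ) W) :
    1 ≤ ‖w‖ :=
  (re_mem_of_mem_closedBall (Metric.sphere_subset_closedBall hw)).trans (Complex.re_le_norm w)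

theorem continuousOn_inv_sq_norm (W : ℝ) :
    ContinuousOn (fun w : ℂ => (‖w‖ ^ 2)⁻¹) (Metric.sphere (1 + W : ℂ) W) := by
  refine ContinuousOn.inv₀ (by fun_prop) fun w hw => ?_
  have := one_le_norm_of_mem_sphere hw
  positivity

theorem circleAverage_inv_sq_norm {W : ℝ} (hW : 0 < W) :
    Real.circleAverage (fun w : ℂ => (‖w‖ ^ 2)⁻¹) (1 + W) W = (1 + 2 * W)⁻¹ := by
  have h0 : ∀ w ∈ Metric.closedBall (1 + W : ℂ) W, w ≠ 0 := fun w hw h => by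
    have := re_mem_of_mem_closedBall hw
    rw [h, Complex.zero_re] at this
    linarith
  have hmean : Real.circleAverage (fun w : ℂ => w⁻¹) (1 + W) W = (1 + W : ℂ)⁻¹ := by
    refine DiffContOnCl.circleAverage (f := fun w : ℂ => w⁻¹) ?_
    refine DifferentiableOn.diffContOnCl ?_
    rw [abs_of_pos hW, closure_ball _ hW.ne']
    exact fun w hw => (differentiableAt_inv (h0 w hw)).differentiableWithinAt
  have hint : CircleIntegrable (fun w : ℂ => w⁻¹) (1 + W) W := by
    refine ContinuousOn.circleIntegrable hW.le (continuousOn_id.inv₀ fun w hw => h0 w ?_)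
    exact Metric.sphere_subset_closedBall hw
  have hint2 : CircleIntegrable (fun w : ℂ => (‖w‖ ^ 2)⁻¹) (1 + W) W :=
    (continuousOn_inv_sq_norm W).circleIntegrable hW.le
  have h1 := Complex.reCLM.circleAverage_comp_comm hint
  rw [hmean] at h1
  have h2 : Real.circleAverage (Complex.reCLM ∘ fun w : ℂ => w⁻¹) (1 + W) W =
      Real.circleAverage ((fun _ : ℂ => (2 * (1 + W))⁻¹) +
        ((1 + 2 * W) / (2 * (1 + W))) • fun w : ℂ => (‖w‖ ^ 2)⁻¹) (1 + W) W := by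
    refine Real.circleAverage_congr_sphere fun w hw => ?_
    rw [abs_of_pos hW] at hw
    have e1 := norm_sq_eq_of_mem_sphere hw
    have e2 : 0 < ‖w‖ := zero_lt_one.trans_le (one_le_norm_of_mem_sphere hw)
    have e3 : 0 < 1 + W := by linarith
    simp only [Function.comp_apply, Complex.reCLM_apply, Complex.inv_re, smul_eq_mul,
      Pi.add_apply, Pi.smul_apply]
    rw [← Complex.sq_norm]
    field_simp
    linarith
  have h3 : (1 + W : ℂ)⁻¹ = (((1 + W)⁻¹ : ℝ) : ℂ) := by push_cast; rfl
  rw [h2, Real.circleAverage_add (circleIntegrable_const _ _ _) (hint2.const_smul),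
    Real.circleAverage_const, Real.circleAverage_smul, h3, Complex.reCLM_apply,
    Complex.ofReal_re, smul_eq_mul] at h1
  field_simp at h1 ⊢
  linarith

theorem pow_add_mul_sub_le_pow {x y : ℝ} (hx : 0 ≤ x) (hy : 0 ≤ y) (n : ℕ) :
    y ^ (n + 1) + (n + 1) * y ^ n * (x - y) ≤ x ^ (n + 1) := by
  rcases hy.eq_or_lt with rfl | hy
  · rcases n.eq_zero_or_pos with rfl | hn
    · simp
    · rw [zero_pow hn.ne', zero_pow (by omega)]
      simpa using pow_nonneg hx _
  · have h := one_add_mul_sub_le_pow (a := x / y) (by have : 0 ≤ x / y := by positivity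
                                                      linarith) (n + 1)
    rw [div_pow, le_div_iff₀ (by positivity)] at h
    refine le_of_eq_of_le ?_ h
    push_cast
    field_simp
    ring

/-- Jensen's inequality for the circle average with respect to the weight `|w|⁻²`. -/
theorem mul_circleAverage_pow_le {W : ℝ} (hW : 0 < W) {L : ℂ → ℝ}
    (hL : ContinuousOn L (Metric.sphere (1 + W : ℂ) W))
    (h0 : ∀ w ∈ Metric.sphere (1 + W : ℂ) W, 0 ≤ L w) (n : ℕ) :
    (W * Real.circleAverage L (1 + W) W) ^ (n + 1) ≤
      W * Real.circleAverage (fun w => ‖w‖ ^ (2 * n) * L w ^ (n + 1)) (1 + W) W := by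
  have habs : Metric.sphere (1 + W : ℂ) |W| = Metric.sphere (1 + W : ℂ) W := by rw [abs_of_pos hW]
  set x := Real.circleAverage L (1 + W) W with hx
  have hx0 : 0 ≤ x := Real.circleAverage_nonneg_of_nonneg fun w hw => h0 w (habs ▸ hw)
  obtain ⟨y, hy⟩ : ∃ y, y = W * x := ⟨_, rfl⟩
  rw [← hy]
  have hy0 : 0 ≤ y := by rw [hy]; positivity
  have hm := circleAverage_inv_sq_norm hW
  have hc1 : CircleIntegrable (fun w : ℂ => (‖w‖ ^ 2)⁻¹) (1 + W) W :=
    (continuousOn_inv_sq_norm W).circleIntegrable hW.le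
  have hc2 : CircleIntegrable L (1 + W) W := hL.circleIntegrable hW.le
  have hmono : Real.circleAverage ((-(n * y ^ (n + 1))) • (fun w : ℂ => (‖w‖ ^ 2)⁻¹) +
      ((n + 1) * y ^ n) • L) (1 + W) W ≤
      Real.circleAverage (fun w => ‖w‖ ^ (2 * n) * L w ^ (n + 1)) (1 + W) W := by
    refine Real.circleAverage_mono (hc1.const_smul.add hc2.const_smul) ?_ ?_
    · exact ((continuous_norm.pow _).continuousOn.mul (hL.pow _)).circleIntegrable hW.le
    · intro w hw
      rw [habs] at hw
      have hw1 := one_le_norm_of_mem_sphere hw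
      have h1 := pow_add_mul_sub_le_pow (mul_nonneg (sq_nonneg ‖w‖) (h0 w hw)) hy0 n
      have h2 : 0 < ‖w‖ ^ 2 := by positivity
      have h3 := mul_le_mul_of_nonneg_left h1 (inv_nonneg.mpr h2.le)
      rw [mul_pow (‖w‖ ^ 2), ← pow_mul] at h3
      have h4 : ‖w‖ ≠ 0 := by positivity
      refine le_of_eq_of_le ?_ (h3.trans_eq ?_)
      · simp only [smul_eq_mul, Pi.add_apply, Pi.smul_apply]
        field_simp
        ring
      · field_simp
        ring
  rw [Real.circleAverage_add hc1.const_smul hc2.const_smul, Real.circleAverage_smul,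
    Real.circleAverage_smul, hm, ← hx, smul_eq_mul, smul_eq_mul] at hmono
  refine le_trans ?_ (mul_le_mul_of_nonneg_left hmono hW.le)
  have h5 : W * (1 + 2 * W)⁻¹ ≤ 1 := by
    rw [← div_eq_mul_inv, div_le_one (by positivity)]
    linarith
  have h6 : W * (-(n * y ^ (n + 1)) * (1 + 2 * W)⁻¹ + (n + 1) * y ^ n * x) =
      y ^ (n + 1) + n * y ^ (n + 1) * (1 - W * (1 + 2 * W)⁻¹) := by
    rw [pow_succ y n]
    have : W * ((n + 1) * y ^ n * x) = (n + 1) * y ^ n * y := by rw [hy]; ring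
    linear_combination this
  rw [h6]
  exact le_add_of_nonneg_right (mul_nonneg (by positivity) (by linarith))

theorem log_one_add_pow_le {x : ℝ} (hx : 0 ≤ x) {j : ℕ} (hj : 1 ≤ j) :
    Real.log (1 + x) ^ (2 * j) ≤ (j.factorial : ℝ) ^ 2 * x ^ 2 := by
  have hl : 0 ≤ Real.log (1 + x) := Real.log_nonneg (by linarith)
  have h1 := Real.sum_le_exp_of_nonneg hl (j + 1)
  rw [Real.exp_log (by linarith)] at h1
  have h2 : ∑ i ∈ ({0, j} : Finset ℕ), Real.log (1 + x) ^ i / i.factorial ≤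
      ∑ i ∈ Finset.range (j + 1), Real.log (1 + x) ^ i / i.factorial := by
    refine Finset.sum_le_sum_of_subset_of_nonneg ?_ fun i _ _ => by positivity
    intro i hi
    simp only [Finset.mem_insert, Finset.mem_singleton] at hi
    rw [Finset.mem_range]
    omega
  rw [Finset.sum_pair (by omega), pow_zero, Nat.factorial_zero, Nat.cast_one, div_one] at h2
  have h3 : Real.log (1 + x) ^ j ≤ j.factorial * x := by
    rw [← div_le_iff₀' (by positivity)]
    linarith
  rw [mul_comm 2 j, pow_mul, ← mul_pow]
  gcongr

theorem setLIntegral_comp_add_le {a b : ℝ} {φ : ℝ} (hφ : |φ| ≤ 1) (g : ℝ → ENNReal) :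
    ∫⁻ t in Set.Icc a b, g (t + φ) ≤ ∫⁻ t in Set.Icc (a - 1) (b + 1), g t := by
  rw [abs_le] at hφ
  rw [← lintegral_indicator measurableSet_Icc, ← lintegral_indicator measurableSet_Icc,
    ← lintegral_add_right_eq_self ((Set.Icc (a - 1) (b + 1)).indicator g) φ]
  refine lintegral_mono fun t => ?_
  by_cases ht : t ∈ Set.Icc a b
  · rw [Set.indicator_of_mem ht, Set.indicator_of_mem (show t + φ ∈ Set.Icc (a - 1) (b + 1) from
      ⟨by linarith [ht.1], by linarith [ht.2]⟩)]
  · rw [Set.indicator_of_notMem ht]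
    exact zero_le

theorem ofReal_circleAverage_eq {h : ℂ → ℝ} {c : ℂ} {R : ℝ} (hR : 0 ≤ R)
    (hh : ContinuousOn h (Metric.sphere c R)) (h0 : ∀ z ∈ Metric.sphere c R, 0 ≤ h z) :
    ENNReal.ofReal (Real.circleAverage h c R) = ENNReal.ofReal (2 * Real.pi)⁻¹ *
      ∫⁻ θ in Set.Ioc 0 (2 * Real.pi), ENNReal.ofReal (h (circleMap c R θ)) := by
  have hi := hh.circleIntegrable hR
  rw [Real.circleAverage, smul_eq_mul, ENNReal.ofReal_mul (by positivity),
    intervalIntegral.integral_of_le Real.two_pi_pos.le, ofReal_integral_eq_lintegral_ofReal]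
  · exact (intervalIntegrable_iff_integrableOn_Ioc_of_le Real.two_pi_pos.le).mp hi
  · exact Eventually.of_forall fun θ => h0 _ (circleMap_mem_sphere c hR θ)

theorem continuousOn_logStrip (c W : ℝ) :
    ContinuousOn (fun p : ℝ × ℝ => logStrip p.1 c (circleMap (1 + W) W p.2))
      {p | circleMap (1 + W : ℂ) W p.2 ∈ Complex.slitPlane} := by
  unfold logStrip
  have h : Continuous fun p : ℝ × ℝ => circleMap (1 + W : ℂ) W p.2 :=
    (continuous_circleMap _ _).comp continuous_snd
  exact (by fun_prop : Continuous fun p : ℝ × ℝ => (1 / 2 + p.1 * Complex.I : ℂ)).continuousOn.add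
    (((h.continuousOn.clog fun p hp => hp).sub continuousOn_const).div_const _)

/-- Moments of circle averages, from mean square bounds on vertical lines. -/
theorem lintegral_circleAverage_pow_le {F : ℂ → ℂ} {T c W K : ℝ} (hc : 2 ≤ c) (hT : 1 < T)
    (hW : 0 < W) (hF : ContinuousOn F {s | 0 < s.im}) {j : ℕ} (hj : 1 ≤ j) (hK0 : 0 ≤ K)
    (hK : ∀ r : ℝ, 1 ≤ r → ∫⁻ t in Set.Icc (T - 1) (2 * T + 1), ENNReal.ofReal
      (‖F ((1 / 2 + (Real.log r - 2) / c : ℝ) + t * Complex.I) - 1‖ ^ 2) ≤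
        ENNReal.ofReal (K * (r ^ (4 * j))⁻¹)) :
    ∫⁻ t in Set.Icc T (2 * T), ENNReal.ofReal ((W * Real.circleAverage
      (fun w => Real.log (1 + ‖F (logStrip t c w) - 1‖)) (1 + W) W) ^ (2 * j)) ≤
        ENNReal.ofReal ((j.factorial : ℝ) ^ 2 * K) := by
  have hsph : ∀ w ∈ Metric.sphere (1 + W : ℂ) W, 1 ≤ w.re := fun w hw =>
    re_mem_of_mem_closedBall (Metric.sphere_subset_closedBall hw)
  have hcirc : ∀ θ, circleMap (1 + W : ℂ) W θ ∈ Metric.sphere (1 + W : ℂ) W := fun θ =>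
    circleMap_mem_sphere _ hW.le θ
  have hslit : ∀ w ∈ Metric.sphere (1 + W : ℂ) W, w ∈ Complex.slitPlane := fun w hw =>
    Or.inl (by linarith [hsph w hw])
  have him : ∀ t ∈ Set.Icc T (2 * T), ∀ w ∈ Metric.sphere (1 + W : ℂ) W,
      0 < (logStrip t c w).im := by
    intro t ht w hw
    rw [logStrip_im]
    linarith [(abs_le.mp (abs_arg_div_le hc (hsph w hw))).1, ht.1]
  have hcont : ∀ t ∈ Set.Icc T (2 * T),
      ContinuousOn (fun w => ‖F (logStrip t c w) - 1‖) (Metric.sphere (1 + W : ℂ) W) := by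
    intro t ht
    refine ((hF.comp (fun w hw => ?_) (him t ht)).sub continuousOn_const).norm
    exact (analyticAt_logStrip t c (hslit w hw)).continuousAt.continuousWithinAt
  set h : ℝ → ℂ → ℝ := fun t w => ‖w‖ ^ (4 * j - 2) * ‖F (logStrip t c w) - 1‖ ^ 2 with hh
  have hhcont : ∀ t ∈ Set.Icc T (2 * T), ContinuousOn (h t) (Metric.sphere (1 + W : ℂ) W) :=
    fun t ht => (continuous_norm.pow _).continuousOn.mul ((hcont t ht).pow 2)
  have hpoint : ∀ t ∈ Set.Icc T (2 * T), (W * Real.circleAverage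
      (fun w => Real.log (1 + ‖F (logStrip t c w) - 1‖)) (1 + W) W) ^ (2 * j) ≤
        W * ((j.factorial : ℝ) ^ 2 * Real.circleAverage (h t) (1 + W) W) := by
    intro t ht
    have hlog : ContinuousOn (fun w => Real.log (1 + ‖F (logStrip t c w) - 1‖))
        (Metric.sphere (1 + W : ℂ) W) :=
      ContinuousOn.log (continuousOn_const.add (hcont t ht)) fun w _ => by positivity
    have h1 := mul_circleAverage_pow_le hW hlog
      (fun w _ => Real.log_nonneg (by linarith [norm_nonneg (F (logStrip t c w) - 1)])) (2 * j - 1)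
    rw [Nat.sub_add_cancel (by omega)] at h1
    refine h1.trans (mul_le_mul_of_nonneg_left ?_ hW.le)
    rw [← smul_eq_mul (_ ^ 2), ← Real.circleAverage_smul]
    refine Real.circleAverage_mono ?_ ?_ fun w _ => ?_
    · exact ((continuous_norm.pow _).continuousOn.mul (hlog.pow _)).circleIntegrable hW.le
    · exact ((hhcont t ht).circleIntegrable hW.le).const_smul
    · have h2 := log_one_add_pow_le (norm_nonneg (F (logStrip t c w) - 1)) hj
      have h3 : 2 * (2 * j - 1) = 4 * j - 2 := by omega
      simp only [Pi.smul_apply, smul_eq_mul, hh]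
      rw [h3, mul_left_comm]
      gcongr
  set P := ENNReal.ofReal (W * (j.factorial : ℝ) ^ 2 * (2 * Real.pi)⁻¹) with hP
  have hmeas : AEMeasurable
      (Function.uncurry fun t θ => ENNReal.ofReal (h t (circleMap (1 + W) W θ)))
      ((volume.restrict (Set.Icc T (2 * T))).prod
        (volume.restrict (Set.Ioc 0 (2 * Real.pi)))) := by
    rw [Measure.prod_restrict]
    refine AEMeasurable.ennreal_ofReal (ContinuousOn.aemeasurable ?_
      (measurableSet_Icc.prod measurableSet_Ioc))
    refine ContinuousOn.mul (by fun_prop) (ContinuousOn.pow (ContinuousOn.norm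
      (ContinuousOn.sub (hF.comp ((continuousOn_logStrip c W).mono fun p _ => hslit _ (hcirc p.2))
        fun p hp => him p.1 hp.1 _ (hcirc p.2)) continuousOn_const)) 2)
  have hinner : ∀ θ, ∫⁻ t in Set.Icc T (2 * T), ENNReal.ofReal (h t (circleMap (1 + W) W θ)) ≤
      ENNReal.ofReal (K * (‖circleMap (1 + W : ℂ) W θ‖ ^ 2)⁻¹) := by
    intro θ
    set w := circleMap (1 + W : ℂ) W θ with hw
    have hw1 : 1 ≤ ‖w‖ := one_le_norm_of_mem_sphere (hcirc θ)
    set g : ℝ → ENNReal := fun t => ENNReal.ofReal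
      (‖F ((1 / 2 + (Real.log ‖w‖ - 2) / c : ℝ) + t * Complex.I) - 1‖ ^ 2) with hg
    have h1 : ∀ t, ENNReal.ofReal (h t w) =
        ENNReal.ofReal (‖w‖ ^ (4 * j - 2)) * g (t + w.arg / c) := by
      intro t
      rw [hg, hh, ENNReal.ofReal_mul (by positivity), ← logStrip_re t, ← logStrip_im]
      dsimp only
      rw [Complex.re_add_im]
    simp only [h1]
    rw [lintegral_const_mul' _ _ ENNReal.ofReal_ne_top]
    calc _ ≤ ENNReal.ofReal (‖w‖ ^ (4 * j - 2)) * ENNReal.ofReal (K * (‖w‖ ^ (4 * j))⁻¹) := by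
          gcongr
          exact (setLIntegral_comp_add_le (abs_arg_div_le hc (hsph w (hcirc θ))) g).trans
            (hK _ hw1)
      _ = ENNReal.ofReal (K * (‖w‖ ^ 2)⁻¹) := by
          rw [← ENNReal.ofReal_mul (by positivity)]
          congr 1
          have h2 : ‖w‖ ^ (4 * j) = ‖w‖ ^ (4 * j - 2) * ‖w‖ ^ 2 := by
            rw [← pow_add]
            congr 1
            omega
          rw [h2]
          field_simp
  calc _ ≤ ∫⁻ t in Set.Icc T (2 * T),
          P * ∫⁻ θ in Set.Ioc 0 (2 * Real.pi), ENNReal.ofReal (h t (circleMap (1 + W) W θ)) := by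
        refine setLIntegral_mono' measurableSet_Icc fun t ht => ?_
        refine (ENNReal.ofReal_le_ofReal (hpoint t ht)).trans_eq ?_
        rw [← mul_assoc, ENNReal.ofReal_mul (by positivity),
          ofReal_circleAverage_eq hW.le (hhcont t ht) fun w _ => by rw [hh]; positivity, hP,
          ← mul_assoc, ← ENNReal.ofReal_mul (by positivity)]
    _ = P * ∫⁻ θ in Set.Ioc 0 (2 * Real.pi), ∫⁻ t in Set.Icc T (2 * T),
          ENNReal.ofReal (h t (circleMap (1 + W) W θ)) := by
        rw [lintegral_const_mul' _ _ ENNReal.ofReal_ne_top, lintegral_lintegral_swap hmeas]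
    _ ≤ P * ∫⁻ θ in Set.Ioc 0 (2 * Real.pi),
          ENNReal.ofReal (K * (‖circleMap (1 + W : ℂ) W θ‖ ^ 2)⁻¹) := by
        gcongr with θ
        exact hinner θ
    _ = ENNReal.ofReal (W * (j.factorial : ℝ) ^ 2 *
          Real.circleAverage (K • fun w : ℂ => (‖w‖ ^ 2)⁻¹) (1 + W) W) := by
        rw [hP, ENNReal.ofReal_mul (by positivity), mul_assoc,
          ENNReal.ofReal_mul (p := W * (j.factorial : ℝ) ^ 2) (by positivity),
          ofReal_circleAverage_eq hW.le (h := K • fun w : ℂ => (‖w‖ ^ 2)⁻¹)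
            ((continuousOn_inv_sq_norm W).const_smul K)
            fun w _ => by simp only [Pi.smul_apply, smul_eq_mul]; positivity]
        rfl
    _ ≤ _ := by
        rw [Real.circleAverage_smul, circleAverage_inv_sq_norm hW, smul_eq_mul]
        refine ENNReal.ofReal_le_ofReal ?_
        have h5 : W * (1 + 2 * W)⁻¹ ≤ 1 := by
          rw [← div_eq_mul_inv, div_le_one (by positivity)]
          linarith
        calc W * (j.factorial : ℝ) ^ 2 * (K * (1 + 2 * W)⁻¹)
            = (j.factorial : ℝ) ^ 2 * K * (W * (1 + 2 * W)⁻¹) := by ring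
          _ ≤ (j.factorial : ℝ) ^ 2 * K * 1 := by gcongr
          _ = _ := mul_one _

theorem differentiable_mollifier (X : ℝ) : Differentiable ℂ (mollifier X) := by
  intro s
  unfold mollifier
  refine DifferentiableAt.fun_sum fun d hd => ?_
  have hd0 : (d : ℂ) ≠ 0 := by exact_mod_cast (Finset.mem_Ioc.mp hd).1.ne'
  exact (differentiableAt_id.neg.const_cpow (Or.inl hd0)).const_mul _

/-- The Riemann zeta function multiplied by the mollifier of length `T ^ (1 / 50)`. -/
noncomputable def mollifiedZeta (T : ℝ) : ℂ → ℂ :=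
  riemannZeta * mollifier (T ^ (1 / 100 : ℝ))

theorem analyticAt_mollifiedZeta (T : ℝ) {s : ℂ} (hs : 0 < s.im) :
    AnalyticAt ℂ (mollifiedZeta T) s :=
  (analyticAt_riemannZeta fun h => by simp [h] at hs).mul
    ((differentiable_mollifier _).analyticAt s)

theorem zetaZeroOrder_le_analyticOrderAt_mollifiedZeta (T : ℝ) {s : ℂ} (hs : 0 < s.im) :
    (zetaZeroOrder s : ℕ∞) ≤ analyticOrderAt (mollifiedZeta T) s := by
  have hs1 : s ≠ 1 := fun h => by simp [h] at hs
  rw [mollifiedZeta, analyticOrderAt_mul (analyticAt_riemannZeta hs1)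
    ((differentiable_mollifier _).analyticAt s), natCast_zetaZeroOrder hs1]
  exact le_self_add

theorem rpow_half_rpow_neg_le {T x : ℝ} (hT : 0 < T) (hL : 200 ≤ Real.log T) (hx : 0 ≤ x) :
    (T ^ (1 / 100 : ℝ) / 2) ^ (-x) ≤ Real.exp (-(x * Real.log T / 200)) := by
  have h1 : Real.exp (Real.log T / 200) ≤ T ^ (1 / 100 : ℝ) / 2 := by
    have h2 : T ^ (1 / 100 : ℝ) = Real.exp (Real.log T / 200) * Real.exp (Real.log T / 200) := by
      rw [Real.rpow_def_of_pos hT, ← Real.exp_add]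
      ring_nf
    have h3 := Real.add_one_le_exp (Real.log T / 200)
    rw [h2]
    nlinarith
  refine (Real.rpow_le_rpow_of_nonpos (Real.exp_pos _) h1 (by linarith)).trans_eq ?_
  rw [← Real.exp_mul]
  ring_nf

theorem exists_norm_mollifiedZeta_center_le {c₁ : ℝ} (hc : 0 < c₁) (hc' : c₁ ≤ 1 / 1000) :
    ∃ T₀ : ℝ, ∀ T : ℝ, T₀ ≤ T → ∀ t ∈ Set.Icc T (2 * T),
      ‖mollifiedZeta T (logStrip t (c₁ * Real.log T) (1 + T)) - 1‖ ≤ 1 / T := by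
  obtain ⟨C, hC, h⟩ := exists_norm_zeta_mul_mollifier_sub_one_le (2 / c₁) (by positivity)
  refine ⟨max (Real.exp (200 + (2 * (2 / c₁) + 1))) C, fun T hT t ht => ?_⟩
  have hexp := (le_max_left _ _).trans hT
  have hCT := (le_max_right _ _).trans hT
  have hT0 : 0 < T := (Real.exp_pos _).trans_le hexp
  have hlog := (Real.le_log_iff_exp_le hT0).mpr hexp
  have ha : 0 < 2 / c₁ := by positivity
  have hL : 200 ≤ Real.log T := by linarith
  have hnorm : ‖(1 + T : ℂ)‖ = 1 + T := by
    rw [← Complex.ofReal_one, ← Complex.ofReal_add, Complex.norm_real, Real.norm_of_nonneg]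
    linarith
  have him : (logStrip t (c₁ * Real.log T) (1 + T)).im = t := by
    rw [logStrip_im, ← Complex.ofReal_one, ← Complex.ofReal_add,
      Complex.arg_ofReal_of_nonneg (by linarith)]
    simp
  have hre : 802 ≤ (logStrip t (c₁ * Real.log T) (1 + T)).re := by
    rw [logStrip_re, hnorm]
    have h1 : Real.log T ≤ Real.log (1 + T) := Real.log_le_log hT0 (by linarith)
    have h2 : 802 ≤ (Real.log (1 + T) - 2) / (c₁ * Real.log T) := by
      rw [le_div_iff₀ (by positivity)]
      nlinarith
    linarith
  have hb := h T hT0 hL (by linarith) _ t (by linarith) (by linarith [ht.1]) (by linarith [ht.2])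
  have heq : ((logStrip t (c₁ * Real.log T) (1 + T)).re : ℂ) + t * Complex.I =
      logStrip t (c₁ * Real.log T) (1 + T) := by
    conv_rhs => rw [← Complex.re_add_im (logStrip t (c₁ * Real.log T) (1 + T)), him]
  rw [heq] at hb
  refine hb.trans ?_
  have h3 := rpow_half_rpow_neg_le hT0 hL
    (x := (logStrip t (c₁ * Real.log T) (1 + T)).re - 2) (by linarith)
  have h4 : Real.exp (-(((logStrip t (c₁ * Real.log T) (1 + T)).re - 2) * Real.log T / 200)) ≤
      (T ^ 4)⁻¹ := by
    rw [← Real.exp_log (x := (T ^ 4)⁻¹) (by positivity), Real.log_inv, Real.log_pow,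
      Real.exp_le_exp]
    push_cast
    nlinarith
  have hT1 : 1 ≤ T := (Real.one_le_exp (by linarith)).trans hexp
  calc _ ≤ T * T * (T ^ 4)⁻¹ := by
        gcongr
        exact h3.trans h4
    _ = 1 / T * (1 / T) := by field_simp
    _ ≤ 1 / T * 1 := by
        gcongr
        rwa [div_le_one hT0]
    _ = _ := mul_one _

theorem exists_lintegral_mollifiedZeta_moment_le {c₁ : ℝ} (hc : 0 < c₁) {j : ℕ} (hj : 1 ≤ j)
    (hcj : c₁ * (400 * j) ≤ 1) : ∃ C T₀ : ℝ, 0 ≤ C ∧ ∀ T : ℝ, T₀ ≤ T →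
      ∫⁻ t in Set.Icc T (2 * T), ENNReal.ofReal ((T * Real.circleAverage (fun w => Real.log
        (1 + ‖mollifiedZeta T (logStrip t (c₁ * Real.log T) w) - 1‖)) (1 + T) T) ^ (2 * j)) ≤
      ENNReal.ofReal (C * T) := by
  obtain ⟨C, hC, h⟩ := exists_lintegral_zeta_mul_mollifier_sub_one_le (2 / c₁) (by positivity)
  refine ⟨(j.factorial : ℝ) ^ 2 * C, Real.exp (200 + (2 * (2 / c₁) + 1)), by positivity,
    fun T hexp => ?_⟩
  have hT0 : 0 < T := (Real.exp_pos _).trans_le hexp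
  have hlog := (Real.le_log_iff_exp_le hT0).mpr hexp
  have ha : 0 < 2 / c₁ := by positivity
  have hL : 200 ≤ Real.log T := by linarith
  have hc2 : 2 ≤ c₁ * Real.log T := by
    rw [← div_le_iff₀' hc]
    linarith
  rw [mul_assoc]
  refine lintegral_circleAverage_pow_le hc2 (by linarith [one_lt_of_le_log hT0 (by linarith)]) hT0
    (fun s hs => (analyticAt_mollifiedZeta T hs).continuousAt.continuousWithinAt) hj
    (by positivity) fun r hr => ?_
  have hr0 : 0 ≤ Real.log r := Real.log_nonneg hr
  have hσ : 1 / 2 + (Real.log r - 2) / (c₁ * Real.log T) - (1 / 2 - 2 / c₁ / Real.log T) =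
      Real.log r / (c₁ * Real.log T) := by
    field_simp
    ring
  refine (h T hT0 hL (by linarith) (1 / 2 + (Real.log r - 2) / (c₁ * Real.log T)) ?_).trans ?_
  · have : 0 ≤ Real.log r / (c₁ * Real.log T) := by positivity
    linarith
  · rw [hσ]
    refine ENNReal.ofReal_le_ofReal (mul_le_mul_of_nonneg_left ?_ (by positivity))
    refine (rpow_half_rpow_neg_le hT0 hL (by positivity)).trans ?_
    rw [← Real.exp_log (x := (r ^ (4 * j))⁻¹) (by positivity), Real.log_inv, Real.log_pow,
      Real.exp_le_exp, neg_le_neg_iff]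
    have h1 : 2 * (Real.log r / (c₁ * Real.log T)) * Real.log T / 200 =
        Real.log r * (1 / (100 * c₁)) := by
      field_simp
      ring
    have h2 : ((4 * j : ℕ) : ℝ) ≤ 1 / (100 * c₁) := by
      rw [le_div_iff₀ (by positivity)]
      push_cast
      linarith
    rw [h1, mul_comm]
    gcongr

theorem zetaN_sub_zetaN_le_circleAverage {A c₁ T t : ℝ} (hA : 0 < A) (hc : 0 < c₁)
    (hc' : c₁ ≤ 1 / 1000) (hcA : c₁ * A ≤ 1 / 10) (hT : 0 < T) (hL : 200 ≤ Real.log T)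
    (hLc : 2 ≤ c₁ * Real.log T) (ht : T ≤ t)
    (hcenter : ‖mollifiedZeta T (logStrip t (c₁ * Real.log T) (1 + T)) - 1‖ ≤ 1 / T) :
    zetaN (t + A / Real.log T) - zetaN t ≤ 4 * (T * Real.circleAverage (fun w => Real.log
      (1 + ‖mollifiedZeta T (logStrip t (c₁ * Real.log T) w) - 1‖)) (1 + T) T) + 8 := by
  have hT1 : 101 ≤ T := one_lt_of_le_log hT (by linarith)
  have hL0 : 0 < Real.log T := by linarith
  have hTinv : 1 / T ≤ 1 / 2 := one_div_le_one_div_of_le two_pos (by linarith)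
  have h1 := zetaN_sub_zetaN_le (t := t) (h := A / Real.log T) (by linarith) (by positivity)
  have h2 := sum_order_le_circleAverage (F := mollifiedZeta T) (t := t) (W := T) hLc
    (fun s hs => analyticAt_mollifiedZeta T (by linarith))
    ((finite_zetaZerosBetween t (t + A / Real.log T)).toFinset.filter fun z => 1 / 2 ≤ z.re)
    zetaZeroOrder ?_ ?_ ?_ (hcenter.trans hTinv)
  · have h3 : 4 * T * ‖mollifiedZeta T (logStrip t (c₁ * Real.log T) (1 + T)) - 1‖ ≤ 4 := by
      calc _ ≤ 4 * T * (1 / T) := by gcongr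
        _ = 4 := by field_simp
    linarith
  · intro s hs
    simp only [Finset.mem_filter, Set.Finite.mem_toFinset, zetaZerosBetween,
      Set.mem_ofPred_eq] at hs
    exact zetaZeroOrder_le_analyticOrderAt_mollifiedZeta T (by linarith [hs.1.2.2.2.1])
  · intro s hs
    simp only [Finset.mem_filter, Set.Finite.mem_toFinset, zetaZerosBetween,
      Set.mem_ofPred_eq] at hs
    obtain ⟨⟨-, -, h4, h5, h6⟩, h7⟩ := hs
    refine ⟨h7, h4.le, ?_⟩
    rw [abs_of_nonneg (mul_nonneg (by positivity) (by linarith))]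
    calc c₁ * Real.log T * (s.im - t) ≤ c₁ * Real.log T * (A / Real.log T) := by
          gcongr
          linarith
      _ = c₁ * A := by field_simp
      _ ≤ _ := hcA
  · have h8 : Real.exp (c₁ * Real.log T / 2 + 2) + 1 ≤ Real.exp (c₁ * Real.log T / 2 + 3) := by
      have e1 : Real.exp (c₁ * Real.log T / 2 + 3) =
          Real.exp (c₁ * Real.log T / 2 + 2) * Real.exp 1 := by
        rw [← Real.exp_add]
        ring_nf
      have e2 : 1 ≤ Real.exp (c₁ * Real.log T / 2 + 2) := Real.one_le_exp (by positivity)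
      rw [e1]
      nlinarith [Real.exp_one_gt_d9]
    calc _ ≤ Real.exp (c₁ * Real.log T / 2 + 3) ^ 2 := by gcongr
      _ = Real.exp (c₁ * Real.log T + 6) := by
          rw [← Real.exp_nat_mul]
          push_cast
          ring_nf
      _ ≤ Real.exp (Real.log T) := by
          rw [Real.exp_le_exp]
          nlinarith
      _ = T := Real.exp_log hT

theorem pow_le_of_le_four_mul_add {x y : ℝ} {k n : ℕ} (hy : 0 ≤ y) (hx : 0 ≤ x)
    (h : y ≤ 4 * x + 8) (hkn : k ≤ n) : y ^ k ≤ 12 ^ n * (x ^ n + 1) := by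
  have h1 : y ≤ 12 * max x 1 := by linarith [le_max_left x 1, le_max_right x 1]
  have h2 : 1 ≤ 12 * max x 1 := by linarith [le_max_right x 1]
  calc y ^ k ≤ (12 * max x 1) ^ k := by gcongr
    _ ≤ (12 * max x 1) ^ n := pow_le_pow_right₀ h2 hkn
    _ = 12 ^ n * max x 1 ^ n := mul_pow _ _ _
    _ ≤ _ := by
        gcongr
        rcases max_cases x 1 with ⟨h3, -⟩ | ⟨h3, -⟩ <;> rw [h3]
        · linarith
        · rw [one_pow]
          linarith [pow_nonneg hx n]

theorem intervalIntegral_le_of_lintegral_le {f : ℝ → ℝ} {a b K : ℝ} (hab : a ≤ b) (hK : 0 ≤ K)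
    (hf : ∀ t ∈ Set.Icc a b, 0 ≤ f t)
    (h : ∫⁻ t in Set.Icc a b, ENNReal.ofReal (f t) ≤ ENNReal.ofReal K) :
    ∫ t in a..b, f t ≤ K := by
  rw [intervalIntegral.integral_of_le hab, ← integral_Icc_eq_integral_Ioc]
  refine (Real.le_norm_self _).trans ((norm_integral_le_lintegral_norm _).trans ?_)
  refine ENNReal.toReal_le_of_le_ofReal hK (le_of_eq_of_le ?_ h)
  refine setLIntegral_congr_fun measurableSet_Icc fun t ht => ?_
  simp only [Real.norm_of_nonneg (hf t ht)]

theorem zetaN_nonneg (t : ℝ) : 0 ≤ zetaN t := tsum_nonneg fun _ => Nat.cast_nonneg _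

theorem exists_integral_zetaN_sub_pow_le_of_large {A : ℝ} (hA : 0 < A) (k : ℕ) :
    ∃ C T₀ : ℝ, ∀ T : ℝ, T₀ ≤ T →
      ∫ t in T..(2 * T), (zetaN (t + A / Real.log T) - zetaN t) ^ k ≤ C * T := by
  obtain ⟨j, hj, hkj⟩ : ∃ j : ℕ, 1 ≤ j ∧ k ≤ 2 * j := ⟨k + 1, by omega, by omega⟩
  have hj0 : (0 : ℝ) < j := by exact_mod_cast hj
  obtain ⟨c₁, hc, hc', hcj, hcA⟩ : ∃ c₁ : ℝ, 0 < c₁ ∧ c₁ ≤ 1 / 1000 ∧ c₁ * (400 * j) ≤ 1 ∧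
      c₁ * A ≤ 1 / 10 := by
    refine ⟨min (1 / 1000) (min (1 / (400 * j)) (1 / (10 * A))), by positivity,
      min_le_left _ _, ?_, ?_⟩
    · rw [← le_div_iff₀ (by positivity)]
      exact (min_le_right _ _).trans (min_le_left _ _)
    · rw [← le_div_iff₀ hA, div_div]
      exact (min_le_right _ _).trans (min_le_right _ _)
  obtain ⟨T₁, h₁⟩ := exists_norm_mollifiedZeta_center_le hc hc'
  obtain ⟨C, T₂, hC, h₂⟩ := exists_lintegral_mollifiedZeta_moment_le hc hj hcj
  refine ⟨12 ^ (2 * j) * (C + 1), max (max T₁ T₂) (Real.exp (200 + 2 / c₁)), fun T hT => ?_⟩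
  simp only [max_le_iff] at hT
  obtain ⟨⟨hT₁, hT₂⟩, hexp⟩ := hT
  have hT0 : 0 < T := (Real.exp_pos _).trans_le hexp
  have hlog := (Real.le_log_iff_exp_le hT0).mpr hexp
  have hc2 : 0 < 2 / c₁ := by positivity
  have hL : 200 ≤ Real.log T := by linarith
  have hLc : 2 ≤ c₁ * Real.log T := by
    rw [← div_le_iff₀' hc]
    linarith
  have hdiff (t : ℝ) : 0 ≤ zetaN (t + A / Real.log T) - zetaN t :=
    sub_nonneg.mpr (zetaN_mono (le_add_of_nonneg_right (by positivity)))
  obtain ⟨x, hx⟩ : ∃ x : ℝ → ℝ, x = fun t => T * Real.circleAverage (fun w => Real.log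
      (1 + ‖mollifiedZeta T (logStrip t (c₁ * Real.log T) w) - 1‖)) (1 + T) T := ⟨_, rfl⟩
  have hx0 (t : ℝ) : 0 ≤ x t := by
    rw [hx]
    exact mul_nonneg hT0.le (Real.circleAverage_nonneg_of_nonneg fun w _ =>
      Real.log_nonneg (le_add_of_nonneg_right (norm_nonneg _)))
  refine intervalIntegral_le_of_lintegral_le (by linarith) (by positivity)
    (fun t _ => pow_nonneg (hdiff t) k) ?_
  calc ∫⁻ t in Set.Icc T (2 * T), ENNReal.ofReal ((zetaN (t + A / Real.log T) - zetaN t) ^ k)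
      ≤ ∫⁻ t in Set.Icc T (2 * T),
          ENNReal.ofReal (12 ^ (2 * j)) * (ENNReal.ofReal (x t ^ (2 * j)) + 1) := by
        refine setLIntegral_mono' measurableSet_Icc fun t ht => ?_
        rw [← ENNReal.ofReal_one, ← ENNReal.ofReal_add (pow_nonneg (hx0 t) _) zero_le_one,
          ← ENNReal.ofReal_mul (by positivity)]
        refine ENNReal.ofReal_le_ofReal (pow_le_of_le_four_mul_add (hdiff t) (hx0 t) ?_ hkj)
        rw [hx]
        exact zetaN_sub_zetaN_le_circleAverage hA hc hc' hcA hT0 hL hLc ht.1 (h₁ T hT₁ t ht)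
    _ = ENNReal.ofReal (12 ^ (2 * j)) *
          ((∫⁻ t in Set.Icc T (2 * T), ENNReal.ofReal (x t ^ (2 * j))) + ENNReal.ofReal T) := by
        rw [lintegral_const_mul' _ _ ENNReal.ofReal_ne_top, lintegral_add_right _ measurable_const,
          setLIntegral_one, Real.volume_Icc,
          show 2 * T - T = T by ring]
    _ ≤ ENNReal.ofReal (12 ^ (2 * j)) * (ENNReal.ofReal (C * T) + ENNReal.ofReal T) := by
        gcongr
        rw [hx]
        exact h₂ T hT₂
    _ = ENNReal.ofReal (12 ^ (2 * j) * (C + 1) * T) := by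
        rw [← ENNReal.ofReal_add (by positivity) hT0.le, ← ENNReal.ofReal_mul (by positivity)]
        ring_nf

/-- (Cor. of Fujii's bound.) For fixed `A > 0` and `k ≥ 0` there is a constant `C` depending
only on `A` and `k` with `(1/T) ∫_T^{2T} (N(t + A/log T) − N(t))^k dt ≤ C` for all
`T ≥ 3`. -/
theorem stmt_18 (A : ℝ) (hA : 0 < A) (k : ℕ) :
    ∃ C : ℝ, ∀ T : ℝ, 3 ≤ T →
      (∫ t in T..(2 * T), (zetaN (t + A / Real.log T) - zetaN t) ^ k) / T ≤ C := by
  obtain ⟨C, T₀, h⟩ := exists_integral_zetaN_sub_pow_le_of_large hA k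
  refine ⟨max C (zetaN (2 * T₀ + A) ^ k), fun T hT => ?_⟩
  have hT0 : 0 < T := by linarith
  rw [div_le_iff₀ hT0]
  rcases le_or_gt T₀ T with hT' | hT'
  · exact (h T hT').trans (by gcongr; exact le_max_left _ _)
  have hlog : 1 ≤ Real.log T := by
    rw [Real.le_log_iff_exp_le hT0]
    linarith [Real.exp_one_lt_d9]
  have hAlog : A / Real.log T ≤ A := div_le_self hA.le hlog
  have hbound : ∀ t ∈ Set.uIoc T (2 * T),
      ‖(zetaN (t + A / Real.log T) - zetaN t) ^ k‖ ≤ zetaN (2 * T₀ + A) ^ k := by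
    intro t ht
    rw [Set.uIoc_of_le (by linarith)] at ht
    have h0 : 0 ≤ zetaN (t + A / Real.log T) - zetaN t :=
      sub_nonneg.mpr (zetaN_mono (le_add_of_nonneg_right (by positivity)))
    rw [Real.norm_of_nonneg (pow_nonneg h0 k)]
    have h1 : zetaN (t + A / Real.log T) ≤ zetaN (2 * T₀ + A) := zetaN_mono (by linarith [ht.2])
    exact pow_le_pow_left₀ h0 (by linarith [zetaN_nonneg t]) k
  refine (le_abs_self _).trans
    ((intervalIntegral.norm_integral_le_of_norm_le_const hbound).trans ?_)
  rw [show 2 * T - T = T by ring, abs_of_pos hT0]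
  gcongr
  exact le_max_right _ _
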